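/- arXiv:1204.2604 — 3 statements merged into one kernel-verified Lean document; each statement's English description precedes it below -/
import Mathlib

section
/- If G is a 2-connected simple graph on n ≥ 7 vertices, then ξ_m(G) ≤ n² − 7n + 12. -/
open Finset

namespace Forwarding

variable {V : Type*} [Fintype V] [DecidableEq V]

/-- A routing of a graph `G`: for every ordered pair of vertices, a fixed path.
(For `x = y` the path condition forces the trivial walk, so only the
`n(n-1)` paths between distinct vertices matter.) -/
structure Routing (G : SimpleGraph V) where
  walk : ∀ x y : V, G.Walk x y
  isPath : ∀ x y : V, (walk x y).IsPath

/-- A routing is minimal if every specified path is a shortest path. -/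
def Routing.IsMinimal {G : SimpleGraph V} (R : Routing G) : Prop :=
  ∀ x y : V, (R.walk x y).length = G.dist x y

/-- The load of a vertex `x`: the number of paths of the routing passing
through `x` as an internal vertex. -/
def vertexLoad {G : SimpleGraph V} (R : Routing G) (x : V) : ℕ :=
  (univ.filter fun p : V × V =>
    p.1 ≠ p.2 ∧ x ∈ (R.walk p.1 p.2).support ∧ x ≠ p.1 ∧ x ≠ p.2).card

/-- The load of an edge `e`: the number of paths of the routing traversing `e`. -/
def edgeLoad {G : SimpleGraph V} (R : Routing G) (e : Sym2 V) : ℕ :=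
  (univ.filter fun p : V × V => p.1 ≠ p.2 ∧ e ∈ (R.walk p.1 p.2).edges).card

/-- `ξ(G,R)`: the maximum vertex load of the routing `R`. -/
def routingVertexIndex {G : SimpleGraph V} (R : Routing G) : ℕ :=
  univ.sup (vertexLoad R)

/-- `π(G,R)`: the maximum edge load of the routing `R`. (Edges not in `G`
carry load `0`, so taking the `sup` over all of `Sym2 V` is equivalent.) -/
def routingEdgeIndex {G : SimpleGraph V} (R : Routing G) : ℕ :=
  univ.sup (edgeLoad R)

/-- The vertex-forwarding index `ξ(G)`. -/
noncomputable def xi (G : SimpleGraph V) : ℕ :=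
  sInf { k | ∃ R : Routing G, routingVertexIndex R = k }

/-- The vertex-forwarding index over minimal routings, `ξ_m(G)`. -/
noncomputable def xiMin (G : SimpleGraph V) : ℕ :=
  sInf { k | ∃ R : Routing G, R.IsMinimal ∧ routingVertexIndex R = k }

/-- The edge-forwarding index `π(G)`. -/
noncomputable def piIdx (G : SimpleGraph V) : ℕ :=
  sInf { k | ∃ R : Routing G, routingEdgeIndex R = k }

/-- The edge-forwarding index over minimal routings, `π_m(G)`. -/
noncomputable def piMinIdx (G : SimpleGraph V) : ℕ :=
  sInf { k | ∃ R : Routing G, R.IsMinimal ∧ routingEdgeIndex R = k }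

end Forwarding

/-- `G` is `k`-connected: `n > k` and removing any set of fewer than `k`
vertices leaves a connected induced subgraph. -/
def IsKConnected {V : Type*} [Fintype V] (k : ℕ) (G : SimpleGraph V) : Prop :=
  k < Fintype.card V ∧
    ∀ s : Finset V, s.card < k → (G.induce ((↑s : Set V)ᶜ)).Connected

set_option linter.unusedSectionVars false

namespace XiAux

open Forwarding

variable {V : Type*} [Fintype V] [DecidableEq V]

/-- Vertex-deleted connectivity: an edge leaves `S` avoiding `x`. -/
lemma cross {G : SimpleGraph V} (hG : IsKConnected 2 G) (x : V) (S : Finset V)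
    (hS : S.Nonempty) (hx : x ∉ S) (hw : ∃ w, w ∉ S ∧ w ≠ x) :
    ∃ z ∈ S, ∃ w, w ∉ S ∧ w ≠ x ∧ G.Adj z w := by
  obtain ⟨s, hs⟩ := hS
  obtain ⟨w, hwS, hwx⟩ := hw
  have hc := hG.2 {x} (by simp)
  have hsx : s ≠ x := fun h => hx (h ▸ hs)
  let s' : ((↑({x} : Finset V) : Set V)ᶜ : Set V) := ⟨s, by simpa using hsx⟩
  let w' : ((↑({x} : Finset V) : Set V)ᶜ : Set V) := ⟨w, by simpa using hwx⟩
  obtain ⟨p⟩ := hc.preconnected s' w'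
  obtain ⟨d, -, h1, h2⟩ := p.exists_boundary_dart {v | (v : V) ∈ S} hs hwS
  refine ⟨d.fst, h1, d.snd, h2, ?_, ?_⟩
  · have := d.snd.2
    simpa using this
  · have := d.adj
    simpa using this

lemma conn {G : SimpleGraph V} (hG : IsKConnected 2 G) : G.Connected := by
  have hc := hG.2 ∅ (by simp)
  have hne : Nonempty V := Fintype.card_pos_iff.1 (by have := hG.1; omega)
  refine ⟨fun a b => ?_⟩
  have := hc.preconnected ⟨a, by simp⟩ ⟨b, by simp⟩
  exact this.map (SimpleGraph.Embedding.induce _).toHom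

/-- Ordered pairs at distance at most two, avoiding `x`. -/
def Near (G : SimpleGraph V) (x : V) (p : V × V) : Prop :=
  p.1 ≠ p.2 ∧ (G.Adj p.1 p.2 ∨ ∃ y, y ≠ x ∧ G.Adj p.1 y ∧ G.Adj y p.2)

open Classical in
lemma grow {G : SimpleGraph V} (hG : IsKConnected 2 G) (x : V) (k : ℕ)
    (hk : k + 3 ≤ Fintype.card V) :
    ∃ S : Finset V, S.card = k + 2 ∧ x ∉ S ∧ (∀ z ∈ S, ∃ z' ∈ S, G.Adj z z') ∧
      2 * (2 * k + 1) ≤ ((S ×ˢ S).filter (Near G x)).card := by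
  induction k with
  | zero =>
    have h2 : ∃ s, s ≠ x := by
      have : Nontrivial V := Fintype.one_lt_card_iff_nontrivial.1 (by omega)
      exact exists_ne x
    obtain ⟨s, hs⟩ := h2
    have h3 : ∃ w, w ∉ ({s} : Finset V) ∧ w ≠ x := by
      by_contra! h
      have : (univ : Finset V) ⊆ {s, x} := by
        intro w _
        by_cases hws : w = s
        · simp [hws]
        · have := h w (by simpa using hws)
          simp [this]
      have := Finset.card_le_card this
      have h4 : ({s, x} : Finset V).card ≤ 2 := Finset.card_le_two
      rw [Finset.card_univ] at this
      omega
    obtain ⟨z, hz, w, hwS, hwx, hzw⟩ := cross hG x {s} (by simp) (by simpa using hs.symm) h3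
    have hzs : z = s := by simpa using hz
    subst hzs
    have hne : z ≠ w := hzw.ne
    refine ⟨{z, w}, by simp [hne], ?_, ?_, ?_⟩
    · simp [hs.symm, hwx.symm]
    · intro t ht
      simp only [Finset.mem_insert, Finset.mem_singleton] at ht
      rcases ht with rfl | rfl
      · exact ⟨w, by simp, hzw⟩
      · exact ⟨z, by simp, hzw.symm⟩
    · have : ({(z, w), (w, z)} : Finset (V × V)) ⊆
          (({z, w} ×ˢ {z, w} : Finset (V × V)).filter (Near G x)) := by
        intro p hp
        simp only [Finset.mem_insert, Finset.mem_singleton] at hp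
        rcases hp with rfl | rfl
        · simp [Near, hne, hzw]
        · simp [Near, hne.symm, hzw.symm]
      refine le_trans ?_ (Finset.card_le_card this)
      rw [Finset.card_pair]
      simp [hne]
  | succ k ih =>
    obtain ⟨S, hc, hxS, hnb, hcard⟩ := ih (by omega)
    have h3 : ∃ w, w ∉ S ∧ w ≠ x := by
      by_contra! h
      have : (univ : Finset V) ⊆ insert x S := by
        intro w _
        by_cases hws : w ∈ S
        · simp [hws]
        · simp [h w hws]
      have := Finset.card_le_card this
      have h4 := Finset.card_insert_le x S
      rw [Finset.card_univ] at this
      omega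
    obtain ⟨z, hz, w, hwS, hwx, hzw⟩ := cross hG x S
      (Finset.card_pos.1 (by omega)) hxS h3
    obtain ⟨z', hz', hzz'⟩ := hnb z hz
    have hzx : z ≠ x := fun h => hxS (h ▸ hz)
    have hwz : w ≠ z := fun h => hwS (h ▸ hz)
    have hwz' : w ≠ z' := fun h => hwS (h ▸ hz')
    refine ⟨insert w S, by rw [Finset.card_insert_of_notMem hwS, hc], ?_, ?_, ?_⟩
    · simp [hwx.symm, hxS]
    · intro t ht
      rcases Finset.mem_insert.1 ht with rfl | ht
      · exact ⟨z, by simp [hz], hzw.symm⟩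
      · obtain ⟨t', ht', h⟩ := hnb t ht
        exact ⟨t', by simp [ht'], h⟩
    · have hsub : ((S ×ˢ S).filter (Near G x)) ∪ {(w, z), (z, w), (w, z'), (z', w)} ⊆
          ((insert w S ×ˢ insert w S).filter (Near G x)) := by
        intro p hp
        rcases Finset.mem_union.1 hp with hp | hp
        · simp only [Finset.mem_filter, Finset.mem_product, Finset.mem_insert] at hp ⊢
          tauto
        · simp only [Finset.mem_insert, Finset.mem_singleton] at hp
          have h1 := hzw.symm
          have h2 := hzz'.symm
          rcases hp with rfl | rfl | rfl | rfl
          · simp [Near, hz, hwz, h1]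
          · simp [Near, hz, hwz.symm, hzw]
          · simp only [Finset.mem_filter, Finset.mem_product, Finset.mem_insert, Near]
            exact ⟨⟨Or.inl trivial, Or.inr hz'⟩, hwz', Or.inr ⟨z, hzx, h1, hzz'⟩⟩
          · simp only [Finset.mem_filter, Finset.mem_product, Finset.mem_insert, Near]
            exact ⟨⟨Or.inr hz', Or.inl trivial⟩, hwz'.symm, Or.inr ⟨z, hzx, h2, hzw⟩⟩
      refine le_trans ?_ (Finset.card_le_card hsub)
      rw [Finset.card_union_of_disjoint]
      · have h4 : ({(w, z), (z, w), (w, z'), (z', w)} : Finset (V × V)).card = 4 := by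
          have := hzz'.ne
          rw [Finset.card_insert_of_notMem, Finset.card_insert_of_notMem,
            Finset.card_insert_of_notMem, Finset.card_singleton]
          all_goals simp
          all_goals grind
        omega
      · rw [Finset.disjoint_left]
        intro p hp hp'
        simp only [Finset.mem_filter, Finset.mem_product] at hp
        simp only [Finset.mem_insert, Finset.mem_singleton] at hp'
        grind

lemma geo {G : SimpleGraph V} {p q x : V} (W : G.Walk p q)
    (hl : W.length = G.dist p q) (hx : x ∈ W.support) (hc : G.Connected) :
    G.dist p x + G.dist x q = G.dist p q := by
  have h1 := congrArg SimpleGraph.Walk.length (W.take_spec hx)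
  rw [SimpleGraph.Walk.length_append] at h1
  have h2 := SimpleGraph.dist_le (W.takeUntil x hx)
  have h3 := SimpleGraph.dist_le (W.dropUntil x hx)
  have h4 : G.dist p q ≤ G.dist p x + G.dist x q := hc.dist_triangle
  omega

lemma geo2 {G : SimpleGraph V} {p q x y : V} (W : G.Walk p q)
    (hl : W.length = G.dist p q) (hx : x ∈ W.support) (hy : y ∈ W.support)
    (hc : G.Connected) :
    (G.dist p y + G.dist y x + G.dist x q = G.dist p q) ∨
    (G.dist p x + G.dist x y + G.dist y q = G.dist p q) := by
  have h0 := geo W hl hx hc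
  have h1 := congrArg SimpleGraph.Walk.length (W.take_spec hx)
  rw [SimpleGraph.Walk.length_append] at h1
  have h2 := SimpleGraph.dist_le (W.takeUntil x hx)
  have h3 := SimpleGraph.dist_le (W.dropUntil x hx)
  have hy' := hy
  rw [← W.take_spec hx, SimpleGraph.Walk.mem_support_append_iff] at hy'
  rcases hy' with h | h
  · left
    have := geo (W.takeUntil x hx) (by omega) h hc
    omega
  · right
    have := geo (W.dropUntil x hx) (by omega) h hc
    omega

lemma exists_minimal_routing {G : SimpleGraph V} (hc : G.Connected) :
    ∃ R : Routing G, R.IsMinimal := by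
  choose f hf using fun a b : V => hc.exists_walk_length_eq_dist a b
  exact ⟨⟨f, fun a b => SimpleGraph.Walk.isPath_of_length_eq_dist _ (hf a b)⟩, hf⟩

/-- The pairs counted in the load. -/
def Ld {G : SimpleGraph V} (R : Routing G) (x : V) : Finset (V × V) :=
  univ.filter fun p : V × V =>
    p.1 ≠ p.2 ∧ x ∈ (R.walk p.1 p.2).support ∧ x ≠ p.1 ∧ x ≠ p.2

lemma vertexLoad_eq {G : SimpleGraph V} (R : Routing G) (x : V) :
    vertexLoad R x = (Ld R x).card := rfl

lemma mem_Ld {G : SimpleGraph V} (R : Routing G) (x p q : V) :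
    (p, q) ∈ Ld R x ↔ p ≠ q ∧ x ∈ (R.walk p q).support ∧ x ≠ p ∧ x ≠ q := by
  simp [Ld]

/-- Replace one path. -/
def reroute {G : SimpleGraph V} (R : Routing G) (u v : V) (W : G.Walk u v) (hW : W.IsPath) :
    Routing G where
  walk := Function.update R.walk u (Function.update (R.walk u) v W)
  isPath := by
    intro a b
    by_cases ha : a = u
    · subst ha
      rw [Function.update_self]
      by_cases hb : b = v
      · subst hb
        rw [Function.update_self]
        exact hW
      · rw [Function.update_of_ne hb]
        exact R.isPath _ _
    · rw [Function.update_of_ne ha]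
      exact R.isPath _ _

lemma reroute_self {G : SimpleGraph V} (R : Routing G) (u v : V) (W : G.Walk u v)
    (hW : W.IsPath) : (reroute R u v W hW).walk u v = W := by
  simp [reroute]

lemma reroute_ne {G : SimpleGraph V} (R : Routing G) (u v : V) (W : G.Walk u v)
    (hW : W.IsPath) (a b : V) (h : ¬ (a = u ∧ b = v)) :
    (reroute R u v W hW).walk a b = R.walk a b := by
  by_cases ha : a = u
  · subst ha
    have hb : b ≠ v := fun hb => h ⟨rfl, hb⟩
    simp [reroute, Function.update_of_ne hb]
  · simp [reroute, Function.update_of_ne ha]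

/-- Key exchange: in a routing of minimal sum of squares of loads. -/
lemma exchange {G : SimpleGraph V} (hc : G.Connected) (R : Routing G) (hR : R.IsMinimal)
    (hmin : ∀ R' : Routing G, R'.IsMinimal →
      ∑ z, (vertexLoad R z) ^ 2 ≤ ∑ z, (vertexLoad R' z) ^ 2)
    (u v x y : V) (hxy : x ≠ y) (huv : u ≠ v) (hnadj : ¬ G.Adj u v)
    (huy : G.Adj u y) (hyv : G.Adj y v)
    (hx : (u, v) ∈ Ld R x) : G.Adj u x ∧ G.Adj x v ∧
      vertexLoad R x ≤ vertexLoad R y + 1 := by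
  let W : G.Walk u v := SimpleGraph.Walk.cons huy (SimpleGraph.Walk.cons hyv .nil)
  have hWs : W.support = [u, y, v] := rfl
  have hWl : W.length = 2 := rfl
  have hd1 : G.dist u v ≤ 2 := by
    have := SimpleGraph.dist_le W
    omega
  have hd0 : 0 < G.dist u v := hc.pos_dist_of_ne huv
  have hdn : G.dist u v ≠ 1 := fun h => hnadj (SimpleGraph.dist_eq_one_iff_adj.1 h)
  have hd : G.dist u v = 2 := by omega
  have hWp : W.IsPath := SimpleGraph.Walk.isPath_of_length_eq_dist _ (by omega)
  -- internal vertices of the old path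
  have hl : (R.walk u v).length = G.dist u v := hR u v
  have hin : ∀ z, z ∈ (R.walk u v).support → z ≠ u → z ≠ v → z = x := by
    intro z hz hzu hzv
    rw [mem_Ld] at hx
    by_contra hzx
    have a1 := hc.pos_dist_of_ne hzu.symm
    have a2 := hc.pos_dist_of_ne hzv
    have a3 := hc.pos_dist_of_ne hzx
    have a4 := hc.pos_dist_of_ne hx.2.2.1.symm
    have a5 := hc.pos_dist_of_ne hx.2.2.2
    have a6 := hc.pos_dist_of_ne (Ne.symm hzx)
    rcases geo2 _ hl hx.2.1 hz hc with h | h <;> omega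
  have hx' := (mem_Ld R x u v).1 hx
  have hg := geo _ hl hx'.2.1 hc
  have a4 := hc.pos_dist_of_ne hx'.2.2.1.symm
  have a5 := hc.pos_dist_of_ne hx'.2.2.2
  refine ⟨SimpleGraph.dist_eq_one_iff_adj.1 (by omega),
    SimpleGraph.dist_eq_one_iff_adj.1 (by omega), ?_⟩
  set R' := reroute R u v W hWp with hR'
  have hR'm : R'.IsMinimal := by
    intro a b
    by_cases h : a = u ∧ b = v
    · obtain ⟨rfl, rfl⟩ := h
      rw [hR', reroute_self]
      omega
    · rw [hR', reroute_ne _ _ _ _ _ _ _ h]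
      exact hR a b
  have hLx : Ld R' x = (Ld R x).erase (u, v) := by
    ext ⟨a, b⟩
    by_cases h : a = u ∧ b = v
    · obtain ⟨rfl, rfl⟩ := h
      simp only [mem_Ld, hR', reroute_self, hWs, Finset.mem_erase]
      simp
      tauto
    · rw [Finset.mem_erase, mem_Ld, mem_Ld, hR', reroute_ne _ _ _ _ _ _ _ h]
      simp only [ne_eq, Prod.mk.injEq, h, not_false_eq_true, true_and]
  have hynot : (u, v) ∉ Ld R y := by
    intro h
    rw [mem_Ld] at h
    exact hxy (hin y h.2.1 h.2.2.1 h.2.2.2).symm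
  have hLy : Ld R' y = insert (u, v) (Ld R y) := by
    ext ⟨a, b⟩
    by_cases h : a = u ∧ b = v
    · obtain ⟨rfl, rfl⟩ := h
      simp only [mem_Ld, hR', reroute_self, hWs, Finset.mem_insert]
      have := huy.ne
      have := hyv.ne
      simp
      grind
    · rw [Finset.mem_insert, mem_Ld, mem_Ld, hR', reroute_ne _ _ _ _ _ _ _ h]
      simp only [ne_eq, Prod.mk.injEq, h, false_or]
  have hLz : ∀ z, z ≠ x → z ≠ y → Ld R' z = Ld R z := by
    intro z hzx hzy
    ext ⟨a, b⟩
    by_cases h : a = u ∧ b = v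
    · obtain ⟨rfl, rfl⟩ := h
      simp only [mem_Ld, hR', reroute_self, hWs]
      constructor
      · rintro ⟨_, h1, h2, h3⟩
        simp at h1
        tauto
      · rintro ⟨_, h1, h2, h3⟩
        exact absurd (hin z h1 h2 h3) hzx
    · rw [mem_Ld, mem_Ld, hR', reroute_ne _ _ _ _ _ _ _ h]
  have cx : vertexLoad R' x + 1 = vertexLoad R x := by
    rw [vertexLoad_eq, vertexLoad_eq, hLx]
    exact Finset.card_erase_add_one hx
  have cy : vertexLoad R' y = vertexLoad R y + 1 := by
    rw [vertexLoad_eq, vertexLoad_eq, hLy, Finset.card_insert_of_notMem hynot]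
  have hs := hmin R' hR'm
  have hyu : y ∈ univ.erase x := by simp [hxy.symm]
  rw [← Finset.add_sum_erase univ _ (Finset.mem_univ x),
    ← Finset.add_sum_erase univ _ (Finset.mem_univ x),
    ← Finset.add_sum_erase _ _ hyu, ← Finset.add_sum_erase _ _ hyu] at hs
  have hrest : ∑ z ∈ (univ.erase x).erase y, (vertexLoad R' z) ^ 2 =
      ∑ z ∈ (univ.erase x).erase y, (vertexLoad R z) ^ 2 := by
    apply Finset.sum_congr rfl
    intro z hz
    simp only [Finset.mem_erase, Finset.mem_univ, and_true] at hz
    rw [vertexLoad_eq, vertexLoad_eq, hLz z hz.2 hz.1]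
  rw [hrest, cy, ← cx] at hs
  rw [← cx]
  nlinarith

/-- Vertices strictly closer to `x` than to `y`, other than `x`. -/
noncomputable def Cl (G : SimpleGraph V) (x y : V) : Finset V :=
  open Classical in univ.filter fun p => p ≠ x ∧ G.dist p x < G.dist p y

lemma mem_Cl {G : SimpleGraph V} {x y p : V} :
    p ∈ Cl G x y ↔ p ≠ x ∧ G.dist p x < G.dist p y := by
  simp [Cl]

lemma Cl_not_adj {G : SimpleGraph V} (hc : G.Connected) {x y p : V} (hp : p ∈ Cl G x y) :
    ¬ G.Adj p y := by
  intro h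
  rw [mem_Cl] at hp
  have h1 := SimpleGraph.dist_eq_one_iff_adj.2 h
  have h2 := hc.pos_dist_of_ne hp.1
  omega

lemma Cl_ne {G : SimpleGraph V} {x y p : V} (hp : p ∈ Cl G x y) :
    p ≠ x ∧ p ≠ y := by
  rw [mem_Cl] at hp
  refine ⟨hp.1, ?_⟩
  rintro rfl
  have := hp.2
  simp at this

lemma Cl_disj {G : SimpleGraph V} {x y p : V} (hp : p ∈ Cl G x y) (hp' : p ∈ Cl G y x) :
    False := by
  rw [mem_Cl] at hp hp'
  omega

/-- Adjacent ordered pairs outside `x, y`. -/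
noncomputable def DD (G : SimpleGraph V) (x y : V) : Finset (V × V) :=
  open Classical in univ.filter fun p => G.Adj p.1 p.2 ∧ p.1 ≠ x ∧ p.1 ≠ y ∧ p.2 ≠ x ∧ p.2 ≠ y

/-- Edges between the two sides. -/
noncomputable def EE (G : SimpleGraph V) (x y : V) : Finset (V × V) :=
  open Classical in (Cl G x y ×ˢ Cl G y x).filter fun p => G.Adj p.1 p.2

lemma mem_DD {G : SimpleGraph V} {x y : V} {p : V × V} : p ∈ DD G x y ↔
    G.Adj p.1 p.2 ∧ p.1 ≠ x ∧ p.1 ≠ y ∧ p.2 ≠ x ∧ p.2 ≠ y := by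
  simp [DD]

lemma mem_EE {G : SimpleGraph V} {x y : V} {p : V × V} : p ∈ EE G x y ↔
    (p.1 ∈ Cl G x y ∧ p.2 ∈ Cl G y x) ∧ G.Adj p.1 p.2 := by
  simp [EE]

lemma EE_swap (G : SimpleGraph V) (x y : V) : (EE G y x).card = (EE G x y).card := by
  apply Finset.card_bij (fun p _ => p.swap)
  · rintro ⟨a, b⟩ h
    rw [mem_EE] at *
    exact ⟨⟨h.1.2, h.1.1⟩, h.2.symm⟩
  · rintro ⟨a, b⟩ _ ⟨c, d⟩ _ h
    simpa [Prod.swap, and_comm] using h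
  · rintro ⟨a, b⟩ h
    refine ⟨(b, a), ?_, rfl⟩
    rw [mem_EE] at *
    exact ⟨⟨h.1.2, h.1.1⟩, h.2.symm⟩

lemma DD_even (G : SimpleGraph V) (x y : V) : Even (DD G x y).card := by
  have h : ∑ _p ∈ DD G x y, (1 : ZMod 2) = 0 := by
    apply Finset.sum_involution (fun p _ => p.swap)
    · intro a _
      decide
    · rintro ⟨a, b⟩ h _ h'
      rw [mem_DD] at h
      simp only [Prod.swap, Prod.mk.injEq] at h'
      exact h.1.ne h'.2
    · intro a _
      simp
    · rintro ⟨a, b⟩ h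
      rw [mem_DD] at *
      exact ⟨h.1.symm, h.2.2.2.1, h.2.2.2.2, h.2.1, h.2.2.1⟩
  simp only [Finset.sum_const, nsmul_eq_mul, mul_one] at h
  exact (ZMod.natCast_eq_zero_iff_even).1 h

/-- The set of pairs used by both. -/
lemma both_bound {G : SimpleGraph V} (hc : G.Connected) (R : Routing G) (hR : R.IsMinimal)
    (x y : V) (hxy : x ≠ y) :
    (Ld R x ∩ Ld R y).card + 2 * (EE G x y).card ≤
      2 * ((Cl G x y).card * (Cl G y x).card) := by
  have hsub : Ld R x ∩ Ld R y ⊆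
      ((Cl G x y ×ˢ Cl G y x) \ EE G x y) ∪ ((Cl G y x ×ˢ Cl G x y) \ EE G y x) := by
    rintro ⟨p, q⟩ h
    rw [Finset.mem_inter, mem_Ld, mem_Ld] at h
    obtain ⟨⟨hpq, hx, hxp, hxq⟩, -, hy, hyp, hyq⟩ := h
    have g1 := geo _ (hR p q) hx hc
    have g2 := geo _ (hR p q) hy hc
    have b1 := hc.pos_dist_of_ne hxp
    have b2 := hc.pos_dist_of_ne hxq
    have b3 := hc.pos_dist_of_ne hxy
    have e1 : G.dist x p = G.dist p x := SimpleGraph.dist_comm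
    have e2 : G.dist x q = G.dist q x := SimpleGraph.dist_comm
    have e3 : G.dist y q = G.dist q y := SimpleGraph.dist_comm
    have e4 : G.dist y x = G.dist x y := SimpleGraph.dist_comm
    have hna : ¬ G.Adj p q := by
      intro h
      have := SimpleGraph.dist_eq_one_iff_adj.2 h
      omega
    have hna' : ¬ G.Adj q p := fun h => hna h.symm
    simp only [Finset.mem_union, Finset.mem_sdiff, Finset.mem_product, mem_EE, mem_Cl, hna]
    rcases geo2 _ (hR p q) hx hy hc with h | h
    · right
      refine ⟨⟨⟨hyp.symm, by omega⟩, hxq.symm, by omega⟩, by simp⟩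
    · left
      refine ⟨⟨⟨hxp.symm, by omega⟩, hyq.symm, by omega⟩, by simp⟩
  have h1 := (Finset.card_le_card hsub).trans (Finset.card_union_le _ _)
  have s1 : EE G x y ⊆ Cl G x y ×ˢ Cl G y x := by
    intro p hp
    rw [mem_EE] at hp
    exact Finset.mem_product.2 hp.1
  have s2 : EE G y x ⊆ Cl G y x ×ˢ Cl G x y := by
    intro p hp
    rw [mem_EE] at hp
    exact Finset.mem_product.2 hp.1
  have c1 := Finset.card_sdiff_add_card_eq_card s1
  have c2 := Finset.card_sdiff_add_card_eq_card s2
  rw [Finset.card_product] at c1 c2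
  rw [EE_swap] at c2
  have : (Cl G y x).card * (Cl G x y).card = (Cl G x y).card * (Cl G y x).card := mul_comm _ _
  omega

lemma union_bound {G : SimpleGraph V} (hc : G.Connected) (R : Routing G) (hR : R.IsMinimal)
    (x y : V) (hxy : x ≠ y) (hn : 3 ≤ Fintype.card V) :
    (Ld R x ∪ Ld R y).card + (DD G x y).card ≤
      (Fintype.card V - 2) * (Fintype.card V - 3)
        + 2 * ((Cl G x y).card + (Cl G y x).card) := by
  set W : Finset V := (univ.erase x).erase y with hW
  have hWc : W.card = Fintype.card V - 2 := by
    rw [hW, Finset.card_erase_of_mem (by simp [hxy.symm]),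
      Finset.card_erase_of_mem (by simp), Finset.card_univ]
    omega
  have hmW : ∀ p, p ∈ W ↔ p ≠ x ∧ p ≠ y := by
    intro p
    simp [hW, and_comm]
  have hD : DD G x y ⊆ W.offDiag := by
    intro p hp
    rw [mem_DD] at hp
    rw [Finset.mem_offDiag, hmW, hmW]
    exact ⟨⟨hp.2.1, hp.2.2.1⟩, ⟨hp.2.2.2.1, hp.2.2.2.2⟩, hp.1.ne⟩
  have hsub : Ld R x ∪ Ld R y ⊆ (W.offDiag \ DD G x y) ∪
      ((({x} ×ˢ Cl G y x) ∪ (Cl G y x ×ˢ {x})) ∪ (({y} ×ˢ Cl G x y) ∪ (Cl G x y ×ˢ {y}))) := by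
    have key : ∀ z p q, (p, q) ∈ Ld R z → p ≠ q ∧ z ≠ p ∧ z ≠ q ∧ ¬ G.Adj p q ∧
        G.dist p z < G.dist p q ∧ G.dist q z < G.dist q p := by
      intro z p q h
      rw [mem_Ld] at h
      obtain ⟨hpq, hx, hxp, hxq⟩ := h
      have g1 := geo _ (hR p q) hx hc
      have b1 := hc.pos_dist_of_ne hxp
      have b2 := hc.pos_dist_of_ne hxq
      have e1 : G.dist z p = G.dist p z := SimpleGraph.dist_comm
      have e2 : G.dist z q = G.dist q z := SimpleGraph.dist_comm
      have e3 : G.dist q p = G.dist p q := SimpleGraph.dist_comm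
      refine ⟨hpq, hxp, hxq, ?_, by omega, by omega⟩
      intro h
      have := SimpleGraph.dist_eq_one_iff_adj.2 h
      omega
    rintro ⟨p, q⟩ h
    simp only [Finset.mem_union, Finset.mem_sdiff, Finset.mem_offDiag, hmW, mem_DD,
      Finset.mem_product, Finset.mem_singleton, mem_Cl]
    rcases Finset.mem_union.1 h with h | h
    · obtain ⟨h1, h2, h3, h4, h5, h6⟩ := key _ _ _ h
      by_cases hpy : p = y
      · subst hpy
        right; right; left
        exact ⟨rfl, h3.symm, h6⟩
      · by_cases hqy : q = y
        · subst hqy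
          right; right; right
          exact ⟨⟨h2.symm, h5⟩, rfl⟩
        · left
          exact ⟨⟨⟨h2.symm, hpy⟩, ⟨h3.symm, hqy⟩, h1⟩, fun h => h4 h.1⟩
    · obtain ⟨h1, h2, h3, h4, h5, h6⟩ := key _ _ _ h
      by_cases hpx : p = x
      · subst hpx
        right; left; left
        exact ⟨rfl, h3.symm, h6⟩
      · by_cases hqx : q = x
        · subst hqx
          right; left; right
          exact ⟨⟨h2.symm, h5⟩, rfl⟩
        · left
          exact ⟨⟨⟨hpx, h2.symm⟩, ⟨hqx, h3.symm⟩, h1⟩, fun h => h4 h.1⟩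
  have c0 := Finset.card_le_card hsub
  have c1 := Finset.card_union_le (W.offDiag \ DD G x y)
      ((({x} ×ˢ Cl G y x) ∪ (Cl G y x ×ˢ {x})) ∪ (({y} ×ˢ Cl G x y) ∪ (Cl G x y ×ˢ {y})))
  have c2 := Finset.card_union_le
      (({x} ×ˢ Cl G y x) ∪ (Cl G y x ×ˢ {x})) (({y} ×ˢ Cl G x y) ∪ (Cl G x y ×ˢ {y}))
  have c3 := Finset.card_union_le ({x} ×ˢ Cl G y x) (Cl G y x ×ˢ {x})
  have c4 := Finset.card_union_le ({y} ×ˢ Cl G x y) (Cl G x y ×ˢ {y})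
  simp only [Finset.card_product, Finset.card_singleton, one_mul, mul_one] at c3 c4
  have c5 := Finset.card_sdiff_add_card_eq_card hD
  rw [Finset.offDiag_card, hWc] at c5
  obtain ⟨m, hm⟩ := Nat.exists_eq_add_of_le hn
  have e : (Fintype.card V - 2) * (Fintype.card V - 2) - (Fintype.card V - 2) =
      (Fintype.card V - 2) * (Fintype.card V - 3) := by
    rw [hm]
    have h1 : 3 + m - 2 = m + 1 := by omega
    have h2 : 3 + m - 3 = m := by omega
    rw [h1, h2, Nat.mul_succ]
    omega
  rw [e] at c5
  omega

/-- Every vertex on a side has a neighbour outside `x, y`. -/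
lemma deg_pos {G : SimpleGraph V} (hG : IsKConnected 2 G) {x y p : V}
    (hn : 3 ≤ Fintype.card V)
    (hp : p ∈ Cl G x y) : ∃ q, (p, q) ∈ DD G x y := by
  have hpn := Cl_ne hp
  have h3 : ∃ w, w ∉ ({p} : Finset V) ∧ w ≠ x := by
    refine ⟨y, by simpa using hpn.2.symm, ?_⟩
    rintro rfl
    rw [mem_Cl] at hp
    omega
  obtain ⟨z, hz, w, -, hwx, hzw⟩ := cross hG x {p} (by simp) (by simpa using hpn.1.symm) h3
  have : z = p := by simpa using hz
  subst this
  refine ⟨w, mem_DD.2 ⟨hzw, hpn.1, hpn.2, hwx, ?_⟩⟩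
  rintro rfl
  exact Cl_not_adj (conn hG) hp hzw

/-- An edge leaving a side. -/
lemma side_edge {G : SimpleGraph V} (hG : IsKConnected 2 G) {x y : V}
    (hne : (Cl G x y).Nonempty) :
    ∃ a ∈ Cl G x y, ∃ w, w ∉ Cl G x y ∧ (a, w) ∈ DD G x y := by
  have h3 : ∃ w, w ∉ Cl G x y ∧ w ≠ x := by
    refine ⟨y, fun h => (Cl_ne h).2 rfl, ?_⟩
    rintro rfl
    obtain ⟨p, hp⟩ := hne
    rw [mem_Cl] at hp
    omega
  obtain ⟨z, hz, w, hw, hwx, hzw⟩ := cross hG x _ hne (fun h => (Cl_ne h).1 rfl) h3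
  refine ⟨z, hz, w, hw, mem_DD.2 ⟨hzw, (Cl_ne hz).1, (Cl_ne hz).2, hwx, ?_⟩⟩
  rintro rfl
  exact Cl_not_adj (conn hG) hz hzw

lemma DD_symm {G : SimpleGraph V} {x y p q : V} (h : (p, q) ∈ DD G x y) :
    (q, p) ∈ DD G x y := by
  rw [mem_DD] at *
  exact ⟨h.1.symm, h.2.2.2.1, h.2.2.2.2, h.2.1, h.2.2.1⟩

lemma DD_comm {G : SimpleGraph V} {x y : V} {p : V × V} (h : p ∈ DD G x y) :
    p ∈ DD G y x := by
  rw [mem_DD] at *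
  tauto

lemma DD_ge {G : SimpleGraph V} (hG : IsKConnected 2 G) (x y : V)
    (hn : 3 ≤ Fintype.card V) :
    (Cl G x y).card + (Cl G y x).card ≤
      ((DD G x y).filter fun p => p.1 ∈ Cl G x y ∪ Cl G y x).card := by
  rw [← Finset.card_union_of_disjoint
    (Finset.disjoint_left.2 fun p h h' => Cl_disj h h')]
  refine le_trans (Finset.card_le_card ?_) (Finset.card_image_le (f := Prod.fst))
  intro p hp
  rw [Finset.mem_image]
  rcases Finset.mem_union.1 hp with h | h
  · obtain ⟨q, hq⟩ := deg_pos hG hn h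
    exact ⟨(p, q), Finset.mem_filter.2 ⟨hq, hp⟩, rfl⟩
  · obtain ⟨q, hq⟩ := deg_pos hG hn h
    exact ⟨(p, q), Finset.mem_filter.2 ⟨DD_comm hq, hp⟩, rfl⟩

lemma weight {G : SimpleGraph V} (hG : IsKConnected 2 G) (x y : V)
    (hn : 3 ≤ Fintype.card V) (ha : (Cl G x y).Nonempty) (hb : (Cl G y x).Nonempty) :
    (Cl G x y).card + (Cl G y x).card + 2 ≤ (DD G x y).card + 2 * (EE G x y).card := by
  have h1 := DD_ge hG x y hn
  have h2 : ((DD G x y).filter fun p => p.1 ∈ Cl G x y ∪ Cl G y x).card ≤ (DD G x y).card :=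
    Finset.card_filter_le _ _
  by_cases hE : (EE G x y).Nonempty
  · have := Finset.card_pos.2 hE
    omega
  · obtain ⟨a, haA, w, hwA, hD⟩ := side_edge hG ha
    obtain ⟨b, hbB, w', hwB', hD'⟩ := side_edge hG hb
    replace hD' := DD_comm hD'
    have hwB : w ∉ Cl G y x := fun h =>
      hE ⟨(a, w), mem_EE.2 ⟨⟨haA, h⟩, (mem_DD.1 hD).1⟩⟩
    have hwA' : w' ∉ Cl G x y := fun h =>
      hE ⟨(w', b), mem_EE.2 ⟨⟨h, hbB⟩, (mem_DD.1 hD').1.symm⟩⟩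
    have hne : (w, a) ≠ (w', b) := by
      intro h
      have : a = b := (Prod.mk.inj h).2
      subst this
      exact Cl_disj haA hbB
    have h3 : ({(w, a), (w', b)} : Finset (V × V)) ⊆
        (DD G x y).filter fun p => ¬ (p.1 ∈ Cl G x y ∪ Cl G y x) := by
      intro p hp
      simp only [Finset.mem_insert, Finset.mem_singleton] at hp
      rcases hp with rfl | rfl
      · simp [DD_symm hD, hwA, hwB]
      · simp [DD_symm hD', hwA', hwB']
    have h4 := Finset.card_le_card h3
    rw [Finset.card_pair hne] at h4
    have h5 := Finset.card_filter_add_card_filter_not (s := DD G x y)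
      (fun p => p.1 ∈ Cl G x y ∪ Cl G y x)
    omega

lemma arith (n a b d e L : ℤ) (hn : 7 ≤ n) (ha : 0 ≤ a) (hb : 0 ≤ b) (he : 0 ≤ e)
    (hab : a + b ≤ n - 4) (hd : a + b ≤ d) (hev : Even d)
    (hw : 1 ≤ a → 1 ≤ b → a + b + 2 ≤ d + 2 * e)
    (hL : L + d + 2 * e ≤ (n - 2) * (n - 3) + 2 * (a + b) + 2 * (a * b)) :
    L ≤ 2 * (n ^ 2 - 7 * n + 12) := by
  obtain ⟨k, rfl⟩ := hev
  rcases lt_or_ge a 1 with h | h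
  · have : a = 0 := by omega
    subst this
    nlinarith
  rcases lt_or_ge b 1 with h' | h'
  · have : b = 0 := by omega
    subst this
    nlinarith
  have hw' := hw h h'
  have hsq : 4 * (a * b) ≤ (a + b) ^ 2 := by nlinarith [sq_nonneg (a - b)]
  rcases lt_or_ge n 11 with h11 | h11
  · have hb6 : b ≤ 6 := by omega
    have ha6 : a ≤ 6 := by omega
    interval_cases n <;> interval_cases a <;> interval_cases b <;> omega
  · have : (a + b) ^ 2 ≤ (n - 4) ^ 2 := by
      apply pow_le_pow_left₀ <;> omega
    nlinarith

lemma pair_bound {G : SimpleGraph V} (hG : IsKConnected 2 G) (hn : 7 ≤ Fintype.card V)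
    (R : Routing G) (hR : R.IsMinimal) (x y u v : V) (hxy : x ≠ y) (huv : u ≠ v)
    (hux : G.Adj u x) (huy : G.Adj u y) (hvx : G.Adj v x) (hvy : G.Adj v y) :
    ((vertexLoad R x + vertexLoad R y : ℕ) : ℤ) ≤
      2 * ((Fintype.card V : ℤ) ^ 2 - 7 * (Fintype.card V : ℤ) + 12) := by
  have hc := conn hG
  have h1 := both_bound hc R hR x y hxy
  have h2 := union_bound hc R hR x y hxy (by omega)
  have h3 := Finset.card_union_add_card_inter (Ld R x) (Ld R y)
  have h4 := DD_ge hG x y (by omega)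
  have h5 : ((DD G x y).filter fun p => p.1 ∈ Cl G x y ∪ Cl G y x).card ≤ (DD G x y).card :=
    Finset.card_filter_le _ _
  have h6 := weight hG x y (by omega)
  have h7 := DD_even G x y
  have hab : (Cl G x y).card + (Cl G y x).card + 4 ≤ Fintype.card V := by
    have hdis : Disjoint (Cl G x y) (Cl G y x) :=
      Finset.disjoint_left.2 fun p h h' => Cl_disj h h'
    have hdis2 : Disjoint (Cl G x y ∪ Cl G y x) ({x, y, u, v} : Finset V) := by
      rw [Finset.disjoint_left]
      intro p hp hp'
      simp only [Finset.mem_insert, Finset.mem_singleton] at hp'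
      rcases hp' with rfl | rfl | rfl | rfl
      · rcases Finset.mem_union.1 hp with h | h
        · exact (Cl_ne h).1 rfl
        · exact (Cl_ne h).2 rfl
      · rcases Finset.mem_union.1 hp with h | h
        · exact (Cl_ne h).2 rfl
        · exact (Cl_ne h).1 rfl
      · rcases Finset.mem_union.1 hp with h | h
        · exact Cl_not_adj hc h huy
        · exact Cl_not_adj hc h hux
      · rcases Finset.mem_union.1 hp with h | h
        · exact Cl_not_adj hc h hvy
        · exact Cl_not_adj hc h hvx
    have h4c : ({x, y, u, v} : Finset V).card = 4 := by
      have := hux.ne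
      have := huy.ne
      have := hvx.ne
      have := hvy.ne
      rw [Finset.card_insert_of_notMem, Finset.card_insert_of_notMem,
        Finset.card_insert_of_notMem, Finset.card_singleton]
      all_goals simp
      all_goals grind
    have := Finset.card_le_univ ((Cl G x y ∪ Cl G y x) ∪ ({x, y, u, v} : Finset V))
    rw [Finset.card_union_of_disjoint hdis2, Finset.card_union_of_disjoint hdis, h4c] at this
    exact this
  rw [vertexLoad_eq, vertexLoad_eq]
  apply arith (Fintype.card V : ℤ) ((Cl G x y).card : ℤ) ((Cl G y x).card : ℤ)
    ((DD G x y).card : ℤ) ((EE G x y).card : ℤ)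
  · exact_mod_cast hn
  · positivity
  · positivity
  · positivity
  · omega
  · omega
  · exact_mod_cast h7
  · intro i1 i2
    have := h6 (Finset.card_pos.1 (by omega)) (Finset.card_pos.1 (by omega))
    exact_mod_cast this
  · have hh : (Ld R x).card + (Ld R y).card + (DD G x y).card + 2 * (EE G x y).card ≤
        (Fintype.card V - 2) * (Fintype.card V - 3) + 2 * ((Cl G x y).card + (Cl G y x).card)
        + 2 * ((Cl G x y).card * (Cl G y x).card) := by omega
    zify [show 2 ≤ Fintype.card V by omega, show 3 ≤ Fintype.card V by omega] at hh
    push_cast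
    exact hh

open Classical in
/-- A vertex with excessive load routes some pair that could avoid it. -/
lemma find_pair {G : SimpleGraph V} (hG : IsKConnected 2 G) (hn : 7 ≤ Fintype.card V)
    (R : Routing G) (x : V)
    (hx : (Fintype.card V : ℤ) ^ 2 - 7 * (Fintype.card V : ℤ) + 12 < (vertexLoad R x : ℤ)) :
    ∃ u v, (u, v) ∈ Ld R x ∧ Near G x (u, v) := by
  by_contra! hno
  obtain ⟨k, hk⟩ := Nat.exists_eq_add_of_le (show 3 ≤ Fintype.card V by omega)
  obtain ⟨S, hSc, hxS, -, hcard⟩ := grow hG x k (by omega)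
  set N := (S ×ˢ S).filter (Near G x)
  have hdis : Disjoint (Ld R x) N := by
    rw [Finset.disjoint_left]
    rintro ⟨p, q⟩ h h'
    exact hno p q h (Finset.mem_filter.1 h').2
  have hsub : Ld R x ∪ N ⊆ (univ.erase x).offDiag := by
    rintro ⟨p, q⟩ h
    rw [Finset.mem_offDiag]
    rcases Finset.mem_union.1 h with h | h
    · rw [mem_Ld] at h
      simp [h.1, h.2.2.1.symm, h.2.2.2.symm]
    · obtain ⟨h1, h2⟩ := Finset.mem_filter.1 h
      rw [Finset.mem_product] at h1
      refine ⟨?_, ?_, h2.1⟩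
      · simp only [Finset.mem_erase, Finset.mem_univ, and_true]
        exact fun h => hxS (h ▸ h1.1)
      · simp only [Finset.mem_erase, Finset.mem_univ, and_true]
        exact fun h => hxS (h ▸ h1.2)
  have hcd := Finset.card_le_card hsub
  rw [Finset.card_union_of_disjoint hdis, Finset.offDiag_card,
    Finset.card_erase_of_mem (Finset.mem_univ x), Finset.card_univ, hk] at hcd
  rw [vertexLoad_eq, hk] at hx
  have h1 : 3 + k - 1 = k + 2 := by omega
  rw [h1] at hcd
  have h2 : (k + 2) * (k + 2) - (k + 2) = (k + 2) * (k + 1) := by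
    rw [Nat.mul_succ (k + 2) (k + 1)]
    omega
  rw [h2] at hcd
  have h3 : (Ld R x).card + 2 * (2 * k + 1) ≤ (k + 2) * (k + 1) := by omega
  zify at h3
  push_cast at hx
  nlinarith

end XiAux

/-- If `G` is a `2`-connected graph on `n ≥ 7` vertices,
then `ξ_m(G) ≤ n² - 7n + 12`. -/
theorem xiMin_two_connected {V : Type*} [Fintype V] [DecidableEq V]
    (G : SimpleGraph V) (hG : IsKConnected 2 G) (hn : 7 ≤ Fintype.card V) :
    (Forwarding.xiMin G : ℤ) ≤
      (Fintype.card V : ℤ) ^ 2 - 7 * (Fintype.card V : ℤ) + 12 := by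
  classical
  have hc := XiAux.conn hG
  obtain ⟨R, hR, hmin⟩ : ∃ R : Forwarding.Routing G, R.IsMinimal ∧
      ∀ R' : Forwarding.Routing G, R'.IsMinimal →
      ∑ z, (Forwarding.vertexLoad R z) ^ 2 ≤ ∑ z, (Forwarding.vertexLoad R' z) ^ 2 := by
    have hex : ∃ k, ∃ R : Forwarding.Routing G, R.IsMinimal ∧
        ∑ z, (Forwarding.vertexLoad R z) ^ 2 = k := by
      obtain ⟨R, hR⟩ := XiAux.exists_minimal_routing hc
      exact ⟨_, R, hR, rfl⟩
    obtain ⟨R, hR, hk⟩ := Nat.find_spec hex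
    refine ⟨R, hR, fun R' hR' => ?_⟩
    rw [hk]
    exact Nat.find_min' hex ⟨R', hR', rfl⟩
  have hle : ∀ x, (Forwarding.vertexLoad R x : ℤ) ≤
      (Fintype.card V : ℤ) ^ 2 - 7 * (Fintype.card V : ℤ) + 12 := by
    intro x
    by_contra! hx
    obtain ⟨u, v, hL, huv, hadj⟩ := XiAux.find_pair hG hn R x hx
    have hL' := (XiAux.mem_Ld R x u v).1 hL
    have hna : ¬ G.Adj u v := by
      intro h
      have h1 := SimpleGraph.dist_eq_one_iff_adj.2 h
      have h2 := XiAux.geo _ (hR u v) hL'.2.1 hc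
      have h3 := hc.pos_dist_of_ne hL'.2.2.1.symm
      have h4 := hc.pos_dist_of_ne hL'.2.2.2
      omega
    rcases hadj with h | ⟨y, hyx, huy, hyv⟩
    · exact hna h
    obtain ⟨hux, hxv, hlt⟩ := XiAux.exchange hc R hR hmin u v x y hyx.symm huv hna huy hyv hL
    have hb := XiAux.pair_bound hG hn R hR x y u v hyx.symm huv hux huy hxv.symm hyv.symm
    push_cast at hb
    have : (Forwarding.vertexLoad R x : ℤ) ≤ Forwarding.vertexLoad R y + 1 := by
      exact_mod_cast hlt
    linarith
  have hne : Nonempty V := hc.nonempty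
  have h1 : Forwarding.xiMin G ≤ Forwarding.routingVertexIndex R :=
    Nat.sInf_le ⟨R, hR, rfl⟩
  obtain ⟨x, -, hx⟩ := Finset.exists_mem_eq_sup (univ : Finset V) Finset.univ_nonempty
    (Forwarding.vertexLoad R)
  have h2 := hle x
  have h3 : Forwarding.routingVertexIndex R = Forwarding.vertexLoad R x := hx
  rw [← h3] at h2
  exact le_trans (by exact_mod_cast h1) h2
end

section
/- If G is a 2-connected simple graph on n vertices, then π(G) ≤ ⌊n²/4⌋. -/
open Finset

namespace FwdAux

open SimpleGraph Classical
set_option linter.unusedSectionVars false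

variable {V : Type*} [Fintype V]

/-- Flow value leaving a set. -/
noncomputable def cs (c : V → V → ℤ) (X : Finset V) : ℤ := ∑ u ∈ X, ∑ w ∈ Xᶜ, c u w

/-- Net outflow of a vertex. -/
def net (f : V → V → ℤ) (v : V) : ℤ := ∑ w, f v w

/-- Antisymmetric functions. -/
def Asym (f : V → V → ℤ) : Prop := ∀ u w, f u w = - f w u

/-- Number of edges leaving a set. -/
noncomputable def dd (G : SimpleGraph V) (X : Finset V) : ℤ :=
  cs (fun u w => if G.Adj u w then 1 else 0) X

theorem sum_net {f : V → V → ℤ} (hf : Asym f) (X : Finset V) :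
    ∑ v ∈ X, net f v = cs f X := by
  have h1 : ∑ u ∈ X, ∑ w ∈ X, f u w = 0 := by
    have h2 : ∑ u ∈ X, ∑ w ∈ X, f u w = ∑ u ∈ X, ∑ w ∈ X, - f u w := by
      rw [Finset.sum_comm]
      refine Finset.sum_congr rfl fun u _ => Finset.sum_congr rfl fun w _ => ?_
      exact hf w u
    simp only [Finset.sum_neg_distrib] at h2
    omega
  unfold net cs
  have h3 : ∀ u, ∑ w, f u w = ∑ w ∈ X, f u w + ∑ w ∈ Xᶜ, f u w := fun u =>
    (Finset.sum_add_sum_compl X _).symm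
  simp only [h3, Finset.sum_add_distrib, h1, zero_add]

theorem cs_mono {c c' : V → V → ℤ} {X : Finset V}
    (h : ∀ u ∈ X, ∀ w ∉ X, c u w ≤ c' u w) : cs c X ≤ cs c' X := by
  unfold cs
  refine Finset.sum_le_sum fun u hu => Finset.sum_le_sum fun w hw => h u hu w ?_
  simpa using hw

theorem cs_congr {c c' : V → V → ℤ} {X : Finset V}
    (h : ∀ u ∈ X, ∀ w ∉ X, c u w = c' u w) : cs c X = cs c' X := by
  apply le_antisymm <;> apply cs_mono <;> intro u hu w hw
  · exact (h u hu w hw).le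
  · exact (h u hu w hw).ge

theorem cs_add (c c' : V → V → ℤ) (X : Finset V) :
    cs (fun u w => c u w + c' u w) X = cs c X + cs c' X := by
  simp [cs, Finset.sum_add_distrib]

theorem cs_sub (c c' : V → V → ℤ) (X : Finset V) :
    cs (fun u w => c u w - c' u w) X = cs c X - cs c' X := by
  simp [cs, Finset.sum_sub_distrib]

theorem cs_mul (k : ℤ) (c : V → V → ℤ) (X : Finset V) :
    cs (fun u w => k * c u w) X = k * cs c X := by
  simp [cs, Finset.mul_sum]

theorem cs_nonneg {c : V → V → ℤ} {X : Finset V}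
    (h : ∀ u ∈ X, ∀ w ∉ X, 0 ≤ c u w) : 0 ≤ cs c X := by
  unfold cs
  refine Finset.sum_nonneg fun u hu => Finset.sum_nonneg fun w hw => h u hu w ?_
  simpa using hw

/-- `cs` as a sum over all ordered pairs. -/
theorem cs_eq_prod (c : V → V → ℤ) (X : Finset V) :
    cs c X = ∑ p ∈ X ×ˢ Xᶜ, c p.1 p.2 := by
  rw [cs, Finset.sum_product]

theorem net_add (f g : V → V → ℤ) (v : V) :
    net (fun u w => f u w + g u w) v = net f v + net g v := by
  simp [net, Finset.sum_add_distrib]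

theorem net_sub (f g : V → V → ℤ) (v : V) :
    net (fun u w => f u w - g u w) v = net f v - net g v := by
  simp [net, Finset.sum_sub_distrib]

/-- Unit flow along a walk. -/
noncomputable def chi {G : SimpleGraph V} : {a b : V} → G.Walk a b → V → V → ℤ
  | _, _, Walk.nil => fun _ _ => 0
  | x, _, Walk.cons (v := y) _ p => fun u w =>
      ((if u = x ∧ w = y then 1 else 0) - (if u = y ∧ w = x then 1 else 0)) + chi p u w

theorem chi_asym {G : SimpleGraph V} {a b : V} (p : G.Walk a b) : Asym (chi p) := by
  induction p with
  | nil => intro u w; simp [chi]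
  | cons h p ih =>
    intro u w
    simp only [chi]
    rw [ih u w]
    simp only [and_comm]
    ring

theorem chi_net {G : SimpleGraph V} {a b : V} (p : G.Walk a b) (v : V) :
    net (chi p) v = (if v = a then 1 else 0) - (if v = b then 1 else 0) := by
  induction p with
  | nil => simp [net, chi]
  | @cons x y z h p ih =>
    have : net (chi (Walk.cons h p)) v =
      (∑ w, ((if v = x ∧ w = y then (1:ℤ) else 0) - (if v = y ∧ w = x then 1 else 0)))
        + net (chi p) v := by
      simp [net, chi, Finset.sum_add_distrib]
    rw [this, ih, Finset.sum_sub_distrib]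
    have e1 : ∑ w, (if v = x ∧ w = y then (1:ℤ) else 0) = if v = x then 1 else 0 := by
      by_cases hv : v = x <;> simp [hv]
    have e2 : ∑ w, (if v = y ∧ w = x then (1:ℤ) else 0) = if v = y then 1 else 0 := by
      by_cases hv : v = y <;> simp [hv]
    rw [e1, e2]; ring

theorem chi_trail {G : SimpleGraph V} {a b : V} (p : G.Walk a b) (hp : p.IsTrail) (u w : V) :
    (s(u,w) ∉ p.edges → chi p u w = 0) ∧
    (s(u,w) ∈ p.edges → (chi p u w = 1 ∧ ∃ d ∈ p.darts, d.fst = u ∧ d.snd = w) ∨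
      (chi p u w = -1 ∧ ∃ d ∈ p.darts, d.fst = w ∧ d.snd = u)) := by
  induction p with
  | nil => simp [chi]
  | @cons x y z h p ih =>
    rw [Walk.isTrail_cons] at hp
    obtain ⟨i1, i2⟩ := ih hp.1
    have hxy : x ≠ y := h.ne
    by_cases he : s(u,w) = s(x,y)
    · have h0 : chi p u w = 0 := i1 (he ▸ hp.2)
      refine ⟨fun hh => absurd (by simp [he]) hh, fun _ => ?_⟩
      rw [Sym2.eq_iff] at he
      rcases he with ⟨rfl, rfl⟩ | ⟨rfl, rfl⟩
      · left
        refine ⟨?_, ⟨(u,w), h⟩, by simp, rfl, rfl⟩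
        simp [chi, h0, hxy]
      · right
        refine ⟨?_, ⟨(w,u), h⟩, by simp, rfl, rfl⟩
        simp [chi, h0, hxy.symm]
    · have hc : chi (Walk.cons h p) u w = chi p u w := by
        have a1 : ¬ (u = x ∧ w = y) := fun hh => he (by rw [hh.1, hh.2])
        have a2 : ¬ (u = y ∧ w = x) := fun hh => he (by rw [hh.1, hh.2, Sym2.eq_swap])
        simp [chi, a1, a2]
      rw [hc]
      constructor
      · intro hh
        exact i1 fun h' => hh (by simp [h'])
      · intro hh
        have : s(u,w) ∈ p.edges := by
          rw [Walk.edges_cons, List.mem_cons] at hh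
          exact hh.resolve_left he
        rcases i2 this with ⟨q, d, hd, hq⟩ | ⟨q, d, hd, hq⟩
        · exact Or.inl ⟨q, d, by simp [hd], hq⟩
        · exact Or.inr ⟨q, d, by simp [hd], hq⟩

/-- Set reachable by paths all of whose darts satisfy `R`. -/
noncomputable def reach (G : SimpleGraph V) (R : V → V → Prop) (v : V) : Finset V :=
  Finset.univ.filter fun w => ∃ p : G.Walk v w, p.IsPath ∧ ∀ d ∈ p.darts, R d.fst d.snd

theorem mem_reach {G : SimpleGraph V} {R : V → V → Prop} {v w : V} :
    w ∈ reach G R v ↔ ∃ p : G.Walk v w, p.IsPath ∧ ∀ d ∈ p.darts, R d.fst d.snd := by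
  simp [reach]

theorem self_mem_reach {G : SimpleGraph V} {R : V → V → Prop} {v : V} : v ∈ reach G R v :=
  mem_reach.2 ⟨Walk.nil, by simp, by simp⟩

theorem reach_closed {G : SimpleGraph V} {R : V → V → Prop} {v u w : V}
    (hu : u ∈ reach G R v) (h : G.Adj u w) (hR : R u w) : w ∈ reach G R v := by
  obtain ⟨p, -, hp⟩ := mem_reach.1 hu
  refine mem_reach.2 ⟨(p.concat h).bypass, Walk.bypass_isPath _, fun d hd => ?_⟩
  have := Walk.darts_bypass_subset_darts _ hd
  rw [Walk.darts_concat, List.concat_eq_append, List.mem_append] at this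
  rcases this with h1 | h1
  · exact hp d h1
  · simp at h1; subst h1; exact hR

/-- Supply-demand theorem. -/
theorem flow_exists (G : SimpleGraph V) (c : V → V → ℤ) (β : V → ℤ)
    (hc0 : ∀ u w, 0 ≤ c u w) (hcG : ∀ u w, ¬ G.Adj u w → c u w = 0)
    (hβ : ∑ v, β v = 0) (hcut : ∀ X : Finset V, ∑ v ∈ X, β v ≤ cs c X) :
    ∃ f : V → V → ℤ, Asym f ∧ (∀ u w, f u w ≤ c u w) ∧ ∀ v, net f v = β v := by
  suffices H : ∀ k : ℕ, ∀ f : V → V → ℤ, Asym f → (∀ u w, f u w ≤ c u w) →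
      ∑ v, (β v - net f v).toNat = k →
      ∃ f : V → V → ℤ, Asym f ∧ (∀ u w, f u w ≤ c u w) ∧ ∀ v, net f v = β v from
    H _ (fun _ _ => 0) (fun _ _ => by simp) (fun u w => hc0 u w) rfl
  intro k
  induction k with
  | zero =>
    intro f hf hfc hk
    refine ⟨f, hf, hfc, ?_⟩
    have h1 : ∀ v, β v ≤ net f v := by
      intro v
      have := (Finset.sum_eq_zero_iff.1 hk) v (Finset.mem_univ v)
      omega
    have h2 : ∑ v, net f v = 0 := by
      rw [sum_net hf]; simp [cs]
    have h3 := (Finset.sum_eq_sum_iff_of_le (s := Finset.univ) (fun v _ => h1 v)).1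
      (by rw [h2, hβ])
    exact fun v => (h3 v (Finset.mem_univ v)).symm
  | succ k ih =>
    intro f hf hfc hk
    have hnot : ∃ v, net f v < β v := by
      by_contra hcon
      push Not at hcon
      have : ∑ v, (β v - net f v).toNat = 0 :=
        Finset.sum_eq_zero fun v _ => by have := hcon v; omega
      omega
    obtain ⟨v, hv⟩ := hnot
    set X := reach G (fun u w => f u w < c u w) v with hX
    by_cases hs : ∃ x ∈ X, β x < net f x
    · obtain ⟨x, hxX, hx⟩ := hs
      obtain ⟨p, hp, hpR⟩ := mem_reach.1 hxX
      have hvx : v ≠ x := by rintro rfl; omega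
      apply ih (fun u w => f u w + chi p u w)
      · intro u w
        have h1 := hf u w
        have h2 := chi_asym p u w
        simp only; omega
      · intro u w
        have ht := chi_trail p hp.isTrail u w
        have := hfc u w
        by_cases he : s(u,w) ∈ p.edges
        · rcases ht.2 he with ⟨h1, d, hd, rfl, rfl⟩ | ⟨h1, _⟩
          · have := hpR d hd
            omega
          · omega
        · have := ht.1 he
          omega
      · have e1 : ∀ y, ((β y - net f y).toNat : ℤ) =
          (β y - net (fun u w => f u w + chi p u w) y).toNat + (if y = v then 1 else 0) := by
          intro y
          rw [net_add, chi_net]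
          by_cases h1 : y = v
          · subst h1
            simp [hvx]; omega
          · by_cases h2 : y = x
            · subst h2; simp [h1]; omega
            · simp [h1, h2]
        have e2 : ((∑ y, (β y - net f y).toNat : ℕ) : ℤ) =
          ((∑ y, (β y - net (fun u w => f u w + chi p u w) y).toNat : ℕ) : ℤ) + 1 := by
          push_cast
          rw [Finset.sum_congr rfl fun y _ => e1 y, Finset.sum_add_distrib]
          simp
        rw [hk] at e2
        push_cast at e2
        have : ((∑ y, (β y - net (fun u w => f u w + chi p u w) y).toNat : ℕ) : ℤ) = k := by
          push_cast; omega
        exact_mod_cast this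
    · push Not at hs
      exfalso
      have h1 : ∑ y ∈ X, net f y < ∑ y ∈ X, β y :=
        Finset.sum_lt_sum (fun y hy => hs y hy) ⟨v, self_mem_reach, hv⟩
      rw [sum_net hf] at h1
      have h2 : cs f X = cs c X := by
        apply cs_congr
        intro u hu w hw
        by_contra hne
        have hlt : f u w < c u w := lt_of_le_of_ne (hfc u w) hne
        have hadj : G.Adj u w := by
          by_contra hna
          have a1 := hcG u w hna
          have a2 := hcG w u (fun h => hna h.symm)
          have a3 := hfc w u
          have a4 := hf u w
          omega
        exact hw (reach_closed hu hadj hlt)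
      have := hcut X
      omega

/-- Extracting one path from a flow. -/
theorem extract_one (G : SimpleGraph V) (f : V → V → ℤ) (hf : Asym f)
    (hG : ∀ u w, ¬ G.Adj u w → f u w = 0) {a v : V} (hnn : ∀ w, w ≠ a → 0 ≤ net f w)
    (hva : v ≠ a) (hv : 0 < net f v) :
    ∃ p : G.Walk v a, p.IsPath ∧
      ∀ u w, |f u w - chi p u w| + (if s(u,w) ∈ p.edges then 1 else 0) ≤ |f u w| := by
  have hmem : a ∈ reach G (fun u w => 0 < f u w) v := by
    by_contra hcon
    set X := reach G (fun u w => 0 < f u w) v with hX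
    have h1 : 0 < ∑ y ∈ X, net f y := by
      apply Finset.sum_pos'
      · intro y hy
        exact hnn y (by rintro rfl; exact hcon hy)
      · exact ⟨v, self_mem_reach, hv⟩
    rw [sum_net hf] at h1
    have h2 : cs f X ≤ cs (fun _ _ => 0) X := by
      apply cs_mono
      intro u hu w hw
      by_contra hlt
      push Not at hlt
      have hadj : G.Adj u w := by
        by_contra hna
        have := hG u w hna
        omega
      exact hw (reach_closed hu hadj hlt)
    simp [cs] at h2 h1
    omega
  obtain ⟨p, hp, hR⟩ := mem_reach.1 hmem
  refine ⟨p, hp, fun u w => ?_⟩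
  have ht := chi_trail p hp.isTrail u w
  by_cases he : s(u,w) ∈ p.edges
  · simp only [he, if_true]
    rcases ht.2 he with ⟨h1, d, hd, rfl, rfl⟩ | ⟨h1, d, hd, rfl, rfl⟩
    · have := hR d hd
      rw [h1, abs_of_nonneg (by omega), abs_of_nonneg (by omega)]; omega
    · have := hR d hd
      have h3 := hf d.snd d.fst
      rw [h1, abs_of_nonpos (by omega), abs_of_nonpos (by omega)]; omega
  · simp [he, ht.1 he]

/-- `E` is the edge set of a path from `x` to `y`. -/
def IsPE (G : SimpleGraph V) (x y : V) (E : Finset (Sym2 V)) : Prop :=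
  ∃ p : G.Walk x y, p.IsPath ∧ ∀ e, e ∈ E ↔ e ∈ p.edges

theorem IsPE.symm {G : SimpleGraph V} {x y : V} {E : Finset (Sym2 V)} (h : IsPE G x y E) :
    IsPE G y x E := by
  obtain ⟨p, hp, h⟩ := h
  exact ⟨p.reverse, hp.reverse, fun e => by rw [h]; simp⟩

/-- Path decomposition of a flow. -/
theorem extract_all {ι : Type*} (G : SimpleGraph V) (a : V) (src : ι → V) (I : Finset ι) :
    ∀ (f : V → V → ℤ), Asym f → (∀ u w, ¬ G.Adj u w → f u w = 0) →
    (∀ i ∈ I, src i ≠ a) →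
    (∀ w, w ≠ a → ((I.filter fun i => src i = w).card : ℤ) ≤ net f w) →
    ∃ E : ι → Finset (Sym2 V), (∀ i ∈ I, IsPE G (src i) a (E i)) ∧
      ∀ u w, ((I.filter fun i => s(u,w) ∈ E i).card : ℤ) ≤ |f u w| := by
  induction I using Finset.induction_on with
  | empty =>
    intro f _ _ _ _
    exact ⟨fun _ => ∅, by simp, by simp⟩
  | insert i I hi ih =>
    intro f hf hG hne hnet
    have hv : 0 < net f (src i) := by
      have := hnet (src i) (hne i (by simp))
      have h2 : 0 < ((insert i I).filter fun j => src j = src i).card :=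
        Finset.card_pos.2 ⟨i, by simp⟩
      omega
    obtain ⟨p, hp, hload⟩ := extract_one G f hf hG (a := a) (v := src i)
      (fun w hw => le_trans (by positivity) (hnet w hw)) (hne i (by simp)) hv
    obtain ⟨E, hE1, hE2⟩ := ih (fun u w => f u w - chi p u w)
      (by
        intro u w
        have h1 := hf u w
        have h2 := chi_asym p u w
        simp only; omega)
      (by
        intro u w hna
        have he : s(u,w) ∉ p.edges := fun h => hna (p.adj_of_mem_edges h)
        simp [hG u w hna, (chi_trail p hp.isTrail u w).1 he])
      (fun j hj => hne j (by simp [hj]))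
      (by
        intro w hw
        have h1 := hnet w hw
        rw [net_sub, chi_net, Finset.filter_insert] at *
        simp only [hw, if_false]
        by_cases h2 : src i = w
        · rw [if_pos h2, Finset.card_insert_of_notMem (by simp [hi])] at h1
          rw [if_pos h2.symm]; push_cast at h1; omega
        · rw [if_neg h2] at h1
          rw [if_neg (fun h => h2 h.symm)]; omega)
    refine ⟨fun j => if j = i then p.edges.toFinset else E j, ?_, ?_⟩
    · intro j hj
      by_cases hji : j = i
      · subst hji
        exact ⟨p, hp, fun e => by simp⟩
      · simp only [hji, if_false]
        exact hE1 j (by simpa [hji] using hj)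
    · intro u w
      have h1 := hload u w
      have h2 := hE2 u w
      rw [Finset.filter_insert]
      have h3 : (I.filter fun j => s(u,w) ∈ (if j = i then p.edges.toFinset else E j)) =
          I.filter fun j => s(u,w) ∈ E j := by
        apply Finset.filter_congr
        intro j hj
        have : j ≠ i := by rintro rfl; exact hi hj
        simp [this]
      simp only [h3, if_true, List.mem_toFinset]
      by_cases he : s(u,w) ∈ p.edges
      · rw [if_pos he] at h1 ⊢
        rw [Finset.card_insert_of_notMem (by simp [hi])]
        push_cast; omega
      · rw [if_neg he] at h1 ⊢
        omega

theorem cs_eq_all (c : V → V → ℤ) (X : Finset V) :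
    cs c X = ∑ u, ∑ w, if u ∈ X ∧ w ∉ X then c u w else 0 := by
  unfold cs
  rw [← Finset.sum_subset (Finset.subset_univ X)]
  · refine Finset.sum_congr rfl fun u hu => ?_
    rw [← Finset.sum_subset (Finset.subset_univ Xᶜ)]
    · refine Finset.sum_congr rfl fun w hw => ?_
      rw [if_pos ⟨hu, by simpa using hw⟩]
    · intro w _ hw
      rw [if_neg]
      simp at hw
      tauto
  · intro u _ hu
    simp [hu]

theorem cs_compl {c : V → V → ℤ} (hc : ∀ u w, c u w = c w u) (X : Finset V) :
    cs c Xᶜ = cs c X := by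
  unfold cs
  rw [compl_compl, Finset.sum_comm]
  exact Finset.sum_congr rfl fun u _ => Finset.sum_congr rfl fun w _ => hc _ _

theorem dd_compl (G : SimpleGraph V) (X : Finset V) : dd G Xᶜ = dd G X :=
  cs_compl (fun u w => by simp [G.adj_comm]) X

theorem dd_nonneg (G : SimpleGraph V) (X : Finset V) : 0 ≤ dd G X :=
  cs_nonneg fun u _ w _ => by split_ifs <;> simp

theorem dd_submod (G : SimpleGraph V) (X Y : Finset V) :
    dd G (X ∩ Y) + dd G (X ∪ Y) ≤ dd G X + dd G Y := by
  simp only [dd, cs_eq_all, ← Finset.sum_add_distrib]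
  refine Finset.sum_le_sum fun u _ => Finset.sum_le_sum fun w _ => ?_
  by_cases h : G.Adj u w <;> by_cases h1 : u ∈ X <;> by_cases h2 : u ∈ Y <;>
    by_cases h3 : w ∈ X <;> by_cases h4 : w ∈ Y <;> simp [h, h1, h2, h3, h4]

theorem dd_split (G : SimpleGraph V) (X Z : Finset V)
    (h : ∀ u ∈ X ∩ Z, ∀ w ∈ X \ Z, ¬ G.Adj u w) :
    dd G (X ∩ Z) + dd G (X \ Z) ≤ dd G X := by
  simp only [dd, cs_eq_all, ← Finset.sum_add_distrib]
  refine Finset.sum_le_sum fun u _ => Finset.sum_le_sum fun w _ => ?_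
  have e1 := h u
  have e2 := h w
  have e3 := e1
  simp only [Finset.mem_inter, Finset.mem_sdiff] at e1 e2
  by_cases h0 : G.Adj u w
  · have h0' := h0.symm
    by_cases h1 : u ∈ X <;> by_cases h2 : u ∈ Z <;>
    by_cases h3 : w ∈ X <;> by_cases h4 : w ∈ Z <;> simp_all
  · simp [h0]

theorem le_cs_of_mem {c : V → V → ℤ} {X : Finset V} (hc : ∀ u ∈ X, ∀ w ∉ X, 0 ≤ c u w)
    {u w : V} (hu : u ∈ X) (hw : w ∉ X) : c u w ≤ cs c X := by
  rw [cs_eq_prod]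
  refine Finset.single_le_sum (f := fun p : V × V => c p.1 p.2) (a := (u, w)) ?_ ?_
  · intro p hp
    simp only [Finset.mem_product, Finset.mem_compl] at hp
    exact hc _ hp.1 _ hp.2
  · simp [hu, hw]

theorem two_le_cs {c : V → V → ℤ} {X : Finset V} (hc : ∀ u ∈ X, ∀ w ∉ X, 0 ≤ c u w)
    {u w u' w' : V} (hu : u ∈ X) (hw : w ∉ X) (hu' : u' ∈ X) (hw' : w' ∉ X)
    (hne : (u, w) ≠ (u', w')) : c u w + c u' w' ≤ cs c X := by
  rw [cs_eq_prod]
  have h : ∑ p ∈ ({(u,w), (u',w')} : Finset (V × V)), c p.1 p.2 = c u w + c u' w' := by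
    rw [Finset.sum_pair hne]
  rw [← h]
  apply Finset.sum_le_sum_of_subset_of_nonneg
  · intro p hp
    simp only [Finset.mem_insert, Finset.mem_singleton] at hp
    rcases hp with rfl | rfl <;> simp [*]
  · intro p hp _
    simp only [Finset.mem_product, Finset.mem_compl] at hp
    exact hc _ hp.1 _ hp.2

theorem cross_edge {G : SimpleGraph V} (hG : IsKConnected 2 G) (z : V) (X : Finset V) {x y : V}
    (hx : x ∈ X) (hxz : x ≠ z) (hy : y ∉ X) (hyz : y ≠ z) :
    ∃ u ∈ X, ∃ w, w ∉ X ∧ G.Adj u w ∧ u ≠ z ∧ w ≠ z := by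
  have h := hG.2 {z} (by simp)
  obtain ⟨p⟩ := h.preconnected ⟨x, by simpa using hxz⟩ ⟨y, by simpa using hyz⟩
  obtain ⟨d, hd, h1, h2⟩ := p.exists_boundary_dart {v | v.1 ∈ X} hx hy
  refine ⟨d.fst.1, h1, d.snd.1, h2, ?_, ?_, ?_⟩
  · exact d.adj
  · simpa using d.fst.2
  · simpa using d.snd.2

theorem dd_ge_two {G : SimpleGraph V} (hG : IsKConnected 2 G) (X : Finset V) {x y : V}
    (hx : x ∈ X) (hy : y ∉ X) : 2 ≤ dd G X := by
  have hcard : 2 < Fintype.card V := hG.1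
  have hex : ∀ s : V, ∀ t : V, ∃ z, z ≠ s ∧ z ≠ t := by
    intro s t
    by_contra hcon
    push Not at hcon
    have : (Finset.univ : Finset V) ⊆ {s, t} := by
      intro z _
      by_cases h : z = s
      · simp [h]
      · simp [hcon z h]
    have h2 := Finset.card_le_card this
    have h3 : ({s, t} : Finset V).card ≤ 2 := Finset.card_le_two
    rw [Finset.card_univ] at h2
    omega
  obtain ⟨z, hz1, hz2⟩ := hex x y
  obtain ⟨u, hu, w, hw, huw, -, -⟩ := cross_edge hG z X hx hz1.symm hy hz2.symm
  have key : ∃ u' ∈ X, ∃ w', w' ∉ X ∧ G.Adj u' w' ∧ (u, w) ≠ (u', w') := by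
    obtain ⟨v, hv1, hv2⟩ := hex u w
    by_cases hv : v ∈ X
    · obtain ⟨u', hu', w', hw', h1, h2, h3⟩ := cross_edge hG u X hv hv1 hw (huw.ne.symm)
      exact ⟨u', hu', w', hw', h1, fun h => h2 (by simp at h; exact h.1.symm)⟩
    · obtain ⟨u', hu', w', hw', h1, h2, h3⟩ := cross_edge hG w X hu huw.ne hv hv2
      exact ⟨u', hu', w', hw', h1, fun h => h3 (by simp at h; exact h.2.symm)⟩
  obtain ⟨u', hu', w', hw', h1, hne⟩ := key
  have := two_le_cs (c := fun u w => if G.Adj u w then 1 else 0)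
    (fun u _ w _ => by split_ifs <;> simp) hu hw hu' hw' hne
  simp only [huw, h1, if_true] at this
  exact this

theorem comb_ineq {ι : Type*} (I A B : Finset ι) (r : ℕ) :
    (I.filter fun i => ¬ (A = {i} ↔ B = {i})).card +
      ((Finset.Icc 3 r).filter fun t => ¬ (t ≤ A.card ↔ t ≤ B.card)).card ≤
    (A \ B).card + (B \ A).card := by
  by_cases hAB : A = B
  · subst hAB; simp
  have h1 : (I.filter fun i => ¬ (A = {i} ↔ B = {i})).card ≤
      (if A.card = 1 then 1 else 0) + (if B.card = 1 then 1 else 0) := by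
    have hs : (I.filter fun i => ¬ (A = {i} ↔ B = {i})) ⊆
        (if A.card = 1 then A else ∅) ∪ (if B.card = 1 then B else ∅) := by
      intro i hi
      rw [Finset.mem_filter] at hi
      rw [Finset.mem_union]
      by_cases h : A = {i}
      · left; simp [h]
      · right
        have : B = {i} := by tauto
        simp [this]
    refine (Finset.card_le_card hs).trans ((Finset.card_union_le _ _).trans ?_)
    split_ifs <;> simp_all
  have h2 : ((Finset.Icc 3 r).filter fun t => ¬ (t ≤ A.card ↔ t ≤ B.card)).card ≤
      (B.card - max A.card 2) + (A.card - max B.card 2) := by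
    have hs : ((Finset.Icc 3 r).filter fun t => ¬ (t ≤ A.card ↔ t ≤ B.card)) ⊆
        Finset.Ioc (max A.card 2) B.card ∪ Finset.Ioc (max B.card 2) A.card := by
      intro t ht
      simp only [Finset.mem_filter, Finset.mem_Icc, Finset.mem_union, Finset.mem_Ioc] at ht ⊢
      omega
    refine (Finset.card_le_card hs).trans ((Finset.card_union_le _ _).trans ?_)
    simp
  have h3 : (A \ B).card + (A ∩ B).card = A.card := Finset.card_sdiff_add_card_inter A B
  have h4 : (B \ A).card + (B ∩ A).card = B.card := Finset.card_sdiff_add_card_inter B A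
  rw [Finset.inter_comm] at h4
  have h5 : 1 ≤ (A \ B).card + (B \ A).card := by
    by_contra hcon
    have e1 : A \ B = ∅ := Finset.card_eq_zero.1 (by omega)
    have e2 : B \ A = ∅ := Finset.card_eq_zero.1 (by omega)
    exact hAB (Finset.Subset.antisymm (Finset.sdiff_eq_empty_iff_subset.1 e1)
      (Finset.sdiff_eq_empty_iff_subset.1 e2))
  split_ifs at h1 <;> omega

theorem two_dd (G : SimpleGraph V) (X : Finset V) :
    2 * dd G X = ∑ u, ∑ w, if G.Adj u w then (if ¬ (u ∈ X ↔ w ∈ X) then 1 else 0) else 0 := by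
  have h : 2 * dd G X = dd G X + dd G Xᶜ := by rw [dd_compl]; ring
  rw [h]
  simp only [dd, cs_eq_all, ← Finset.sum_add_distrib]
  refine Finset.sum_congr rfl fun u _ => Finset.sum_congr rfl fun w _ => ?_
  by_cases h0 : G.Adj u w <;> by_cases h1 : u ∈ X <;> by_cases h3 : w ∈ X <;>
    simp [h0, h1, h3]

theorem lemmaB_cut {ι : Type*} (G : SimpleGraph V) (X : ι → Finset V) (I : Finset ι) (r : ℕ) :
    ∑ i ∈ I, dd G (univ.filter fun v => (I.filter fun j => v ∉ X j) = {i}) +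
      ∑ t ∈ Finset.Icc 3 r, dd G (univ.filter fun v => t ≤ (I.filter fun j => v ∉ X j).card) ≤
    ∑ i ∈ I, dd G (X i) := by
  suffices h : 2 * (∑ i ∈ I, dd G (univ.filter fun v => (I.filter fun j => v ∉ X j) = {i}) +
      ∑ t ∈ Finset.Icc 3 r, dd G (univ.filter fun v => t ≤ (I.filter fun j => v ∉ X j).card)) ≤
      2 * ∑ i ∈ I, dd G (X i) by omega
  have comm : ∀ {κ : Type _} (J : Finset κ) (F : κ → V → V → ℤ),
      ∑ i ∈ J, ∑ u, ∑ w, F i u w = ∑ u, ∑ w, ∑ i ∈ J, F i u w := by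
    intro κ J F
    rw [Finset.sum_comm]
    exact Finset.sum_congr rfl fun u _ => Finset.sum_comm
  have comm2 : ∀ (J : Finset ℕ) (F : ℕ → V → V → ℤ),
      ∑ i ∈ J, ∑ u, ∑ w, F i u w = ∑ u, ∑ w, ∑ i ∈ J, F i u w := by
    intro J F
    rw [Finset.sum_comm]
    exact Finset.sum_congr rfl fun u _ => Finset.sum_comm
  rw [mul_add, Finset.mul_sum, Finset.mul_sum, Finset.mul_sum]
  simp only [two_dd]
  rw [comm, comm2, comm, ← Finset.sum_add_distrib]
  refine Finset.sum_le_sum fun u _ => ?_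
  rw [← Finset.sum_add_distrib]
  refine Finset.sum_le_sum fun w _ => ?_
  by_cases h0 : G.Adj u w
  swap
  · simp [h0]
  simp only [h0, if_true, Finset.mem_filter, Finset.mem_univ, true_and]
  have key := comb_ineq I (I.filter fun j => u ∉ X j) (I.filter fun j => w ∉ X j) r
  have e : ((I.filter fun i => ¬ (u ∈ X i ↔ w ∈ X i)).card) =
      ((I.filter fun j => u ∉ X j) \ (I.filter fun j => w ∉ X j)).card +
      ((I.filter fun j => w ∉ X j) \ (I.filter fun j => u ∉ X j)).card := by
    rw [← Finset.card_union_of_disjoint]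
    · congr 1
      ext i
      simp only [Finset.mem_filter, Finset.mem_union, Finset.mem_sdiff]
      tauto
    · rw [Finset.disjoint_left]
      intro i
      simp only [Finset.mem_filter, Finset.mem_sdiff]
      tauto
  rw [← e] at key
  simp only [Finset.sum_boole]
  exact_mod_cast key

theorem lemmaB (G : SimpleGraph V) (D : ∀ (X : Finset V) (x y : V), x ∈ X → y ∉ X → 2 ≤ dd G X)
    (S : Finset V) {a : V} (ha : a ∈ S) (hs : 2 ≤ S.card) :
    ∃ b ∈ S, b ≠ a ∧ ∀ X : Finset V, a ∉ X → b ∉ X →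
      4 * ((X ∩ S).card : ℤ) ≤ ((S.card : ℤ) - 1) * dd G X := by
  by_contra hcon
  push Not at hcon
  choose! X hX1 hX2 hX3 using hcon
  have hcardT : (S.erase a).card = S.card - 1 := Finset.card_erase_of_mem ha
  obtain ⟨I, hI, hmin⟩ := Finset.exists_min_image
    ((S.erase a).powerset.filter fun I => ∀ b ∈ S.erase a, ∃ i ∈ I, b ∉ X i) Finset.card
    ⟨S.erase a, by
      simp only [Finset.mem_filter, Finset.mem_powerset, Finset.Subset.refl, true_and]
      intro b hb
      exact ⟨b, hb, hX2 b (Finset.mem_of_mem_erase hb) (Finset.ne_of_mem_erase hb)⟩⟩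
  simp only [Finset.mem_filter, Finset.mem_powerset] at hI hmin
  obtain ⟨hIS, hIc⟩ := hI
  have hIS' : ∀ i ∈ I, i ∈ S ∧ i ≠ a := fun i hi =>
    ⟨Finset.mem_of_mem_erase (hIS hi), Finset.ne_of_mem_erase (hIS hi)⟩
  have priv : ∀ i ∈ I, ∃ b, b ∈ S.erase a ∧ (I.filter fun j => b ∉ X j) = {i} := by
    intro i hi
    have h1 : ¬ ∀ b ∈ S.erase a, ∃ j ∈ I.erase i, b ∉ X j := by
      intro h
      have := hmin (I.erase i) ⟨(Finset.erase_subset _ _).trans hIS, h⟩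
      rw [Finset.card_erase_of_mem hi] at this
      have := Finset.card_pos.2 ⟨i, hi⟩
      omega
    push Not at h1
    obtain ⟨b, hb, hb2⟩ := h1
    refine ⟨b, hb, ?_⟩
    obtain ⟨k, hk, hk2⟩ := hIc b hb
    have hki : k = i := by
      by_contra hne
      exact hk2 (hb2 k (Finset.mem_erase.2 ⟨hne, hk⟩))
    subst hki
    ext j
    simp only [Finset.mem_filter, Finset.mem_singleton]
    constructor
    · rintro ⟨h1, h2⟩
      by_contra hne
      exact h2 (hb2 j (Finset.mem_erase.2 ⟨hne, h1⟩))
    · rintro rfl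
      exact ⟨hk, hk2⟩
  have hAa : (I.filter fun j => a ∉ X j) = I :=
    Finset.filter_true_of_mem fun j hj => hX1 j (hIS' j hj).1 (hIS' j hj).2
  have hIne : I.Nonempty := by
    obtain ⟨b, hb⟩ : (S.erase a).Nonempty := Finset.card_pos.1 (by omega)
    obtain ⟨i, hi, -⟩ := hIc b hb
    exact ⟨i, hi⟩
  have hr : 1 ≤ I.card := Finset.card_pos.2 hIne
  -- cut bound
  have hcut : 4 * (I.card : ℤ) - 4 ≤ ∑ i ∈ I, dd G (X i) := by
    by_cases hr2 : 2 ≤ I.card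
    · refine le_trans ?_ (lemmaB_cut G X I I.card)
      have e1 : (I.card : ℤ) * 2 ≤
          ∑ i ∈ I, dd G (univ.filter fun v => (I.filter fun j => v ∉ X j) = {i}) := by
        have := Finset.card_nsmul_le_sum I
          (fun i => dd G (univ.filter fun v => (I.filter fun j => v ∉ X j) = {i})) 2 (by
            intro i hi
            obtain ⟨b, hb, hb2⟩ := priv i hi
            refine D _ b a (by simp [hb2]) ?_
            simp only [Finset.mem_filter, Finset.mem_univ, true_and, hAa]
            intro h
            rw [h] at hr2
            simp at hr2)
        simpa using this
      have e2 : ((Finset.Icc 3 I.card).card : ℤ) * 2 ≤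
          ∑ t ∈ Finset.Icc 3 I.card,
            dd G (univ.filter fun v => t ≤ (I.filter fun j => v ∉ X j).card) := by
        have := Finset.card_nsmul_le_sum (Finset.Icc 3 I.card)
          (fun t => dd G (univ.filter fun v => t ≤ (I.filter fun j => v ∉ X j).card)) 2 (by
            intro t ht
            rw [Finset.mem_Icc] at ht
            obtain ⟨i, hi⟩ := hIne
            obtain ⟨b, hb, hb2⟩ := priv i hi
            refine D _ a b (by simp [hAa, ht.2]) ?_
            simp only [Finset.mem_filter, Finset.mem_univ, true_and, hb2,
              Finset.card_singleton]
            omega)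
        simpa using this
      rw [Nat.card_Icc] at e2
      omega
    · have : 0 ≤ ∑ i ∈ I, dd G (X i) := Finset.sum_nonneg fun i _ => dd_nonneg G _
      omega
  -- size bound
  have hsize : ∑ i ∈ I, (X i ∩ S).card + ∑ v ∈ S, (I.filter fun j => v ∉ X j).card
      = I.card * S.card := by
    have e1 : ∑ v ∈ S, (I.filter fun j => v ∉ X j).card =
        ∑ i ∈ I, (S.filter fun v => v ∉ X i).card := by
      simp only [Finset.card_filter]
      rw [Finset.sum_comm]
    rw [e1, ← Finset.sum_add_distrib, Finset.card_eq_sum_ones I, Finset.sum_mul]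
    refine Finset.sum_congr rfl fun i _ => ?_
    rw [one_mul, ← Finset.card_filter_add_card_filter_not (s := S) (fun v => v ∈ X i)]
    congr 2
    ext v
    simp [and_comm]
  have hN : I.card + (S.card - 1) ≤ ∑ v ∈ S, (I.filter fun j => v ∉ X j).card := by
    rw [← Finset.add_sum_erase S _ ha, hAa]
    have := Finset.card_nsmul_le_sum (S.erase a) (fun v => (I.filter fun j => v ∉ X j).card) 1 (by
      intro b hb
      obtain ⟨i, hi, hi2⟩ := hIc b hb
      exact Finset.card_pos.2 ⟨i, by simp [hi, hi2]⟩)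
    simp only [smul_eq_mul, mul_one, hcardT] at this
    omega
  have hsum : ∑ i ∈ I, (((S.card : ℤ) - 1) * dd G (X i) + 1) ≤
      ∑ i ∈ I, 4 * ((X i ∩ S).card : ℤ) :=
    Finset.sum_le_sum fun i hi => hX3 i (hIS' i hi).1 (hIS' i hi).2
  rw [Finset.sum_add_distrib, ← Finset.mul_sum, ← Finset.mul_sum] at hsum
  simp only [Finset.sum_const, nsmul_eq_mul, mul_one] at hsum
  have hM : (1 : ℤ) ≤ (S.card : ℤ) - 1 := by omega
  have h1 := mul_le_mul_of_nonneg_left hcut (show (0:ℤ) ≤ (S.card : ℤ) - 1 by omega)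
  have hsize' : ∑ i ∈ I, ((X i ∩ S).card : ℤ) + (I.card + (S.card - 1)) ≤
      (I.card : ℤ) * S.card := by
    have : ∑ i ∈ I, (X i ∩ S).card + (I.card + (S.card - 1)) ≤ I.card * S.card := by omega
    have h := (Nat.cast_le (α := ℤ)).2 this
    push_cast [Nat.cast_sub (show 1 ≤ S.card by omega)] at h
    exact h
  have hr' : (1 : ℤ) ≤ I.card := by exact_mod_cast hr
  nlinarith

theorem cs_mod (f : V → V → ℤ) (X : Finset V) :
    cs f X = cs (fun u w => f u w % 2) X + 2 * cs (fun u w => f u w / 2) X := by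
  rw [← cs_mul, ← cs_add]
  exact cs_congr fun u _ w _ => by omega

theorem cs_mod_nonneg (f : V → V → ℤ) (X : Finset V) : 0 ≤ cs (fun u w => f u w % 2) X :=
  cs_nonneg fun u _ w _ => by omega

theorem exists_of_cs_ne {f : V → V → ℤ} {X : Finset V} (h : cs f X ≠ 0) :
    ∃ u ∈ X, ∃ w, w ∉ X ∧ f u w ≠ 0 := by
  by_contra hcon
  push Not at hcon
  apply h
  rw [cs_congr (c' := fun _ _ => 0) (fun u hu w hw => hcon u hu w hw)]
  simp [cs]

theorem chi_ne_mem {G : SimpleGraph V} {a b : V} {p : G.Walk a b} (hp : p.IsPath) {u w : V}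
    (h : chi p u w ≠ 0) : s(u,w) ∈ p.edges := by
  by_contra hcon
  exact h ((chi_trail p hp.isTrail u w).1 hcon)

theorem chi_mem {G : SimpleGraph V} {a b : V} {p : G.Walk a b} (hp : p.IsPath) {u w : V}
    (h : s(u,w) ∈ p.edges) : chi p u w = 1 ∨ chi p u w = -1 := by
  rcases (chi_trail p hp.isTrail u w).2 h with h | h
  · exact Or.inl h.1
  · exact Or.inr h.1

theorem chi_not_mem {G : SimpleGraph V} {a b : V} {p : G.Walk a b} (hp : p.IsPath) {u w : V}
    (h : s(u,w) ∉ p.edges) : chi p u w = 0 := (chi_trail p hp.isTrail u w).1 h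

theorem cs_chi {G : SimpleGraph V} {a b : V} (p : G.Walk a b) (X : Finset V) :
    cs (chi p) X = (if a ∈ X then 1 else 0) - (if b ∈ X then 1 else 0) := by
  rw [← sum_net (chi_asym p)]
  simp [chi_net, Finset.sum_sub_distrib]

/-- A path that starts outside `X` and visits `X` has an edge leaving `X`. -/
theorem path_cross {G : SimpleGraph V} {a b : V} (p : G.Walk b a) {X : Finset V} {v : V}
    (hb : b ∉ X) (hv : v ∈ X) (hvp : v ∈ p.support) :
    ∃ u ∈ X, ∃ w, w ∉ X ∧ s(u,w) ∈ p.edges := by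
  obtain ⟨d, hd, h1, h2⟩ := (p.takeUntil v hvp).reverse.exists_boundary_dart
    {x | x ∈ X} hv hb
  refine ⟨d.fst, h1, d.snd, h2, ?_⟩
  have h3 : d.edge ∈ (p.takeUntil v hvp).reverse.edges := List.mem_map_of_mem hd
  rw [Walk.edges_reverse, List.mem_reverse] at h3
  exact p.edges_takeUntil_subset_edges hvp h3

/-- Two edge-disjoint paths. -/
theorem two_paths (G : SimpleGraph V)
    (D : ∀ (X : Finset V) (x y : V), x ∈ X → y ∉ X → 2 ≤ dd G X) {a b : V} (hab : b ≠ a) :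
    ∃ P Q : G.Walk b a, P.IsPath ∧ Q.IsPath ∧ ∀ e, e ∈ P.edges → e ∉ Q.edges := by
  obtain ⟨f, hf, hfc, hfn⟩ := flow_exists G (fun u w => if G.Adj u w then 1 else 0)
    (fun v => 2 * (if v = b then 1 else 0) - 2 * (if v = a then 1 else 0))
    (by intro u w; split_ifs <;> simp) (by intro u w h; simp [h])
    (by simp [Finset.sum_sub_distrib])
    (by
      intro X
      change _ ≤ dd G X
      have h0 := dd_nonneg G X
      have : ∑ v ∈ X, (2 * (if v = b then (1:ℤ) else 0) - 2 * (if v = a then 1 else 0)) =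
          2 * (if b ∈ X then 1 else 0) - 2 * (if a ∈ X then 1 else 0) := by
        simp [Finset.sum_sub_distrib]
      rw [this]
      by_cases h1 : b ∈ X <;> by_cases h2 : a ∈ X <;> simp only [h1, h2, if_true, if_false]
      · omega
      · have := D X b a h1 h2
        omega
      · omega
      · omega)
  have hfz : ∀ u w, ¬ G.Adj u w → f u w = 0 := by
    intro u w h
    have h1 := hfc u w
    have h2 := hfc w u
    have h3 := hf u w
    rw [if_neg h] at h1
    rw [if_neg (fun h' => h h'.symm)] at h2
    omega
  obtain ⟨E, hE1, hE2⟩ := extract_all G a (fun _ : Bool => b) Finset.univ f hf hfz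
    (fun _ _ => hab) (by
      intro w hw
      rw [hfn w]
      by_cases hwb : w = b
      · subst hwb; simp [hw]
      · have : ¬ b = w := fun h => hwb h.symm
        simp [hw, hwb, this])
  obtain ⟨P, hP, hPE⟩ := hE1 true (Finset.mem_univ _)
  obtain ⟨Q, hQ, hQE⟩ := hE1 false (Finset.mem_univ _)
  refine ⟨P, Q, hP, hQ, ?_⟩
  intro e
  induction e using Sym2.ind with
  | _ u w =>
    intro h1 h2
    have h3 := hE2 u w
    have h4 : (Finset.univ.filter fun i => s(u,w) ∈ E i) = Finset.univ := by
      apply Finset.filter_true_of_mem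
      intro i _
      cases i
      · exact (hQE _).2 h2
      · exact (hPE _).2 h1
    rw [h4] at h3
    simp only [Finset.card_univ, Fintype.card_bool] at h3
    have h5 : |f u w| ≤ 1 := by
      have e1 : f u w ≤ 1 := (hfc u w).trans (by split_ifs <;> simp)
      have e2 : f w u ≤ 1 := (hfc w u).trans (by split_ifs <;> simp)
      have e3 := hf u w
      rw [abs_le]; omega
    push_cast at h3
    omega

/-- Tight sets. -/
def Tight (G : SimpleGraph V) (S : Finset V) (a b : V) (M : ℤ) (X : Finset V) : Prop :=
  a ∉ X ∧ b ∉ X ∧ dd G X = 3 ∧ 4 * ((X ∩ S).card : ℤ) = 3 * M - 1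

theorem card_le_of_avoid {S X : Finset V} {a b : V} (ha : a ∈ S) (hb : b ∈ S) (hab : b ≠ a)
    (hX1 : a ∉ X) (hX2 : b ∉ X) : (X ∩ S).card + 2 ≤ S.card := by
  have h : X ∩ S ⊆ (S.erase a).erase b := by
    intro v hv
    rw [Finset.mem_inter] at hv
    simp only [Finset.mem_erase]
    refine ⟨?_, ?_, hv.2⟩
    · rintro rfl; exact hX2 hv.1
    · rintro rfl; exact hX1 hv.1
  have h1 := Finset.card_le_card h
  have h2 : b ∈ S.erase a := Finset.mem_erase.2 ⟨hab, hb⟩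
  rw [Finset.card_erase_of_mem h2, Finset.card_erase_of_mem ha] at h1
  have h3 : ({a, b} : Finset V) ⊆ S := by
    intro v; simp only [Finset.mem_insert, Finset.mem_singleton]
    rintro (rfl | rfl) <;> assumption
  have h4 := Finset.card_le_card h3
  rw [Finset.card_pair hab.symm] at h4
  omega

theorem tight_inter {G : SimpleGraph V}
    (D : ∀ (X : Finset V) (x y : V), x ∈ X → y ∉ X → 2 ≤ dd G X)
    {S : Finset V} {a b : V} {M : ℤ} (ha : a ∈ S) (hb : b ∈ S) (hab : b ≠ a)
    (hM : M = (S.card : ℤ) - 1) (hodd : M % 2 = 1)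
    (LB : ∀ X : Finset V, a ∉ X → b ∉ X → 4 * ((X ∩ S).card : ℤ) ≤ M * dd G X)
    {X Y : Finset V} (hX : Tight G S a b M X) (hY : Tight G S a b M Y) :
    Tight G S a b M (X ∩ Y) := by
  obtain ⟨x1, x2, x3, x4⟩ := hX
  obtain ⟨y1, y2, y3, y4⟩ := hY
  have hi1 : a ∉ X ∩ Y := by simp [x1]
  have hi2 : b ∉ X ∩ Y := by simp [x2]
  have hu1 : a ∉ X ∪ Y := by simp [x1, y1]
  have hu2 : b ∉ X ∪ Y := by simp [x2, y2]
  have hk : ((X ∩ Y) ∩ S).card + ((X ∪ Y) ∩ S).card = (X ∩ S).card + (Y ∩ S).card := by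
    rw [← Finset.card_inter_add_card_union (X ∩ S) (Y ∩ S)]
    congr 2
    · ext v; simp only [Finset.mem_inter]; tauto
    · ext v; simp only [Finset.mem_inter, Finset.mem_union]; tauto
  have hsub := dd_submod G X Y
  have li := LB _ hi1 hi2
  have lu := LB _ hu1 hu2
  have ci := card_le_of_avoid ha hb hab hi1 hi2
  have cu := card_le_of_avoid ha hb hab hu1 hu2
  have hne : (X ∩ Y).Nonempty := by
    by_contra hcon
    rw [Finset.not_nonempty_iff_eq_empty] at hcon
    rw [hcon] at hk
    simp only [Finset.empty_inter, Finset.card_empty] at hk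
    omega
  obtain ⟨v, hv⟩ := hne
  have di := D _ v a hv hi1
  have du := D (X ∪ Y) v a (by simp only [Finset.mem_inter] at hv; simp [hv.1]) hu1
  have hd : (dd G (X ∩ Y) = 2 ∨ dd G (X ∪ Y) = 2) ∨ (dd G (X ∩ Y) = 3 ∧ dd G (X ∪ Y) = 3) := by
    omega
  rcases hd with (h | h) | ⟨h, h'⟩
  · rw [h] at li; omega
  · rw [h] at lu; omega
  · rw [h] at li; rw [h'] at lu
    exact ⟨hi1, hi2, h, by omega⟩

/-- Indicator of the edges of `G` off the walk `Q`. -/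
noncomputable def off {G : SimpleGraph V} {a b : V} (Q : G.Walk b a) (u w : V) : ℤ :=
  if G.Adj u w ∧ s(u,w) ∉ Q.edges then 1 else 0

theorem off_nonneg {G : SimpleGraph V} {a b : V} (Q : G.Walk b a) (u w : V) : 0 ≤ off Q u w := by
  unfold off; split_ifs <;> simp

theorem theta_or (G : SimpleGraph V)
    (D : ∀ (X : Finset V) (x y : V), x ∈ X → y ∉ X → 2 ≤ dd G X) {a b : V}
    {P Q : G.Walk b a} (hP : P.IsPath)
    (hPQ : ∀ e, e ∈ P.edges → e ∉ Q.edges) {X : Finset V} {x : V} (hx : x ∈ X)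
    (haX : a ∉ X) (hdX : dd G X ≤ 3) (hQX : ∀ v ∈ X, v ∉ Q.support) :
    (∃ θ : V → V → ℤ, Asym θ ∧ (∀ u w, ¬ G.Adj u w → θ u w = 0) ∧
      (∀ u w, s(u,w) ∈ Q.edges → θ u w = 0) ∧ (∀ u w, |θ u w| ≤ 2) ∧
      (∀ u w, w ∉ X → |θ u w| ≤ 1) ∧
      ∀ v, net θ v = 2 * (if v = x then 1 else 0) - (if v = a then 1 else 0)
        - (if v = b then 1 else 0)) ∨
    ∃ Z : Finset V, X ⊆ Z ∧ a ∉ Z ∧ b ∉ Z ∧ cs (off Q) Z ≤ 1 ∧ ∀ v ∈ Z, v ∉ P.support := by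
  by_contra hcon
  rw [not_or] at hcon
  obtain ⟨hno, hZ⟩ := hcon
  apply hno
  obtain ⟨c, hc⟩ : ∃ c : V → V → ℤ, c = fun u w =>
    if G.Adj u w ∧ s(u,w) ∉ Q.edges then (if u ∈ X ∧ w ∈ X then 2 else 1) else 0 := ⟨_, rfl⟩
  have hc0 : ∀ u w, 0 ≤ c u w := by intro u w; rw [hc]; dsimp only; split_ifs <;> simp
  have hc2 : ∀ u w, c u w ≤ 2 := by intro u w; rw [hc]; dsimp only; split_ifs <;> simp
  have hcG : ∀ u w, ¬ G.Adj u w → c u w = 0 := by intro u w h; simp [hc, h]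
  have hcQ : ∀ u w, s(u,w) ∈ Q.edges → c u w = 0 := by intro u w h; simp [hc, h]
  have hc1 : ∀ u w, (u ∉ X ∨ w ∉ X) → c u w ≤ 1 := by
    intro u w h
    have : ¬ (u ∈ X ∧ w ∈ X) := by tauto
    simp only [hc, this, if_false]
    split_ifs <;> simp
  have hoff : ∀ u w, off Q u w ≤ c u w := by
    intro u w; simp only [hc, off]; split_ifs <;> simp
  obtain ⟨θ, h1, h2, h3⟩ := flow_exists G c
    (fun v => 2 * (if v = x then 1 else 0) - (if v = a then 1 else 0)
        - (if v = b then 1 else 0)) hc0 hcG (by simp [Finset.sum_sub_distrib]) (by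
    intro Z
    have hsum : ∑ v ∈ Z, (2 * (if v = x then (1:ℤ) else 0) - (if v = a then 1 else 0)
        - (if v = b then 1 else 0)) = 2 * (if x ∈ Z then 1 else 0) - (if a ∈ Z then 1 else 0)
        - (if b ∈ Z then 1 else 0) := by simp [Finset.sum_sub_distrib]
    rw [hsum]
    have hnn : 0 ≤ cs c Z := cs_nonneg fun u _ w _ => hc0 u w
    by_cases hxZ : x ∈ Z
    swap
    · simp only [hxZ, if_false]
      split_ifs <;> omega
    simp only [hxZ, if_true]
    by_cases hXZ : X ⊆ Z
    swap
    · obtain ⟨y, hy, hyZ⟩ := Finset.not_subset.1 hXZ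
      have : ¬ ∀ u ∈ X ∩ Z, ∀ w ∈ X \ Z, ¬ G.Adj u w := by
        intro hall
        have e1 := dd_split G X Z hall
        have e2 := D (X ∩ Z) x a (by simp [hx, hxZ]) (by simp [haX])
        have e3 := D (X \ Z) y a (by simp [hy, hyZ]) (by simp [haX])
        omega
      push Not at this
      obtain ⟨u, hu, w, hw, huw⟩ := this
      rw [Finset.mem_inter] at hu
      rw [Finset.mem_sdiff] at hw
      have hnQ : s(u,w) ∉ Q.edges := fun h => hQX u hu.1 (Q.fst_mem_support_of_mem_edges h)
      have e4 := le_cs_of_mem (c := c) (fun u _ w _ => hc0 u w) hu.2 hw.2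
      have e5 : c u w = 2 := by simp [hc, huw, hnQ, hu.1, hw.1]
      split_ifs <;> omega
    have hsep : cs (chi P) Z ≠ 0 → 1 ≤ cs c Z := by
      intro h
      obtain ⟨u, hu, w, hw, hne⟩ := exists_of_cs_ne h
      have hm := chi_ne_mem hP hne
      have e4 := le_cs_of_mem (c := off Q) (X := Z) (fun u _ w _ => off_nonneg Q u w) hu hw
      have e5 : off Q u w = 1 := by simp [off, P.adj_of_mem_edges hm, hPQ _ hm]
      have e6 : cs (off Q) Z ≤ cs c Z := cs_mono fun u _ w _ => hoff u w
      omega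
    rw [cs_chi] at hsep
    by_cases haZ : a ∈ Z <;> by_cases hbZ : b ∈ Z <;> simp only [haZ, hbZ, if_true, if_false]
    · omega
    · have := hsep (by simp [haZ, hbZ]); omega
    · have := hsep (by simp [haZ, hbZ]); omega
    · by_contra hlt
      have e6 : cs (off Q) Z ≤ cs c Z := cs_mono fun u _ w _ => hoff u w
      refine hZ ⟨Z, hXZ, haZ, hbZ, by omega, ?_⟩
      intro v hv hvP
      obtain ⟨u, hu, w, hw, hm⟩ := path_cross P hbZ hv hvP
      have e7 := le_cs_of_mem (c := fun u w => chi P u w % 2) (X := Z)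
        (fun u _ w _ => by omega) hu hw
      have e8 : chi P u w % 2 = 1 := by
        rcases chi_mem hP hm with h | h <;> rw [h] <;> rfl
      have e9 := cs_mod (chi P) Z
      rw [cs_chi] at e9
      simp only [haZ, hbZ, if_false] at e9
      have e10 : cs (fun u w => chi P u w % 2) Z ≤ cs (off Q) Z := by
        refine cs_mono fun u _ w _ => ?_
        by_cases hm : s(u,w) ∈ P.edges
        · have : off Q u w = 1 := by simp [off, P.adj_of_mem_edges hm, hPQ _ hm]
          omega
        · rw [chi_not_mem hP hm]
          exact off_nonneg Q u w
      simp only [e8] at e7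
      omega)
  refine ⟨θ, h1, ?_, ?_, ?_, ?_, h3⟩
  · intro u w h
    have e1 := h2 u w
    have e2 := h2 w u
    have e3 := h1 u w
    rw [hcG u w h] at e1
    rw [hcG w u (fun h' => h h'.symm)] at e2
    omega
  · intro u w h
    have e1 := h2 u w
    have e2 := h2 w u
    have e3 := h1 u w
    rw [hcQ u w h] at e1
    rw [hcQ w u (by rwa [Sym2.eq_swap])] at e2
    omega
  · intro u w
    have e1 := h2 u w
    have e2 := h2 w u
    have e3 := h1 u w
    have e4 := hc2 u w
    have e5 := hc2 w u
    rw [abs_le]; omega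
  · intro u w h
    have e1 := h2 u w
    have e2 := h2 w u
    have e3 := h1 u w
    have e4 := hc1 u w (Or.inr h)
    have e5 := hc1 w u (Or.inl h)
    rw [abs_le]; omega

/-- The conditions on the auxiliary flow, odd case. -/
def OddGood (G : SimpleGraph V) (S : Finset V) (a b : V) (M : ℤ) : Prop :=
  ∃ (h : V → V → ℤ) (η : V → ℤ), Asym h ∧ (∀ u w, ¬ G.Adj u w → h u w = 0) ∧
    (∀ u w, |h u w| ≤ M) ∧ (∀ v, net h v = 2 * η v) ∧
    (∀ X : Finset V, (a ∈ X ↔ b ∉ X) → 2 ≤ cs (fun u w => h u w % 2) X) ∧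
    (∀ X, Tight G S a b M X → 2 ≤ cs (fun u w => h u w % 2) X)

theorem oddGood_PQ {G : SimpleGraph V} {S : Finset V} {a b : V} {M : ℤ} (hM : 1 ≤ M)
    {P Q : G.Walk b a} (hP : P.IsPath) (hQ : Q.IsPath)
    (hPQ : ∀ e, e ∈ P.edges → e ∉ Q.edges)
    (hT : ∀ X, Tight G S a b M X → ∃ v ∈ X, v ∈ P.support ∨ v ∈ Q.support) :
    OddGood G S a b M := by
  have hcase : ∀ u w, (s(u,w) ∈ P.edges ∨ s(u,w) ∈ Q.edges) →
      chi P u w + chi Q u w = 1 ∨ chi P u w + chi Q u w = -1 := by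
    rintro u w (h | h)
    · rw [chi_not_mem hQ (hPQ _ h), add_zero]; exact chi_mem hP h
    · rw [chi_not_mem hP (fun h' => hPQ _ h' h), zero_add]; exact chi_mem hQ h
  have hcase' : ∀ u w, (s(u,w) ∈ P.edges ∨ s(u,w) ∈ Q.edges) →
      (chi P u w + chi Q u w) % 2 = 1 := by
    intro u w h
    rcases hcase u w h with h | h <;> rw [h] <;> rfl
  have hzero : ∀ u w, ¬ (s(u,w) ∈ P.edges ∨ s(u,w) ∈ Q.edges) →
      chi P u w + chi Q u w = 0 := by
    intro u w h
    rw [not_or] at h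
    rw [chi_not_mem hP h.1, chi_not_mem hQ h.2]; rfl
  refine ⟨fun u w => chi P u w + chi Q u w,
    fun v => (if v = b then 1 else 0) - (if v = a then 1 else 0), ?_, ?_, ?_, ?_, ?_, ?_⟩
  · intro u w
    have h1 := chi_asym P u w
    have h2 := chi_asym Q u w
    simp only; omega
  · intro u w h
    refine hzero u w ?_
    rintro (h' | h')
    · exact h (P.adj_of_mem_edges h')
    · exact h (Q.adj_of_mem_edges h')
  · intro u w
    by_cases h : s(u,w) ∈ P.edges ∨ s(u,w) ∈ Q.edges
    · rcases hcase u w h with h | h <;> simp only [h] <;> simpa using hM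
    · simp only [hzero u w h]; simp; omega
  · intro v
    rw [net_add, chi_net, chi_net]; ring
  · intro X hX
    have hne : ∀ R : G.Walk b a, cs (chi R) X ≠ 0 := by
      intro R
      rw [cs_chi]
      by_cases h1 : a ∈ X
      · have := hX.1 h1; simp [h1, this]
      · have : b ∈ X := by tauto
        simp [h1, this]
    obtain ⟨u, hu, w, hw, h1⟩ := exists_of_cs_ne (hne P)
    obtain ⟨u', hu', w', hw', h2⟩ := exists_of_cs_ne (hne Q)
    have m1 := chi_ne_mem hP h1
    have m2 := chi_ne_mem hQ h2
    have hne : (u, w) ≠ (u', w') := by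
      intro h
      simp only [Prod.mk.injEq] at h
      rw [← h.1, ← h.2] at m2
      exact hPQ _ m1 m2
    have := two_le_cs (c := fun u w => (chi P u w + chi Q u w) % 2)
      (fun u _ w _ => by omega) hu hw hu' hw' hne
    simp only [hcase' u w (Or.inl m1), hcase' u' w' (Or.inr m2)] at this
    exact this
  · intro X hX
    obtain ⟨v, hv, hv2⟩ := hT X hX
    obtain ⟨u, hu, w, hw, hm⟩ : ∃ u ∈ X, ∃ w, w ∉ X ∧ (s(u,w) ∈ P.edges ∨ s(u,w) ∈ Q.edges) := by
      rcases hv2 with h | h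
      · obtain ⟨u, hu, w, hw, hm⟩ := path_cross P hX.2.1 hv h
        exact ⟨u, hu, w, hw, Or.inl hm⟩
      · obtain ⟨u, hu, w, hw, hm⟩ := path_cross Q hX.2.1 hv h
        exact ⟨u, hu, w, hw, Or.inr hm⟩
    have e1 := le_cs_of_mem (c := fun u w => (chi P u w + chi Q u w) % 2) (X := X)
      (fun u _ w _ => by omega) hu hw
    simp only [hcase' u w hm] at e1
    have e2 := cs_mod (fun u w => chi P u w + chi Q u w) X
    rw [cs_add, cs_chi, cs_chi] at e2
    simp only [hX.1, hX.2.1, if_false] at e2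
    simp only
    omega

theorem oddGood_theta {G : SimpleGraph V} {S : Finset V} {a b : V} {M : ℤ} (hM : 2 ≤ M)
    {Q : G.Walk b a} (hQ : Q.IsPath) {X : Finset V} {x : V} (hx : x ∈ X)
    (hT : ∀ Y, Tight G S a b M Y → X ⊆ Y) {θ : V → V → ℤ} (h1 : Asym θ)
    (h2 : ∀ u w, ¬ G.Adj u w → θ u w = 0)
    (h3 : ∀ u w, s(u,w) ∈ Q.edges → θ u w = 0) (h4 : ∀ u w, |θ u w| ≤ 2)
    (h5 : ∀ u w, w ∉ X → |θ u w| ≤ 1)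
    (h6 : ∀ v, net θ v = 2 * (if v = x then 1 else 0) - (if v = a then 1 else 0)
        - (if v = b then 1 else 0)) : OddGood G S a b M := by
  have hcs : ∀ Y : Finset V, cs θ Y = 2 * (if x ∈ Y then 1 else 0) - (if a ∈ Y then 1 else 0)
        - (if b ∈ Y then 1 else 0) := by
    intro Y
    rw [← sum_net h1]
    simp [h6, Finset.sum_sub_distrib]
  refine ⟨fun u w => chi Q u w + θ u w,
    fun v => (if v = x then 1 else 0) - (if v = a then 1 else 0), ?_, ?_, ?_, ?_, ?_, ?_⟩
  · intro u w
    have e1 := chi_asym Q u w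
    have e2 := h1 u w
    simp only; omega
  · intro u w h
    have : s(u,w) ∉ Q.edges := fun h' => h (Q.adj_of_mem_edges h')
    simp only [h2 u w h, chi_not_mem hQ this]; rfl
  · intro u w
    simp only
    by_cases h : s(u,w) ∈ Q.edges
    · rw [h3 u w h, add_zero]
      rcases chi_mem hQ h with h | h <;> rw [h] <;> simp <;> omega
    · rw [chi_not_mem hQ h, zero_add]
      exact (h4 u w).trans hM
  · intro v
    rw [net_add, chi_net, h6]; ring
  · intro Y hY
    have hne : cs (chi Q) Y ≠ 0 := by
      rw [cs_chi]
      by_cases h1 : a ∈ Y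
      · have := hY.1 h1; simp [h1, this]
      · have : b ∈ Y := by tauto
        simp [h1, this]
    obtain ⟨u, hu, w, hw, e1⟩ := exists_of_cs_ne hne
    have m1 := chi_ne_mem hQ e1
    have hne2 : cs (fun u w => θ u w % 2) Y ≠ 0 := by
      intro h
      have e2 := cs_mod θ Y
      rw [hcs, h] at e2
      by_cases h1 : a ∈ Y
      · have := hY.1 h1
        simp only [h1, this, if_true, if_false] at e2
        split_ifs at e2 <;> omega
      · have : b ∈ Y := by tauto
        simp only [h1, this, if_true, if_false] at e2
        split_ifs at e2 <;> omega
    obtain ⟨u', hu', w', hw', e2⟩ := exists_of_cs_ne hne2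
    have m2 : s(u',w') ∉ Q.edges := by
      intro h
      rw [h3 _ _ h] at e2
      exact e2 rfl
    have hne : (u, w) ≠ (u', w') := by
      intro h
      simp only [Prod.mk.injEq] at h
      rw [← h.1, ← h.2] at m2
      exact m2 m1
    have := two_le_cs (c := fun u w => (chi Q u w + θ u w) % 2)
      (fun u _ w _ => by omega) hu hw hu' hw' hne
    simp only [h3 u w m1, chi_not_mem hQ m2] at this
    simp only
    rcases chi_mem hQ m1 with h | h <;> rw [h] at this <;> omega
  · intro Y hY
    have hXY := hT Y hY
    have e1 : cs (fun u w => chi Q u w + θ u w) Y = 2 := by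
      rw [cs_add, cs_chi, hcs]
      simp [hXY hx, hY.1, hY.2.1]
    refine e1.ge.trans ?_
    refine cs_mono fun u hu w hw => ?_
    simp only
    by_cases h : s(u,w) ∈ Q.edges
    · rw [h3 u w h]
      rcases chi_mem hQ h with h | h <;> rw [h] <;> simp
    · rw [chi_not_mem hQ h]
      have := h5 u w (fun h => hw (hXY h))
      rw [abs_le] at this
      omega

theorem oddGood (G : SimpleGraph V)
    (D : ∀ (X : Finset V) (x y : V), x ∈ X → y ∉ X → 2 ≤ dd G X)
    {S : Finset V} {a b : V} {M : ℤ} (ha : a ∈ S) (hb : b ∈ S) (hab : b ≠ a)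
    (hM : M = (S.card : ℤ) - 1) (hM1 : 1 ≤ M) (hodd : M % 2 = 1)
    (LB : ∀ X : Finset V, a ∉ X → b ∉ X → 4 * ((X ∩ S).card : ℤ) ≤ M * dd G X) :
    OddGood G S a b M := by
  obtain ⟨P, Q, hP, hQ, hPQ⟩ := two_paths G D hab
  by_cases hex : ∃ X, Tight G S a b M X
  swap
  · push Not at hex
    exact oddGood_PQ hM1 hP hQ hPQ fun X hX => absurd hX (hex X)
  obtain ⟨X0, hX0⟩ := hex
  obtain ⟨X, hX, hmin⟩ := Finset.exists_min_image
    (Finset.univ.filter fun X => Tight G S a b M X) Finset.card ⟨X0, by simp [hX0]⟩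
  simp only [Finset.mem_filter, Finset.mem_univ, true_and] at hX hmin
  have hsub : ∀ Y, Tight G S a b M Y → X ⊆ Y := by
    intro Y hY
    have h1 := hmin _ (tight_inter D ha hb hab hM hodd LB hX hY)
    have h2 := Finset.eq_of_subset_of_card_le (Finset.inter_subset_left (s₁ := X) (s₂ := Y)) h1
    rw [← h2]
    exact Finset.inter_subset_right
  by_cases hvis : ∃ v ∈ X, v ∈ P.support ∨ v ∈ Q.support
  · obtain ⟨v, hv, hv2⟩ := hvis
    exact oddGood_PQ hM1 hP hQ hPQ fun Y hY => ⟨v, hsub Y hY hv, hv2⟩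
  push Not at hvis
  have hX4 := hX.2.2.2
  have hM3 : 3 ≤ M := by omega
  have hXne : (X ∩ S).Nonempty := by
    rw [← Finset.card_pos]; omega
  obtain ⟨x, hxS⟩ := hXne
  have hx : x ∈ X := (Finset.mem_inter.1 hxS).1
  have hQP : ∀ e, e ∈ Q.edges → e ∉ P.edges := fun e h h' => hPQ e h' h
  rcases theta_or G D hP hPQ hx hX.1 hX.2.2.1.le (fun v hv => (hvis v hv).2) with
    ⟨θ, h1, h2, h3, h4, h5, h6⟩ | ⟨Z1, z1, z2, z3, z4, z5⟩
  · exact oddGood_theta (by omega) hQ hx hsub h1 h2 h3 h4 h5 h6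
  rcases theta_or G D hQ hQP hx hX.1 hX.2.2.1.le (fun v hv => (hvis v hv).1) with
    ⟨θ, h1, h2, h3, h4, h5, h6⟩ | ⟨Z2, y1, y2, y3, y4, y5⟩
  · exact oddGood_theta (by omega) hP hx hsub h1 h2 h3 h4 h5 h6
  exfalso
  have hdd : dd G (Z1 ∩ Z2) ≤ cs (off Q) Z1 + cs (off P) Z2 := by
    simp only [dd, cs_eq_all, ← Finset.sum_add_distrib]
    refine Finset.sum_le_sum fun u _ => Finset.sum_le_sum fun w _ => ?_
    have o1 := off_nonneg Q u w
    have o2 := off_nonneg P u w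
    have n1 : 0 ≤ (if u ∈ Z1 ∧ w ∉ Z1 then off Q u w else 0) := by split_ifs <;> omega
    have n2 : 0 ≤ (if u ∈ Z2 ∧ w ∉ Z2 then off P u w else 0) := by split_ifs <;> omega
    by_cases hc : (u ∈ Z1 ∩ Z2 ∧ w ∉ Z1 ∩ Z2) ∧ G.Adj u w
    · obtain ⟨⟨hu, hw⟩, huw⟩ := hc
      rw [Finset.mem_inter] at hu
      rw [if_pos ⟨by simp [hu], hw⟩, if_pos huw]
      have q1 : s(u,w) ∉ Q.edges := fun h => y5 u hu.2 (Q.fst_mem_support_of_mem_edges h)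
      have q2 : s(u,w) ∉ P.edges := fun h => z5 u hu.1 (P.fst_mem_support_of_mem_edges h)
      have p1 : off Q u w = 1 := by simp [off, huw, q1]
      have p2 : off P u w = 1 := by simp [off, huw, q2]
      by_cases hw1 : w ∈ Z1
      · have hw2 : w ∉ Z2 := fun h => hw (Finset.mem_inter.2 ⟨hw1, h⟩)
        rw [if_pos (⟨hu.2, hw2⟩ : u ∈ Z2 ∧ w ∉ Z2)]
        omega
      · rw [if_pos (⟨hu.1, hw1⟩ : u ∈ Z1 ∧ w ∉ Z1)]
        omega
    · have : (if u ∈ Z1 ∩ Z2 ∧ w ∉ Z1 ∩ Z2 then (if G.Adj u w then (1:ℤ) else 0) else 0) = 0 := by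
        split_ifs <;> simp_all
      rw [this]; omega
  have hLB := LB (Z1 ∩ Z2) (by simp [z2]) (by simp [z3])
  have hcard : (X ∩ S).card ≤ ((Z1 ∩ Z2) ∩ S).card := by
    apply Finset.card_le_card
    intro v hv
    simp only [Finset.mem_inter] at hv ⊢
    exact ⟨⟨z1 hv.1, y1 hv.1⟩, hv.2⟩
  have : M * dd G (Z1 ∩ Z2) ≤ M * 2 := mul_le_mul_of_nonneg_left (by omega) (by omega)
  omega

/-- The auxiliary flow. -/
theorem aux_flow (G : SimpleGraph V)
    (D : ∀ (X : Finset V) (x y : V), x ∈ X → y ∉ X → 2 ≤ dd G X)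
    {S : Finset V} {a b : V} {M : ℤ} (ha : a ∈ S) (hb : b ∈ S) (hab : b ≠ a)
    (hM : M = (S.card : ℤ) - 1) (hM1 : 1 ≤ M)
    (LB : ∀ X : Finset V, a ∉ X → b ∉ X → 4 * ((X ∩ S).card : ℤ) ≤ M * dd G X) :
    ∃ (h : V → V → ℤ) (η : V → ℤ), Asym h ∧ (∀ u w, ¬ G.Adj u w → h u w = 0) ∧
    (∀ u w, |h u w| ≤ M) ∧ (∀ v, net h v = 2 * η v) ∧
    (∀ X : Finset V, (a ∈ X ↔ b ∉ X) →
      2 * M ≤ cs (fun u w => if G.Adj u w then M - (M - h u w) % 2 else 0) X) ∧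
    (∀ X : Finset V, a ∉ X → b ∉ X → 4 * ((X ∩ S).card : ℤ) ≤
      cs (fun u w => if G.Adj u w then M - (M - h u w) % 2 else 0) X) := by
  have hsep : ∀ X : Finset V, (a ∈ X ↔ b ∉ X) → 2 ≤ dd G X := by
    intro X hX
    by_cases h : a ∈ X
    · exact D X a b h (hX.1 h)
    · exact D X b a (by tauto) h
  by_cases hodd : M % 2 = 1
  · obtain ⟨h, η, h1, h2, h3, h4, h5, h6⟩ := oddGood G D ha hb hab hM hM1 hodd LB
    have hW : ∀ X, cs (fun u w => if G.Adj u w then M - (M - h u w) % 2 else 0) X =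
        (M - 1) * dd G X + cs (fun u w => h u w % 2) X := by
      intro X
      rw [dd, ← cs_mul, ← cs_add]
      refine cs_congr fun u _ w _ => ?_
      by_cases huw : G.Adj u w
      · simp only [huw, if_true]; omega
      · simp [huw, h2 u w huw]
    refine ⟨h, η, h1, h2, h3, h4, ?_, ?_⟩
    · intro X hX
      rw [hW]
      have e1 := h5 X hX
      have e2 := mul_le_mul_of_nonneg_left (hsep X hX) (show 0 ≤ M - 1 by omega)
      omega
    · intro X hXa hXb
      rw [hW]
      have e0 := cs_mod_nonneg h X
      by_cases hne : X.Nonempty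
      swap
      · rw [Finset.not_nonempty_iff_eq_empty] at hne
        subst hne
        simp [cs, dd]
      obtain ⟨x, hx⟩ := hne
      have e1 := D X x a hx hXa
      have e2 := LB X hXa hXb
      have e3 := card_le_of_avoid ha hb hab hXa hXb
      have e4 := h6 X
      by_cases hd2 : dd G X = 2
      · rw [hd2] at e2 ⊢; omega
      by_cases hd3 : dd G X = 3
      · rw [hd3] at e2 ⊢
        by_cases ht : 4 * ((X ∩ S).card : ℤ) = 3 * M - 1
        · have := e4 ⟨hXa, hXb, hd3, ht⟩
          omega
        · omega
      have e5 := mul_le_mul_of_nonneg_left (show 4 ≤ dd G X by omega) (show 0 ≤ M - 1 by omega)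
      omega
  · refine ⟨fun _ _ => 0, fun _ => 0, fun _ _ => by simp, fun _ _ _ => rfl, fun _ _ => ?_,
      fun v => by simp [net], ?_, ?_⟩
    · simp; omega
    all_goals
      have hW : ∀ X, cs (fun u w => if G.Adj u w then M - (M - 0) % 2 else 0) X =
          M * dd G X := by
        intro X
        rw [dd, ← cs_mul]
        refine cs_congr fun u _ w _ => ?_
        by_cases huw : G.Adj u w
        · simp only [huw, if_true]; omega
        · simp [huw]
    · intro X hX
      rw [hW]
      have e2 := mul_le_mul_of_nonneg_left (hsep X hX) (show 0 ≤ M by omega)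
      omega
    · intro X hXa hXb
      rw [hW]
      exact LB X hXa hXb

theorem pair_step (G : SimpleGraph V)
    (D : ∀ (X : Finset V) (x y : V), x ∈ X → y ∉ X → 2 ≤ dd G X)
    {S : Finset V} {a b : V} {M : ℤ} (ha : a ∈ S) (hb : b ∈ S) (hab : b ≠ a)
    (hM : M = (S.card : ℤ) - 1) (hM1 : 1 ≤ M)
    (LB : ∀ X : Finset V, a ∉ X → b ∉ X → 4 * ((X ∩ S).card : ℤ) ≤ M * dd G X)
    (T : Finset V) (hT : T = (S.erase a).erase b) :
    ∃ EA EB : V × Bool → Finset (Sym2 V),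
      (∀ v ∈ T, ∀ i, IsPE G v a (EA (v, i))) ∧ IsPE G b a (EA (b, true)) ∧
      (∀ v ∈ T, ∀ i, IsPE G v b (EB (v, i))) ∧ IsPE G a b (EB (a, true)) ∧
      ∀ e, (((insert (b, true) (T ×ˢ univ)).filter fun i => e ∈ EA i).card : ℤ) +
        (((insert (a, true) (T ×ˢ univ)).filter fun i => e ∈ EB i).card : ℤ) ≤ M := by
  obtain ⟨h, η, h1, h2, h3, h4, h5, h6⟩ := aux_flow G D ha hb hab hM hM1 LB
  have haT : a ∉ T := by simp [hT]
  have hbT : b ∉ T := by simp [hT]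
  have hTcard : (T.card : ℤ) = M - 1 := by
    have e1 : b ∈ S.erase a := Finset.mem_erase.2 ⟨hab, hb⟩
    have e2 := Finset.card_erase_add_one e1
    have e3 := Finset.card_erase_add_one ha
    rw [hT]; omega
  obtain ⟨W, hW⟩ : ∃ W : V → V → ℤ,
    W = fun u w => if G.Adj u w then M - (M - h u w) % 2 else 0 := ⟨_, rfl⟩
  rw [← hW] at h5 h6
  have hW0 : ∀ u w, 0 ≤ W u w := by
    intro u w; rw [hW]; dsimp only; split_ifs <;> omega
  obtain ⟨c, hc⟩ : ∃ c : V → V → ℤ,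
    c = fun u w => if G.Adj u w then (M - h u w) / 2 else 0 := ⟨_, rfl⟩
  have hcG : ∀ u w, ¬ G.Adj u w → c u w = 0 := by intro u w h; simp [hc, h]
  have hc0 : ∀ u w, 0 ≤ c u w := by
    intro u w
    have := h3 u w
    rw [abs_le] at this
    rw [hc]; dsimp only; split_ifs <;> omega
  have hcW : ∀ X, 2 * cs c X = cs W X - 2 * ∑ v ∈ X, η v := by
    intro X
    have e1 : 2 * ∑ v ∈ X, η v = cs h X := by
      rw [← sum_net h1, Finset.mul_sum]
      exact Finset.sum_congr rfl fun v _ => (h4 v).symm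
    rw [e1, ← cs_sub, ← cs_mul]
    refine cs_congr fun u _ w _ => ?_
    by_cases huw : G.Adj u w
    · simp only [hc, hW, huw, if_true]; omega
    · simp [hc, hW, huw, h2 u w huw]
  have hη : ∑ v, η v = 0 := by
    have e1 := hcW univ
    simp only [cs, Finset.compl_univ, Finset.sum_empty, Finset.sum_const_zero] at e1
    omega
  obtain ⟨βf, hβf⟩ : ∃ β : V → ℤ, β = fun v => 2 * (if v ∈ T then 1 else 0) -
    (M - 1) * (if v = a then 1 else 0) - (M - 1) * (if v = b then 1 else 0) := ⟨_, rfl⟩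
  obtain ⟨βg, hβg⟩ : ∃ β : V → ℤ, β = fun v =>
    M * (if v = b then 1 else 0) - M * (if v = a then 1 else 0) := ⟨_, rfl⟩
  have sf : ∀ X : Finset V, ∑ v ∈ X, βf v = 2 * ((X ∩ T).card : ℤ) -
      (M - 1) * (if a ∈ X then 1 else 0) - (M - 1) * (if b ∈ X then 1 else 0) := by
    intro X
    rw [hβf]
    simp only [Finset.sum_sub_distrib, ← Finset.mul_sum, Finset.sum_ite_eq', Finset.sum_boole,
      Finset.filter_mem_eq_inter]
  have sg : ∀ X : Finset V, ∑ v ∈ X, βg v =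
      M * (if b ∈ X then 1 else 0) - M * (if a ∈ X then 1 else 0) := by
    intro X
    rw [hβg]
    simp only [Finset.sum_sub_distrib, ← Finset.mul_sum, Finset.sum_ite_eq']
  have bnd : ∀ X : Finset V, 2 * ∑ v ∈ X, βf v ≤ cs W X ∧ 2 * ∑ v ∈ X, βg v ≤ cs W X := by
    intro X
    rw [sf, sg]
    have w0 : 0 ≤ cs W X := cs_nonneg fun u _ w _ => hW0 u w
    have k0 : (X ∩ T).card ≤ T.card := Finset.card_le_card Finset.inter_subset_right
    by_cases hXa : a ∈ X <;> by_cases hXb : b ∈ X <;> simp only [hXa, hXb, if_true, if_false]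
    · constructor <;> omega
    · have := h5 X (by simp [hXa, hXb])
      constructor <;> omega
    · have := h5 X (by simp [hXa, hXb])
      constructor <;> omega
    · have := h6 X hXa hXb
      have k1 : (X ∩ T).card ≤ (X ∩ S).card := by
        apply Finset.card_le_card
        intro v hv
        rw [hT] at hv
        simp only [Finset.mem_inter, Finset.mem_erase] at hv ⊢
        exact ⟨hv.1, hv.2.2.2⟩
      constructor <;> omega
  obtain ⟨f, f1, f2, f3⟩ := flow_exists G c (fun v => βf v - η v) hc0 hcG (by
      rw [Finset.sum_sub_distrib, hη, sf]
      simp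
      omega) (by
      intro X
      have e1 := (bnd X).1
      have e2 := hcW X
      rw [Finset.sum_sub_distrib]
      omega)
  obtain ⟨g, g1, g2, g3⟩ := flow_exists G c (fun v => βg v - η v) hc0 hcG (by
      rw [Finset.sum_sub_distrib, hη, sg]
      simp) (by
      intro X
      have e1 := (bnd X).2
      have e2 := hcW X
      rw [Finset.sum_sub_distrib]
      omega)
  have zero : ∀ k : V → V → ℤ, Asym k → (∀ u w, k u w ≤ c u w) →
      ∀ u w, ¬ G.Adj u w → k u w = 0 := by
    intro k k1 k2 u w huw
    have e1 := k2 u w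
    have e2 := k2 w u
    have e3 := k1 u w
    rw [hcG u w huw] at e1
    rw [hcG w u (fun h' => huw h'.symm)] at e2
    omega
  have hsrc : ∀ x y w : V, x ∉ T → w ≠ y →
      (((insert (x, true) (T ×ˢ univ)).filter fun i : V × Bool => i.1 = w).card : ℤ) ≤
      2 * (if w ∈ T then 1 else 0) + (if w = x then 1 else 0) := by
    intro x y w hx hw
    by_cases hwT : w ∈ T
    · have hwx : w ≠ x := by rintro rfl; exact hx hwT
      have hs : ((insert (x, true) (T ×ˢ univ)).filter fun i : V × Bool => i.1 = w) ⊆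
          {(w, true), (w, false)} := by
        rintro ⟨i, j⟩ hi
        simp only [Finset.mem_filter] at hi
        obtain ⟨-, rfl⟩ := hi
        cases j <;> simp
      have e1 := (Finset.card_le_card hs).trans Finset.card_le_two
      simp only [hwT, hwx, if_true, if_false]
      omega
    · by_cases hwx : w = x
      · subst hwx
        have hs : ((insert (w, true) (T ×ˢ univ)).filter fun i : V × Bool => i.1 = w) ⊆
            {(w, true)} := by
          rintro ⟨i, j⟩ hi
          simp only [Finset.mem_filter, Finset.mem_insert, Finset.mem_product] at hi
          obtain ⟨hi, rfl⟩ := hi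
          rcases hi with hi | hi
          · simp [hi]
          · exact absurd hi.1 hwT
        have e1 := Finset.card_le_card hs
        rw [Finset.card_singleton] at e1
        simp only [hwT, if_true, if_false]
        omega
      · have hs : ((insert (x, true) (T ×ˢ univ)).filter fun i : V × Bool => i.1 = w) = ∅ := by
          apply Finset.filter_eq_empty_iff.2
          rintro ⟨i, j⟩ hi rfl
          simp only [Finset.mem_insert, Finset.mem_product, Prod.mk.injEq] at hi
          rcases hi with hi | hi
          · exact hwx hi.1
          · exact hwT hi.1
        rw [hs]
        simp [hwT, hwx]
  obtain ⟨EA, A1, A2⟩ := extract_all G a (Prod.fst : V × Bool → V)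
    (insert (b, true) (T ×ˢ univ)) (fun u w => (f u w + g u w) + h u w)
    (by
      intro u w
      have e1 := f1 u w
      have e2 := g1 u w
      have e3 := h1 u w
      simp only; omega)
    (by
      intro u w huw
      simp only [zero f f1 f2 u w huw, zero g g1 g2 u w huw, h2 u w huw]; rfl)
    (by
      rintro ⟨i, j⟩ hi
      simp only [Finset.mem_insert, Finset.mem_product, Prod.mk.injEq] at hi
      rcases hi with hi | hi
      · rw [hi.1]; exact hab
      · rintro rfl; exact haT hi.1)
    (by
      intro w hw
      refine (hsrc b a w hbT hw).trans ?_
      rw [net_add, net_add, f3, g3, h4, hβf, hβg]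
      simp only [hw, if_false]
      split_ifs <;> omega)
  obtain ⟨EB, B1, B2⟩ := extract_all G b (Prod.fst : V × Bool → V)
    (insert (a, true) (T ×ˢ univ)) (fun u w => f u w - g u w)
    (by
      intro u w
      have e1 := f1 u w
      have e2 := g1 u w
      simp only; omega)
    (by
      intro u w huw
      simp only [zero f f1 f2 u w huw, zero g g1 g2 u w huw]; rfl)
    (by
      rintro ⟨i, j⟩ hi
      simp only [Finset.mem_insert, Finset.mem_product, Prod.mk.injEq] at hi
      rcases hi with hi | hi
      · rw [hi.1]; exact hab.symm
      · rintro rfl; exact hbT hi.1)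
    (by
      intro w hw
      refine (hsrc a b w haT hw).trans ?_
      rw [net_sub, f3, g3, hβf, hβg]
      simp only [hw, if_false]
      split_ifs <;> omega)
  refine ⟨EA, EB, fun v hv i => A1 (v, i) (by simp [hv]), A1 (b, true) (by simp),
    fun v hv i => B1 (v, i) (by simp [hv]), B1 (a, true) (by simp), ?_⟩
  intro e
  induction e using Sym2.ind with
  | _ u w =>
    refine (add_le_add (A2 u w) (B2 u w)).trans ?_
    by_cases huw : G.Adj u w
    · have hwu := huw.symm
      have e1 := f2 u w
      have e2 := f2 w u
      have e3 := g2 u w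
      have e4 := g2 w u
      have e5 := f1 u w
      have e6 := g1 u w
      have e7 := h1 u w
      simp only [hc, huw, hwu, if_true] at e1 e2 e3 e4
      rcases abs_cases (f u w + g u w + h u w) with q | q <;>
        rcases abs_cases (f u w - g u w) with q' | q' <;> omega
    · simp only [zero f f1 f2 u w huw, zero g g1 g2 u w huw, h2 u w huw]
      simp; omega

theorem main_induction (G : SimpleGraph V)
    (D : ∀ (X : Finset V) (x y : V), x ∈ X → y ∉ X → 2 ≤ dd G X) :
    ∀ (n : ℕ) (S : Finset V), S.card = n →
    ∃ r : V → V → Finset (Sym2 V), (∀ x ∈ S, ∀ y ∈ S, x ≠ y → IsPE G x y (r x y)) ∧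
      ∀ e, ((S ×ˢ S).filter fun p => p.1 ≠ p.2 ∧ e ∈ r p.1 p.2).card ≤ n ^ 2 / 4 := by
  intro n
  induction n using Nat.strong_induction_on with
  | _ n ih =>
    intro S hS
    by_cases hn : n < 2
    · have hS1 : ∀ x ∈ S, ∀ y ∈ S, x = y := Finset.card_le_one.1 (by omega)
      refine ⟨fun _ _ => ∅, fun x hx y hy hne => absurd (hS1 x hx y hy) hne, fun e => by simp⟩
    · have hSne : S.Nonempty := Finset.card_pos.1 (by omega)
      obtain ⟨a, ha⟩ := hSne
      obtain ⟨b, hb, hab, LB⟩ := lemmaB G D S ha (by omega)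
      obtain ⟨T, hT⟩ : ∃ T, T = (S.erase a).erase b := ⟨_, rfl⟩
      obtain ⟨EA, EB, A1, A2, B1, B2, hload⟩ := pair_step G D ha hb hab rfl (by omega) LB T hT
      have hTcard : T.card = n - 2 := by
        have e1 : b ∈ S.erase a := Finset.mem_erase.2 ⟨hab, hb⟩
        rw [hT, Finset.card_erase_of_mem e1, Finset.card_erase_of_mem ha]; omega
      have hTm : ∀ v, v ∈ S → v ≠ a → v ≠ b → v ∈ T := by
        intro v h1 h2 h3
        rw [hT]; simp [h1, h2, h3]
      obtain ⟨r, hr1, hr2⟩ := ih (n - 2) (by omega) T hTcard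
      refine ⟨fun x y => if x = a then (if y = b then EB (a, true) else EA (y, false))
        else if x = b then (if y = a then EA (b, true) else EB (y, false))
        else if y = a then EA (x, true) else if y = b then EB (x, true) else r x y, ?_, ?_⟩
      · intro x hx y hy hxy
        simp only
        by_cases hxa : x = a
        · subst hxa
          by_cases hyb : y = b
          · subst hyb; simpa using B2
          · simp only [hyb, if_true, if_false]
            exact (A1 y (hTm y hy hxy.symm hyb) false).symm
        · by_cases hxb : x = b
          · subst hxb
            by_cases hya : y = a
            · subst hya; simpa [hxa] using A2
            · simp only [hxa, hya, if_true, if_false]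
              exact (B1 y (hTm y hy hya hxy.symm) false).symm
          · have hxT := hTm x hx hxa hxb
            by_cases hya : y = a
            · subst hya; simpa [hxa, hxb] using A1 x hxT true
            · by_cases hyb : y = b
              · subst hyb; simpa [hxa, hxb, hya] using B1 x hxT true
              · simpa [hxa, hxb, hya, hyb] using hr1 x hxT y (hTm y hy hya hyb) hxy
      · intro e
        have hsub : ((S ×ˢ S).filter fun p : V × V => p.1 ≠ p.2 ∧ e ∈
            (if p.1 = a then (if p.2 = b then EB (a, true) else EA (p.2, false))
        else if p.1 = b then (if p.2 = a then EA (b, true) else EB (p.2, false))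
        else if p.2 = a then EA (p.1, true) else if p.2 = b then EB (p.1, true)
          else r p.1 p.2)) ⊆
          ((T ×ˢ T).filter fun p => p.1 ≠ p.2 ∧ e ∈ r p.1 p.2) ∪
          ((((insert (b, true) (T ×ˢ univ)).filter fun i => e ∈ EA i).image
            fun i : V × Bool => if i.2 = true then (i.1, a) else (a, i.1)) ∪
          (((insert (a, true) (T ×ˢ univ)).filter fun i => e ∈ EB i).image
            fun i : V × Bool => if i.2 = true then (i.1, b) else (b, i.1))) := by
          rintro ⟨x, y⟩ hp
          simp only [Finset.mem_filter, Finset.mem_product] at hp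
          obtain ⟨⟨hx, hy⟩, hxy, he⟩ := hp
          simp only [Finset.mem_union, Finset.mem_image, Finset.mem_filter, Finset.mem_product,
            Finset.mem_insert]
          by_cases hxa : x = a
          · subst hxa
            by_cases hyb : y = b
            · subst hyb
              right; right
              exact ⟨(x, true), ⟨Or.inl rfl, by simpa using he⟩, by simp⟩
            · right; left
              simp only [hyb, if_true, if_false] at he
              exact ⟨(y, false), ⟨Or.inr ⟨hTm y hy (Ne.symm hxy) hyb, by simp⟩, he⟩, by simp⟩
          · by_cases hxb : x = b
            · subst hxb
              by_cases hya : y = a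
              · subst hya
                right; left
                exact ⟨(x, true), ⟨Or.inl rfl, by simpa [hxa] using he⟩, by simp⟩
              · right; right
                simp only [hxa, hya, if_true, if_false] at he
                exact ⟨(y, false), ⟨Or.inr ⟨hTm y hy hya (Ne.symm hxy), by simp⟩, he⟩, by simp⟩
            · have hxT := hTm x hx hxa hxb
              by_cases hya : y = a
              · subst hya
                right; left
                exact ⟨(x, true), ⟨Or.inr ⟨hxT, by simp⟩, by simpa [hxa, hxb] using he⟩, by simp⟩
              · by_cases hyb : y = b
                · subst hyb
                  right; right
                  exact ⟨(x, true), ⟨Or.inr ⟨hxT, by simp⟩,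
                    by simpa [hxa, hxb, hya] using he⟩, by simp⟩
                · left
                  exact ⟨⟨hxT, hTm y hy hya hyb⟩, hxy, by simpa [hxa, hxb, hya, hyb] using he⟩
        refine (Finset.card_le_card hsub).trans ?_
        refine (Finset.card_union_le _ _).trans ?_
        have k1 := hr2 e
        have k2 := hload e
        have k3 := (Finset.card_union_le
          (((insert (b, true) (T ×ˢ univ)).filter fun i => e ∈ EA i).image
            fun i : V × Bool => if i.2 = true then (i.1, a) else (a, i.1))
          (((insert (a, true) (T ×ˢ univ)).filter fun i => e ∈ EB i).image
            fun i : V × Bool => if i.2 = true then (i.1, b) else (b, i.1))).trans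
          (add_le_add Finset.card_image_le Finset.card_image_le)
        have k4 : (n - 2) ^ 2 / 4 + (n - 1) = n ^ 2 / 4 := by
          obtain ⟨m, rfl⟩ : ∃ m, n = m + 2 := ⟨n - 2, by omega⟩
          have : (m + 2) ^ 2 = m ^ 2 + (m + 1) * 4 := by ring
          rw [this, Nat.add_mul_div_right _ _ (by norm_num)]
          simp
        omega

theorem final {W : Type*} [Fintype W] [inst : DecidableEq W] (G : SimpleGraph W)
    (hG : IsKConnected 2 G) : Forwarding.piIdx G ≤ Fintype.card W ^ 2 / 4 := by
  obtain ⟨r, hr1, hr2⟩ := main_induction G (fun X x y hx hy => dd_ge_two hG X hx hy) _ univ rfl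
  have hw : ∀ x y : W, ∃ p : G.Walk x y, p.IsPath ∧ (x ≠ y → ∀ e, e ∈ p.edges → e ∈ r x y) := by
    intro x y
    by_cases hxy : x = y
    · subst hxy
      exact ⟨Walk.nil, by simp, fun h => absurd rfl h⟩
    · obtain ⟨p, hp, he⟩ := hr1 x (by simp) y (by simp) hxy
      exact ⟨p, hp, fun _ e h => (he e).2 h⟩
  choose p hp1 hp2 using hw
  have hle : Forwarding.piIdx G ≤ Forwarding.routingEdgeIndex (⟨p, hp1⟩ : Forwarding.Routing G) :=
    Nat.sInf_le ⟨⟨p, hp1⟩, rfl⟩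
  refine hle.trans ?_
  refine Finset.sup_le fun e _ => ?_
  refine le_trans ?_ (hr2 e)
  unfold Forwarding.edgeLoad
  apply Finset.card_le_card
  intro q hq
  simp only [Finset.mem_filter, Finset.mem_univ, true_and, Finset.mem_product] at hq ⊢
  exact ⟨hq.1, hp2 _ _ hq.1 e hq.2⟩

end FwdAux

/-- If `G` is a `2`-connected graph on `n` vertices, then
`π(G) ≤ ⌊n²/4⌋`. -/
theorem pi_two_connected {V : Type*} [Fintype V] [DecidableEq V]
    (G : SimpleGraph V) (hG : IsKConnected 2 G) :
    Forwarding.piIdx G ≤ Fintype.card V ^ 2 / 4 := by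
  exact FwdAux.final G hG
end

section
/- If G is a 3-regular, 3-connected simple graph on n ≥ 4 vertices, then ξ(G) ≤ ⌈(n−3)(n−4)/3⌉. -/
open Finset

set_option linter.unusedSectionVars false
set_option linter.unusedDecidableInType false

namespace CubicRouting

variable {V : Type*} [Fintype V] [DecidableEq V] {G : SimpleGraph V}

theorem chain_initial {α : Type*} {R : α → α → Prop} {l₁ l₂ : List α}
    (h : List.IsChain R l₂) (hp : ∃ t, l₁ ++ t = l₂) : List.IsChain R l₁ := by
  obtain ⟨t, rfl⟩ := hp
  exact h.left_of_append

/-- A finite vertex set induces a connected subgraph. -/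
def Cn (G : SimpleGraph V) (S : Finset V) : Prop := (G.induce (S : Set V)).Connected

lemma cn_singleton (v : V) : Cn G {v} := by
  unfold Cn
  rw [SimpleGraph.connected_iff_exists_forall_reachable]
  refine ⟨⟨v, by simp⟩, ?_⟩
  rintro ⟨w, hw⟩
  simp at hw
  subst hw
  exact SimpleGraph.Reachable.refl _

lemma cn_union {S T : Finset V} {s t : V} (hS : Cn G S) (hT : Cn G T) (hs : s ∈ S) (ht : t ∈ T)
    (h : G.Adj s t) : Cn G (S ∪ T) := by
  unfold Cn at *
  rw [Finset.coe_union]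
  exact SimpleGraph.connected_induce_union hS.preconnected hT.preconnected hs ht h

lemma cn_insert {S : Finset V} {s t : V} (hS : Cn G S) (hs : s ∈ S) (h : G.Adj s t) :
    Cn G (insert t S) := by
  have := cn_union hS (cn_singleton t) hs (Finset.mem_singleton_self t) h
  rwa [Finset.union_comm, ← Finset.insert_eq] at this

lemma cn_leave {S : Finset V} (hS : Cn G S) (A : Set V) {u v : V} (hu : u ∈ S) (huA : u ∈ A)
    (hv : v ∈ S) (hvA : v ∉ A) : ∃ a ∈ S, ∃ b ∈ S, a ∈ A ∧ b ∉ A ∧ G.Adj a b := by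
  obtain ⟨p⟩ := hS.preconnected ⟨u, hu⟩ ⟨v, hv⟩
  obtain ⟨d, -, h1, h2⟩ := p.exists_boundary_dart {z | (z : V) ∈ A} huA hvA
  exact ⟨d.fst, d.fst.2, d.snd, d.snd.2, h1, h2, d.adj⟩

lemma cn_of_chain : ∀ (l : List V), l ≠ [] → l.IsChain G.Adj → Cn G l.toFinset
  | [], h, _ => (h rfl).elim
  | [a], _, _ => by simpa using cn_singleton a
  | a :: b :: l, _, h => by
    rw [List.isChain_cons_cons] at h
    rw [List.toFinset_cons]
    exact cn_insert (cn_of_chain (b :: l) (by simp) h.2) (s := b) (by simp) h.1.symm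

lemma cn_attach {S : Finset V} {s : V} (hS : Cn G S) (hs : s ∈ S) (q : List V)
    (h : (s :: q).IsChain G.Adj) : Cn G (S ∪ q.toFinset) := by
  cases q with
  | nil => simpa using hS
  | cons c q =>
    rw [List.isChain_cons_cons] at h
    exact cn_union hS (cn_of_chain (c :: q) (by simp) h.2) hs (t := c) (by simp) h.1

lemma chain_reverse {l : List V} (h : l.IsChain G.Adj) : l.reverse.IsChain G.Adj := by
  rw [List.isChain_reverse]
  exact h.imp fun a b hab => hab.symm

lemma cn_attach_back {S : Finset V} {s : V} (hS : Cn G S) (hs : s ∈ S) (q : List V)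
    (h : (q ++ [s]).IsChain G.Adj) : Cn G (S ∪ q.toFinset) := by
  have := cn_attach hS hs q.reverse (by simpa using chain_reverse h)
  simpa using this

lemma cn_path {D : Finset V} (hD : Cn G D) {a b u v : V} (hu : u ∈ D) (hv : v ∈ D)
    (hau : G.Adj a u) (hvb : G.Adj v b) :
    ∃ q : List V, q ≠ [] ∧ q.Nodup ∧ (a :: (q ++ [b])).IsChain G.Adj ∧ ∀ z ∈ q, z ∈ D := by
  classical
  obtain ⟨p, hp, -⟩ := hD.exists_path_of_dist ⟨u, hu⟩ ⟨v, hv⟩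
  let p' : G.Walk u v := p.map (SimpleGraph.Embedding.induce (D : Set V)).toHom
  refine ⟨p'.support, by simp, ?_, ?_, ?_⟩
  · exact (SimpleGraph.Walk.IsPath.map Subtype.val_injective hp).support_nodup
  · have h1 : ((SimpleGraph.Walk.cons hau p').concat hvb).support = a :: (p'.support ++ [b]) := by
      simp [SimpleGraph.Walk.support_concat]
    rw [← h1]
    exact SimpleGraph.Walk.isChain_adj_support _
  · intro z hz
    have hs : p'.support = p.support.map Subtype.val := SimpleGraph.Walk.support_map _ _
    rw [hs, List.mem_map] at hz
    obtain ⟨w, -, rfl⟩ := hz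
    exact w.2

/-- A component of the subgraph induced on `S`. -/
lemma exists_comp {S : Finset V} {d : V} (hd : d ∈ S) :
    ∃ D ⊆ S, d ∈ D ∧ Cn G D ∧ ∀ u ∈ D, ∀ v ∈ S, G.Adj u v → v ∈ D := by
  classical
  obtain ⟨D, hD, hmax⟩ := Finset.exists_max_image
    (S.powerset.filter fun D => d ∈ D ∧ Cn G D) Finset.card
    ⟨{d}, by simp [hd, cn_singleton]⟩
  simp only [Finset.mem_filter, Finset.mem_powerset] at hD hmax
  refine ⟨D, hD.1, hD.2.1, hD.2.2, ?_⟩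
  intro u hu v hv huv
  by_contra hvD
  have := hmax (insert v D) ⟨Finset.insert_subset hv hD.1, Finset.mem_insert_of_mem hD.2.1,
    cn_insert hD.2.2 hu huv⟩
  rw [Finset.card_insert_of_notMem hvD] at this
  omega

/-- Separation property of a vertex `x`. -/
def Sep (G : SimpleGraph V) (x : V) : Prop :=
  ∀ D S : Finset V, D.Nonempty → x ∉ D → x ∉ S → Disjoint D S →
    (∀ u ∈ D, ∀ v, G.Adj u v → v ∈ D ∨ v ∈ S) → 3 ≤ S.card

lemma sep_of_conn (h : ∀ s : Finset V, s.card < 3 → (G.induce ((↑s : Set V)ᶜ)).Connected) (x : V) :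
    Sep G x := by
  intro D S ⟨d, hd⟩ hxD hxS hDS hN
  by_contra hc
  have hS := h S (by omega)
  have hdS : d ∉ S := Finset.disjoint_left.1 hDS hd
  obtain ⟨p⟩ := hS.preconnected ⟨d, by simpa using hdS⟩ ⟨x, by simpa using hxS⟩
  obtain ⟨e, -, h1, h2⟩ := p.exists_boundary_dart {z | (z : V) ∈ D} hd hxD
  have h3 : G.Adj e.fst e.snd := e.adj
  rcases hN _ h1 _ h3 with h | h
  · exact h2 h
  · exact e.snd.2 h

/-- A connected set with two distinct neighbours in `H`. -/
def Bridge (G : SimpleGraph V) (H D : Finset V) : Prop :=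
  Cn G D ∧ ∃ a ∈ H, ∃ b ∈ H, a ≠ b ∧ (∃ u ∈ D, G.Adj a u) ∧ ∃ v ∈ D, G.Adj v b

lemma exists_K {x y : V} {H W : Finset V} (hsep : Sep G x)
    (hcov : ∀ v, v = x ∨ v ∈ H ∨ v ∈ W) (hxH : x ∉ H) (hxW : x ∉ W) (hHW : Disjoint H W)
    (hx : ∀ v ∈ W, G.Adj x v → v = y) (hy : y ∈ W) (hW2 : ∃ d ∈ W, d ≠ y) :
    ∃ K ⊆ W, y ∈ K ∧ Cn G K ∧ (∃ D ⊆ W \ K, Bridge G H D) ∧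
      ∀ K' ⊆ W, y ∈ K' → Cn G K' → (∃ D ⊆ W \ K', Bridge G H D) → K'.card ≤ K.card := by
  classical
  obtain ⟨K, hK, hmax⟩ := Finset.exists_max_image
    (W.powerset.filter fun K => y ∈ K ∧ Cn G K ∧ ∃ D ⊆ W \ K, Bridge G H D) Finset.card
    (by
      refine ⟨{y}, ?_⟩
      simp only [Finset.mem_filter, Finset.mem_powerset, Finset.singleton_subset_iff, hy,
        Finset.mem_singleton, true_and]
      refine ⟨cn_singleton y, ?_⟩
      obtain ⟨d, hd, hdy⟩ := hW2
      obtain ⟨D, hDS, hdD, hD, hcl⟩ := exists_comp (G := G) (S := W \ {y}) (d := d)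
        (by simp [hd, hdy])
      refine ⟨D, hDS, hD, ?_⟩
      have h3 := hsep D ((insert y H).filter fun v => ∃ u ∈ D, G.Adj u v) ⟨d, hdD⟩
        (fun h => hxW (Finset.mem_sdiff.1 (hDS h)).1)
        (by
          intro h
          have := (Finset.mem_filter.1 h).1
          rw [Finset.mem_insert] at this
          rcases this with rfl | h
          · exact hxW hy
          · exact hxH h)
        (by
          rw [Finset.disjoint_left]
          intro z hz hz'
          have h1 := hDS hz
          simp only [Finset.mem_filter, Finset.mem_insert, Finset.mem_sdiff,
            Finset.mem_singleton] at hz' h1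
          rcases hz'.1 with h | h
          · exact h1.2 h
          · exact Finset.disjoint_left.1 hHW h h1.1)
        (by
          intro u hu v huv
          have h1 := hDS hu
          simp only [Finset.mem_sdiff, Finset.mem_singleton] at h1
          rcases hcov v with rfl | h | h
          · exact absurd (hx u h1.1 huv.symm) h1.2
          · right; simp only [Finset.mem_filter, Finset.mem_insert]
            exact ⟨Or.inr h, u, hu, huv⟩
          · by_cases hvy : v = y
            · right; simp only [Finset.mem_filter, Finset.mem_insert]
              exact ⟨Or.inl hvy, u, hu, huv⟩
            · left; exact hcl u hu v (by simp [h, hvy]) huv)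
      have h4 : 1 < (((insert y H).filter fun v => ∃ u ∈ D, G.Adj u v).erase y).card := by
        have := Finset.pred_card_le_card_erase (s := (insert y H).filter fun v => ∃ u ∈ D, G.Adj u v)
          (a := y)
        omega
      obtain ⟨a, ha, b, hb, hab⟩ := Finset.one_lt_card.1 h4
      simp only [Finset.mem_erase, Finset.mem_filter, Finset.mem_insert] at ha hb
      obtain ⟨u, hu, hua⟩ := ha.2.2
      obtain ⟨v, hv, hvb⟩ := hb.2.2
      exact ⟨a, ha.2.1.resolve_left ha.1, b, hb.2.1.resolve_left hb.1, hab, ⟨u, hu, hua.symm⟩,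
        v, hv, hvb⟩)
  simp only [Finset.mem_filter, Finset.mem_powerset] at hK hmax
  exact ⟨K, hK.1, hK.2.1, hK.2.2.1, hK.2.2.2, fun K' h1 h2 h3 h4 => hmax K' ⟨h1, h2, h3, h4⟩⟩

lemma exists_ear {x y : V} {H W : Finset V} (hsep : Sep G x)
    (hcov : ∀ v, v = x ∨ v ∈ H ∨ v ∈ W) (hxH : x ∉ H) (hxW : x ∉ W) (hHW : Disjoint H W)
    (hx : ∀ v ∈ W, G.Adj x v → v = y) (hy : y ∈ W) (hW2 : ∃ d ∈ W, d ≠ y) (hW : Cn G W) :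
    ∃ a ∈ H, ∃ b ∈ H, a ≠ b ∧ ∃ q : List V, q ≠ [] ∧ q.Nodup ∧
      (a :: (q ++ [b])).IsChain G.Adj ∧ (∀ v ∈ q, v ∈ W ∧ v ≠ y) ∧ Cn G (W \ q.toFinset) ∧
      ∀ v ∈ q, ∃ k ∈ W \ q.toFinset, G.Adj v k := by
  classical
  obtain ⟨K, hKW, hyK, hK, ⟨D0, hD0, hB0⟩, hmax⟩ :=
    exists_K hsep hcov hxH hxW hHW hx hy hW2
  -- key fact: every bridge avoiding `K` contains all vertices adjacent to `K`
  have key : ∀ E ⊆ W \ K, Bridge G H E → ∀ t ∈ W \ K, (∃ k ∈ K, G.Adj t k) → t ∈ E := by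
    intro E hE hBE t ht ⟨k, hk, htk⟩
    by_contra htE
    have h1 := Finset.mem_sdiff.1 ht
    have := hmax (insert t K) (Finset.insert_subset h1.1 hKW) (Finset.mem_insert_of_mem hyK)
      (cn_insert hK hk htk.symm) ⟨E, by
        intro e he
        have h2 := Finset.mem_sdiff.1 (hE he)
        simp only [Finset.mem_sdiff, Finset.mem_insert, not_or]
        refine ⟨h2.1, ?_, h2.2⟩
        rintro rfl
        exact htE he, hBE⟩
    rw [Finset.card_insert_of_notMem h1.2] at this
    omega
  obtain ⟨hD0c, a, ha, b, hb, hab, ⟨u, hu, hau⟩, v, hv, hvb⟩ := hB0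
  obtain ⟨q, hq0, hqn, hqc, hqD⟩ := cn_path hD0c hu hv hau hvb
  have hqB : ∀ z ∈ q, z ∈ W \ K := fun z hz => hD0 (hqD z hz)
  -- connected pieces of the ear
  have hpre : ∀ n, 0 < n → Cn G (q.take n).toFinset ∧ ∃ u ∈ (q.take n).toFinset, G.Adj a u := by
    intro n hn
    obtain ⟨m, rfl⟩ := Nat.exists_eq_succ_of_ne_zero hn.ne'
    cases q with
    | nil => exact absurd rfl hq0
    | cons c q =>
      simp only [List.cons_append, List.isChain_cons_cons] at hqc
      refine ⟨cn_of_chain _ (by simp) ?_, c, by simp, hqc.1⟩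
      exact (chain_initial (l₁ := c :: q) hqc.2 ⟨[b], by simp⟩).take _
  have hsuf : ∀ n, n < q.length → Cn G (q.drop n).toFinset ∧
      ∃ u ∈ (q.drop n).toFinset, G.Adj u b := by
    intro n hn
    have h1 : (q ++ [b]).IsChain G.Adj := (List.isChain_of_isChain_cons hqc)
    have hne : q.drop n ≠ [] := by simpa using hn
    refine ⟨cn_of_chain _ hne (h1.left_of_append.drop _), q.getLast hq0, ?_, ?_⟩
    · rw [List.mem_toFinset, ← List.getLast_drop hne]
      exact List.getLast_mem _
    · rw [List.isChain_append] at h1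
      exact h1.2.2 _ (by simp [List.getLast?_eq_some_getLast hq0]) b (by simp)
  have hqT : ∀ t ∈ W \ K, (∃ k ∈ K, G.Adj t k) → t ∈ q := by
    intro t ht hk
    have h1 := hpre q.length (List.length_pos_of_ne_nil hq0)
    have h2 := hsuf 0 (List.length_pos_of_ne_nil hq0)
    simp only [List.take_length, List.drop_zero] at h1 h2
    have := key q.toFinset (fun z hz => hqB z (by simpa using hz))
      ⟨h1.1, a, ha, b, hb, hab, h1.2, h2.2⟩ t ht hk
    simpa using this
  -- every vertex of `W \ K` is adjacent to `K`
  have hall : ∀ t ∈ W \ K, ∃ k ∈ K, G.Adj t k := by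
    intro d hd
    by_contra hdK
    set T := (W \ K).filter fun t => ∃ k ∈ K, G.Adj t k with hT
    obtain ⟨D, hDS, hdD, hD, hcl⟩ := exists_comp (G := G) (S := (W \ K) \ T) (d := d)
      (by simp only [hT, Finset.mem_sdiff, Finset.mem_filter]
          simp only [Finset.mem_sdiff] at hd
          exact ⟨hd, fun h => hdK h.2⟩)
    have hDB : ∀ z ∈ D, z ∈ W \ K := fun z hz => (Finset.mem_sdiff.1 (hDS hz)).1
    have hDT : ∀ z ∈ D, z ∉ T := fun z hz => (Finset.mem_sdiff.1 (hDS hz)).2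
    have hTq : ∀ t ∈ T, t ∈ q := by
      intro t ht
      rw [hT, Finset.mem_filter] at ht
      exact hqT t ht.1 ht.2
    have hkey : ∀ E : Finset V, (∀ z ∈ E, z ∈ D ∨ z ∈ q) → Bridge G H E → ∀ t ∈ T, t ∈ E := by
      intro E hE hBE t ht
      rw [hT, Finset.mem_filter] at ht
      refine key E ?_ hBE t ht.1 ht.2
      intro z hz
      rcases hE z hz with h | h
      · exact hDB z h
      · exact hqB z h
    have hTx : x ∉ T := fun h => hxW (Finset.mem_sdiff.1 (Finset.mem_filter.1 h).1).1
    have h3 := hsep D ((T ∪ H).filter fun v => ∃ u ∈ D, G.Adj u v) ⟨d, hdD⟩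
      (fun h => hxW (Finset.mem_sdiff.1 (hDB _ h)).1)
      (by
        intro h
        have := (Finset.mem_filter.1 h).1
        rw [Finset.mem_union] at this
        rcases this with h | h
        · exact hTx h
        · exact hxH h)
      (by
        rw [Finset.disjoint_left]
        intro z hz hz'
        have h1 := (Finset.mem_filter.1 hz').1
        rw [Finset.mem_union] at h1
        rcases h1 with h | h
        · exact hDT z hz h
        · exact Finset.disjoint_left.1 hHW h (Finset.mem_sdiff.1 (hDB z hz)).1)
      (by
        intro u hu v huv
        have h1 := Finset.mem_sdiff.1 (hDB u hu)
        rcases hcov v with rfl | h | h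
        · have := hx u h1.1 huv.symm
          subst this
          exact absurd hyK h1.2
        · right; rw [Finset.mem_filter, Finset.mem_union]
          exact ⟨Or.inr h, u, hu, huv⟩
        · by_cases hvK : v ∈ K
          · exfalso
            apply hDT u hu
            rw [hT, Finset.mem_filter]
            exact ⟨hDB u hu, v, hvK, huv⟩
          · by_cases hvT : v ∈ T
            · right; rw [Finset.mem_filter, Finset.mem_union]
              exact ⟨Or.inl hvT, u, hu, huv⟩
            · left; exact hcl u hu v (by rw [Finset.mem_sdiff, Finset.mem_sdiff]; exact ⟨⟨h, hvK⟩, hvT⟩) huv)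
    obtain ⟨t0, ht0⟩ : ∃ t, t ∈ T := by
      obtain ⟨k, hk, w, hw, hkA, hwA, hkw⟩ := cn_leave hW (K : Set V) hy hyK
        (Finset.mem_sdiff.1 hd).1 (Finset.mem_sdiff.1 hd).2
      refine ⟨w, ?_⟩
      rw [hT, Finset.mem_filter, Finset.mem_sdiff]
      exact ⟨⟨hw, hwA⟩, k, hkA, hkw.symm⟩
    have hHH : ∀ p1 ∈ H, ∀ p2 ∈ H, p1 ≠ p2 → (∃ u ∈ D, G.Adj u p1) → (∃ u ∈ D, G.Adj u p2) →
        False := by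
      rintro p1 h1 p2 h2 h12 ⟨u, hu, hup⟩ ⟨w, hw, hwp⟩
      exact hDT t0 (hkey D (fun z hz => Or.inl hz)
        ⟨hD, p1, h1, p2, h2, h12, ⟨u, hu, hup.symm⟩, w, hw, hwp⟩ t0 ht0) ht0
    have hidx : ∀ {t}, t ∈ T → q.idxOf t < q.length := fun ht => List.idxOf_lt_length_of_mem (hTq _ ht)
    have hmemt : ∀ {t}, t ∈ T → t ∈ (q.take (q.idxOf t + 1)).toFinset := fun {t} ht => by
      rw [List.mem_toFinset, List.mem_take_iff_idxOf_lt (hTq _ ht)]; omega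
    have hdrop : ∀ {t n}, t ∈ T → (t ∈ (q.drop n).toFinset ↔ n ≤ q.idxOf t) := fun {t n} ht => by
      have h1 := hTq _ ht
      have h2 : t ∈ q.take n ∨ t ∈ q.drop n := by
        rw [← List.mem_append, List.take_append_drop]; exact h1
      have h3 : (q.take n).Disjoint (q.drop n) := List.disjoint_take_drop hqn le_rfl
      rw [List.mem_take_iff_idxOf_lt h1] at h2
      rw [List.mem_toFinset]
      constructor
      · intro h
        by_contra hc
        exact h3 ((List.mem_take_iff_idxOf_lt h1).2 (by omega)) h
      · intro h
        exact h2.resolve_left (by omega)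
    have htake : ∀ {t n}, t ∈ T → (t ∈ (q.take n).toFinset ↔ q.idxOf t < n) := fun {t n} ht => by
      rw [List.mem_toFinset, List.mem_take_iff_idxOf_lt (hTq _ ht)]
    have hTTT : ∀ p1 ∈ T, ∀ p2 ∈ T, ∀ p3 ∈ T, q.idxOf p1 < q.idxOf p2 → q.idxOf p2 < q.idxOf p3 →
        (∃ u ∈ D, G.Adj u p1) → (∃ u ∈ D, G.Adj u p3) → False := by
      rintro p1 h1 p2 h2 p3 h3 h12 h23 ⟨u, hu, hup⟩ ⟨w, hw, hwp⟩
      obtain ⟨c1, e, he, hae⟩ := hpre (q.idxOf p1 + 1) (by omega)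
      obtain ⟨c2, f, hf, hfb⟩ := hsuf (q.idxOf p3) (hidx h3)
      have c3 := cn_union hD c1 hu (hmemt h1) hup
      have c4 := cn_union c3 c2 (Finset.mem_union_left _ hw) ((hdrop h3).2 le_rfl) hwp
      have h4 := hkey _ (by
        intro z hz
        simp only [Finset.mem_union, List.mem_toFinset] at hz
        rcases hz with (h | h) | h
        · exact Or.inl h
        · exact Or.inr (List.mem_of_mem_take h)
        · exact Or.inr (List.mem_of_mem_drop h))
        ⟨c4, a, ha, b, hb, hab, ⟨e, by simp only [Finset.mem_union]; tauto, hae⟩,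
          f, by simp only [Finset.mem_union]; tauto, hfb⟩ p2 h2
      simp only [Finset.mem_union, hdrop h2, htake h2] at h4
      rcases h4 with (h | h) | h
      · exact hDT _ h h2
      · omega
      · omega
    have hTTH : ∀ p1 ∈ T, ∀ p2 ∈ T, ∀ h ∈ H, q.idxOf p1 < q.idxOf p2 →
        (∃ u ∈ D, G.Adj u p1) → (∃ u ∈ D, G.Adj u p2) → (∃ u ∈ D, G.Adj u h) → False := by
      rintro p1 h1 p2 h2 h hh h12 ⟨u, hu, hup⟩ ⟨w, hw, hwp⟩ ⟨r, hr, hrh⟩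
      by_cases hhb : h = b
      · obtain ⟨c1, e, he, hae⟩ := hpre (q.idxOf p1 + 1) (by omega)
        have c3 := cn_union hD c1 hu (hmemt h1) hup
        have h4 := hkey _ (by
          intro z hz
          simp only [Finset.mem_union, List.mem_toFinset] at hz
          rcases hz with h | h
          · exact Or.inl h
          · exact Or.inr (List.mem_of_mem_take h))
          ⟨c3, a, ha, h, hh, by rw [hhb]; exact hab, ⟨e, by simp only [Finset.mem_union]; tauto, hae⟩,
            r, by simp only [Finset.mem_union]; tauto, hrh⟩ p2 h2
        simp only [Finset.mem_union, htake h2] at h4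
        rcases h4 with h | h
        · exact hDT _ h h2
        · omega
      · obtain ⟨c2, f, hf, hfb⟩ := hsuf (q.idxOf p2) (hidx h2)
        have c4 := cn_union hD c2 hw ((hdrop h2).2 le_rfl) hwp
        have h4 := hkey _ (by
          intro z hz
          simp only [Finset.mem_union, List.mem_toFinset] at hz
          rcases hz with h | h
          · exact Or.inl h
          · exact Or.inr (List.mem_of_mem_drop h))
          ⟨c4, h, hh, b, hb, hhb, ⟨r, by simp only [Finset.mem_union]; tauto, hrh.symm⟩,
            f, by simp only [Finset.mem_union]; tauto, hfb⟩ p1 h1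
        simp only [Finset.mem_union, hdrop h1] at h4
        rcases h4 with h | h
        · exact hDT _ h h1
        · omega
    have hTTH' : ∀ p1 ∈ T, ∀ p2 ∈ T, ∀ h ∈ H, p1 ≠ p2 →
        (∃ u ∈ D, G.Adj u p1) → (∃ u ∈ D, G.Adj u p2) → (∃ u ∈ D, G.Adj u h) → False := by
      intro p1 h1 p2 h2 h hh h12 e1 e2 e3
      have hne : q.idxOf p1 ≠ q.idxOf p2 := fun he => h12 ((List.idxOf_inj (hTq _ h1)).1 he)
      rcases lt_or_gt_of_ne hne with hlt | hlt
      · exact hTTH p1 h1 p2 h2 h hh hlt e1 e2 e3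
      · exact hTTH p2 h2 p1 h1 h hh hlt e2 e1 e3
    obtain ⟨p1, h1, p2, h2, p3, h3, h12, h13, h23⟩ := Finset.two_lt_card.1 h3
    rw [Finset.mem_filter, Finset.mem_union] at h1 h2 h3
    obtain ⟨h1, e1⟩ := h1
    obtain ⟨h2, e2⟩ := h2
    obtain ⟨h3, e3⟩ := h3
    rcases h1 with h1 | h1 <;> rcases h2 with h2 | h2 <;> rcases h3 with h3 | h3
    · have i12 : q.idxOf p1 ≠ q.idxOf p2 := fun he => h12 ((List.idxOf_inj (hTq _ h1)).1 he)
      have i13 : q.idxOf p1 ≠ q.idxOf p3 := fun he => h13 ((List.idxOf_inj (hTq _ h1)).1 he)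
      have i23 : q.idxOf p2 ≠ q.idxOf p3 := fun he => h23 ((List.idxOf_inj (hTq _ h2)).1 he)
      rcases lt_or_gt_of_ne i12 with l1 | l1 <;> rcases lt_or_gt_of_ne i13 with l2 | l2 <;>
        rcases lt_or_gt_of_ne i23 with l3 | l3
      · exact hTTT p1 h1 p2 h2 p3 h3 l1 l3 e1 e3
      · exact hTTT p1 h1 p3 h3 p2 h2 l2 l3 e1 e2
      · omega
      · exact hTTT p3 h3 p1 h1 p2 h2 l2 l1 e3 e2
      · exact hTTT p2 h2 p1 h1 p3 h3 l1 l2 e2 e3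
      · omega
      · exact hTTT p2 h2 p3 h3 p1 h1 l3 l2 e2 e1
      · exact hTTT p3 h3 p2 h2 p1 h1 l3 l1 e3 e1
    · exact hTTH' p1 h1 p2 h2 p3 h3 h12 e1 e2 e3
    · exact hTTH' p1 h1 p3 h3 p2 h2 h13 e1 e3 e2
    · exact hHH p2 h2 p3 h3 h23 e2 e3
    · exact hTTH' p2 h2 p3 h3 p1 h1 h23 e2 e3 e1
    · exact hHH p1 h1 p3 h3 h13 e1 e3
    · exact hHH p1 h1 p2 h2 h12 e1 e2
    · exact hHH p1 h1 p2 h2 h12 e1 e2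
  have hWK : W \ q.toFinset = K := by
    ext z
    simp only [Finset.mem_sdiff, List.mem_toFinset]
    constructor
    · rintro ⟨h1, h2⟩
      by_contra h
      have h3 : z ∈ W \ K := by simp [h1, h]
      exact h2 (hqT z h3 (hall z h3))
    · intro h
      exact ⟨hKW h, fun hz => (Finset.mem_sdiff.1 (hqB z hz)).2 h⟩
  refine ⟨a, ha, b, hb, hab, q, hq0, hqn, hqc, ?_, ?_, ?_⟩
  · intro z hz
    have := Finset.mem_sdiff.1 (hqB z hz)
    exact ⟨this.1, fun h => this.2 (h ▸ hyK)⟩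
  · rw [hWK]; exact hK
  · rw [hWK]; exact fun z hz => hall z (hqB z hz)

lemma cn_add {K : Finset V} (hK : Cn G K) (Z : Finset V) (h : ∀ z ∈ Z, ∃ k ∈ K, G.Adj z k) :
    Cn G (K ∪ Z) := by
  induction Z using Finset.induction_on with
  | empty => simpa using hK
  | insert z Z _ ih =>
    have h1 := ih fun z hz => h z (Finset.mem_insert_of_mem hz)
    obtain ⟨k, hk, hzk⟩ := h z (Finset.mem_insert_self _ _)
    rw [Finset.union_insert]
    exact cn_insert h1 (Finset.mem_union_left _ hk) hzk.symm

/-- The vertices other than `x` that are not in the list `L`. -/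
def rest (x : V) (L : List V) : Finset V := (Finset.univ \ {x}) \ L.toFinset

lemma mem_rest {x v : V} {L : List V} : v ∈ rest x L ↔ v ≠ x ∧ v ∉ L := by
  simp [rest]

/-- `L` is an ordering from `y1` to `y2` with connected initial and final segments,
and connected remainder. -/
structure Inv (G : SimpleGraph V) (x y1 y2 y3 : V) (L : List V) : Prop where
  nodup : L.Nodup
  hx : x ∉ L
  hy : y3 ∉ L
  conn : Cn G (rest x L)
  split : ∀ A B, L = A ++ B → A ≠ [] → B ≠ [] →
    (y1 ∈ A ∧ Cn G A.toFinset) ∧ (y2 ∈ B ∧ Cn G B.toFinset)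

/-- An ear attached to the list `L`. -/
structure Ear (G : SimpleGraph V) (x y3 : V) (L : List V) (a b : V) (q : List V) : Prop where
  ne : q ≠ []
  nodup : q.Nodup
  chain : (a :: (q ++ [b])).IsChain G.Adj
  mem : ∀ v ∈ q, v ∈ rest x L ∧ v ≠ y3
  conn : Cn G (rest x L \ q.toFinset)
  adj : ∀ v ∈ q, ∃ k ∈ rest x L \ q.toFinset, G.Adj v k

lemma Ear.reverse {x y3 : V} {L : List V} {a b : V} {q : List V} (h : Ear G x y3 L a b q) :
    Ear G x y3 L b a q.reverse where
  ne := by simpa using h.ne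
  nodup := by simpa using h.nodup
  chain := by simpa using chain_reverse h.chain
  mem := by simpa using h.mem
  conn := by simpa using h.conn
  adj := by simpa using h.adj

lemma Inv.exists_ear {x y1 y2 y3 : V} {L : List V} (hsep : Sep G x) (h : Inv G x y1 y2 y3 L)
    (hN : ∀ v, G.Adj x v → v = y1 ∨ v = y2 ∨ v = y3) (h1 : y1 ∈ L) (h2 : y2 ∈ L) (hy3 : y3 ≠ x)
    (hlen : L.length + 2 < Fintype.card V) :
    ∃ A a B b q, L = A ++ a :: B ∧ b ∈ B ∧ Ear G x y3 L a b q := by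
  have hcard : 1 < (rest x L).card := by
    unfold rest
    rw [Finset.card_sdiff_of_subset, List.toFinset_card_of_nodup h.nodup,
      Finset.card_sdiff_of_subset (by simp)]
    · simp; omega
    · intro z hz
      simp only [List.mem_toFinset] at hz
      simp only [Finset.mem_sdiff, Finset.mem_univ, Finset.mem_singleton, true_and]
      rintro rfl
      exact h.hx hz
  obtain ⟨a, ha, b, hb, hab, q, q1, q2, q3, q4, q5, q6⟩ :=
    CubicRouting.exists_ear (G := G) (x := x) (y := y3) (H := L.toFinset) (W := rest x L) hsep
      (fun v => by
        rw [mem_rest, List.mem_toFinset]; tauto)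
      (by simpa using h.hx) (by simp [mem_rest])
      (by
        rw [Finset.disjoint_left]
        intro z hz hz'
        rw [mem_rest] at hz'
        exact hz'.2 (by simpa using hz))
      (by
        intro v hv hxv
        rw [mem_rest] at hv
        rcases hN v hxv with rfl | rfl | rfl
        · exact absurd h1 hv.2
        · exact absurd h2 hv.2
        · rfl)
      (mem_rest.2 ⟨hy3, h.hy⟩)
      (Finset.exists_mem_ne hcard y3)
      h.conn
  have hE : Ear G x y3 L a b q := ⟨q1, q2, q3, q4, q5, q6⟩
  rw [List.mem_toFinset] at ha hb
  obtain ⟨A, B, hL⟩ := List.append_of_mem ha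
  have hb' := hb
  rw [hL, List.mem_append, List.mem_cons] at hb'
  rcases hb' with hb' | hb' | hb'
  · obtain ⟨A1, A2, hA⟩ := List.append_of_mem hb'
    exact ⟨A1, b, A2 ++ a :: B, a, q.reverse, by rw [hL, hA]; simp, by simp, hE.reverse⟩
  · exact absurd hb'.symm hab
  · exact ⟨A, a, B, b, q, hL, hb', hE⟩

lemma Inv.insert {x y1 y2 y3 : V} {A B : List V} {a b : V} {q : List V}
    (h : Inv G x y1 y2 y3 (A ++ a :: B)) (hb : b ∈ B) (hE : Ear G x y3 (A ++ a :: B) a b q) :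
    Inv G x y1 y2 y3 (A ++ a :: (q ++ B)) := by
  have hperm : (A ++ a :: (q ++ B)).Perm ((A ++ a :: B) ++ q) := by
    have : (A ++ a :: (q ++ B)).Perm (A ++ a :: (B ++ q)) :=
      (List.Perm.cons a List.perm_append_comm).append_left A
    simpa using this
  have hBne : B ≠ [] := List.ne_nil_of_mem hb
  have hpfx : ∀ c c', q = c ++ c' → (a :: c).IsChain G.Adj := by
    intro c c' hq
    refine chain_initial hE.chain ⟨c' ++ [b], by simp [hq]⟩
  have hsfx : ∀ c c', q = c ++ c' → (c' ++ [b]).IsChain G.Adj := by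
    intro c c' hq
    refine hE.chain.suffix ⟨a :: c, by simp [hq]⟩
  -- splitting inside the ear
  have hmid : ∀ c c', q = c ++ c' →
      (y1 ∈ A ++ a :: c ∧ Cn G (A ++ a :: c).toFinset) ∧ (y2 ∈ c' ++ B ∧ Cn G (c' ++ B).toFinset) := by
    intro c c' hq
    obtain ⟨⟨i1, i2⟩, i3, i4⟩ := h.split (A ++ [a]) B (by simp) (by simp) hBne
    refine ⟨⟨?_, ?_⟩, ?_, ?_⟩
    · simp only [List.mem_append, List.mem_cons, List.not_mem_nil, or_false] at i1 ⊢; tauto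
    · have := cn_attach i2 (s := a) (by simp) c (hpfx c c' hq)
      convert this using 1
      ext z; simp
    · exact List.mem_append_right _ i3
    · have := cn_attach_back i4 (s := b) (by simpa using hb) c' (hsfx c c' hq)
      rwa [List.toFinset_append, Finset.union_comm]
  refine ⟨?_, ?_, ?_, ?_, ?_⟩
  · rw [hperm.nodup_iff, List.nodup_append]
    refine ⟨h.nodup, hE.nodup, ?_⟩
    rintro z hz w hw rfl
    exact (mem_rest.1 (hE.mem z hw).1).2 hz
  · rw [hperm.mem_iff, List.mem_append]
    rintro (hh | hh)
    · exact h.hx hh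
    · exact (mem_rest.1 (hE.mem _ hh).1).1 rfl
  · rw [hperm.mem_iff, List.mem_append]
    rintro (hh | hh)
    · exact h.hy hh
    · exact (hE.mem _ hh).2 rfl
  · have : rest x (A ++ a :: (q ++ B)) = rest x (A ++ a :: B) \ q.toFinset := by
      ext z
      simp only [mem_rest, Finset.mem_sdiff, List.mem_toFinset, hperm.mem_iff, List.mem_append]
      tauto
    rw [this]
    exact hE.conn
  · intro P S hPS hP hS
    have hPS' : (A ++ [a]) ++ (q ++ B) = P ++ S := by simpa using hPS
    rw [List.append_eq_append_iff] at hPS'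
    rcases hPS' with ⟨c, rfl, h2⟩ | ⟨c, h1, rfl⟩
    · rw [List.append_eq_append_iff] at h2
      rcases h2 with ⟨d, rfl, rfl⟩ | ⟨d, hq, rfl⟩
      · obtain ⟨⟨i1, i2⟩, i3⟩ := h.split (A ++ [a] ++ d) S (by simp) (by simp) hS
        refine ⟨⟨?_, ?_⟩, i3⟩
        · simp only [List.mem_append, List.mem_cons, List.not_mem_nil, or_false] at i1 ⊢; tauto
        · have := cn_attach i2 (s := a) (by simp) q (hpfx q [] (by simp))
          convert this using 1
          ext z
          simp only [List.toFinset_append, Finset.mem_union]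
          tauto
      · simpa using hmid c d hq
    · by_cases hc : c = []
      · subst hc
        rw [List.append_nil] at h1
        subst h1
        simpa using hmid [] q (by simp)
      · obtain ⟨i1, i3, i4⟩ := h.split P (c ++ B) (by
          rw [← List.append_assoc, ← h1]; simp) hP (by simp [hc])
        refine ⟨i1, ?_, ?_⟩
        · simp only [List.mem_append] at i3 ⊢; tauto
        · have hac : a ∈ c := by
            have h2 : (A ++ [a]).getLast (by simp) = (P ++ c).getLast (by simp [hc]) := by
              congr 1
            rw [List.getLast_append_of_ne_nil _ hc] at h2
            simp only [List.getLast_append_singleton] at h2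
            rw [h2]; exact List.getLast_mem _
          have := cn_attach i4 (s := a) (by simp [hac]) q (hpfx q [] (by simp))
          convert this using 1
          ext z
          simp only [List.toFinset_append, Finset.mem_union]
          tauto

/-- The first two parts of a tripartition. -/
def Tri (G : SimpleGraph V) (x y1 y2 y3 : V) (n1 n2 : ℕ) : Prop :=
  ∃ l1 l2 : List V, (l1 ++ l2).Nodup ∧ l1.length = n1 ∧ l2.length = n2 ∧ y1 ∈ l1 ∧ y2 ∈ l2 ∧
    x ∉ l1 ++ l2 ∧ y3 ∉ l1 ++ l2 ∧ Cn G l1.toFinset ∧ Cn G l2.toFinset ∧ Cn G (rest x (l1 ++ l2))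

lemma finish {x y1 y2 y3 : V} {L q : List V} {a b : V} {n1 n2 : ℕ}
    (h : Inv G x y1 y2 y3 L) (hE : Ear G x y3 L a b q) (l1 l2 q' : List V)
    (hperm : (l1 ++ l2).Perm (L ++ q')) (hsub : q'.Sublist q) (hl1 : l1.length = n1)
    (hl2 : l2.length = n2) (h1 : y1 ∈ l1 ∧ Cn G l1.toFinset) (h2 : y2 ∈ l2 ∧ Cn G l2.toFinset) :
    Tri G x y1 y2 y3 n1 n2 := by
  refine ⟨l1, l2, ?_, hl1, hl2, h1.1, h2.1, ?_, ?_, h1.2, h2.2, ?_⟩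
  · rw [hperm.nodup_iff, List.nodup_append]
    refine ⟨h.nodup, hE.nodup.sublist hsub, ?_⟩
    rintro z hz w hw rfl
    exact (mem_rest.1 (hE.mem z (hsub.subset hw)).1).2 hz
  · rw [hperm.mem_iff, List.mem_append]
    rintro (hh | hh)
    · exact h.hx hh
    · exact (mem_rest.1 (hE.mem _ (hsub.subset hh)).1).1 rfl
  · rw [hperm.mem_iff, List.mem_append]
    rintro (hh | hh)
    · exact h.hy hh
    · exact (hE.mem _ (hsub.subset hh)).2 rfl
  · have := cn_add hE.conn (q.toFinset \ q'.toFinset) (by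
      intro z hz
      rw [Finset.mem_sdiff, List.mem_toFinset] at hz
      exact hE.adj z hz.1)
    convert this using 1
    ext z
    have i1 := fun hz => (mem_rest.1 (hE.mem z hz).1)
    have i2 : z ∈ q' → z ∈ q := fun hz => hsub.subset hz
    simp only [mem_rest, Finset.mem_sdiff, List.mem_toFinset, hperm.mem_iff, List.mem_append,
      Finset.mem_union]
    tauto

lemma tri_of_inv {x y1 y2 y3 : V} (hsep : Sep G x)
    (hN : ∀ v, G.Adj x v → v = y1 ∨ v = y2 ∨ v = y3) (hy3 : y3 ≠ x) {n1 n2 : ℕ} (hn1 : 1 ≤ n1)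
    (hn2 : 1 ≤ n2) (hlen : n1 + n2 + 2 ≤ Fintype.card V) :
    ∀ k L, Inv G x y1 y2 y3 L → 2 ≤ L.length → n1 + n2 = L.length + k → Tri G x y1 y2 y3 n1 n2 := by
  intro k
  induction k using Nat.strong_induction_on with
  | _ k ih =>
  intro L h hL2 hk
  have hsplit : ∀ n, 0 < n → n < L.length →
      (y1 ∈ L.take n ∧ Cn G (L.take n).toFinset) ∧ (y2 ∈ L.drop n ∧ Cn G (L.drop n).toFinset) := by
    intro n h0 h1
    refine h.split _ _ (by simp) ?_ ?_
    · intro he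
      have := congrArg List.length he
      simp at this
      rcases this with rfl | rfl
      · omega
      · simp at h1
    · simpa using h1
  rcases Nat.eq_zero_or_pos k with rfl | hkpos
  · obtain ⟨⟨i1, i2⟩, i3, i4⟩ := hsplit n1 (by omega) (by omega)
    refine ⟨L.take n1, L.drop n1, ?_⟩
    rw [List.take_append_drop]
    exact ⟨h.nodup, by simp; omega, by simp; omega, i1, i3, h.hx, h.hy, i2, i4, h.conn⟩
  · have j1 := hsplit 1 (by omega) (by omega)
    obtain ⟨A, a, B, b, q, hL, hb, hE⟩ := h.exists_ear hsep hN (List.mem_of_mem_take j1.1.1)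
      (List.mem_of_mem_drop j1.2.1) hy3 (by omega)
    have hqlen : 0 < q.length := List.length_pos_of_ne_nil hE.ne
    have hLlen : L.length = A.length + 1 + B.length := by rw [hL]; simp; omega
    by_cases hqk : q.length ≤ k
    · have h' : Inv G x y1 y2 y3 (A ++ a :: (q ++ B)) := by
        subst hL
        exact h.insert hb hE
      have hl : (A ++ a :: (q ++ B)).length = L.length + q.length := by
        rw [hL]; simp; omega
      exact ih (k - q.length) (by omega) _ h' (by omega) (by omega)
    · have hBlen : 0 < B.length := List.length_pos_of_mem hb
      have hpfx : ∀ n, (a :: q.take n).IsChain G.Adj := by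
        intro n
        refine chain_initial hE.chain ⟨q.drop n ++ [b], ?_⟩
        simp only [List.cons_append, List.cons.injEq, true_and]
        rw [← List.append_assoc, List.take_append_drop]
      have hsfx : ∀ n, (q.drop n ++ [b]).IsChain G.Adj := by
        intro n
        refine hE.chain.suffix ⟨a :: q.take n, ?_⟩
        simp only [List.cons_append, List.cons.injEq, true_and]
        rw [← List.append_assoc, List.take_append_drop]
      by_cases c1 : A.length + 1 + k ≤ n1
      · -- attach everything to the first part
        obtain ⟨⟨i1, i2⟩, i3⟩ := hsplit (n1 - k) (by omega) (by omega)
        have ha : a ∈ L.take (n1 - k) := by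
          have : n1 - k = A.length + ((n1 - k - A.length - 1) + 1) := by omega
          rw [hL, this, List.take_length_add_append]
          simp
        refine finish h hE (L.take (n1 - k) ++ q.take k) (L.drop (n1 - k)) (q.take k) ?_
          (List.take_sublist _ _) (by simp; omega) (by simp; omega) ⟨by simp [i1], ?_⟩ i3
        · have : (L.take (n1 - k) ++ q.take k ++ L.drop (n1 - k)).Perm
              (L.take (n1 - k) ++ (L.drop (n1 - k) ++ q.take k)) := by
            rw [List.append_assoc]
            exact List.perm_append_comm.append_left _
          rwa [← List.append_assoc, List.take_append_drop] at this
        · rw [List.toFinset_append]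
          exact cn_attach i2 (by simpa using ha) _ (hpfx k)
      · by_cases c2 : n1 < A.length + 1
        · -- attach everything to the second part
          obtain ⟨i1, i3, i4⟩ := hsplit n1 (by omega) (by omega)
          have ha : a ∈ L.drop n1 := by
            rw [hL, List.drop_append_of_le_length (by omega)]
            simp
          refine finish h hE (L.take n1) (L.drop n1 ++ q.take k) (q.take k) ?_
            (List.take_sublist _ _) (by simp; omega) (by simp; omega) i1 ⟨by simp [i3], ?_⟩
          · rw [← List.append_assoc, List.take_append_drop]
          · rw [List.toFinset_append]
            exact cn_attach i4 (by simpa using ha) _ (hpfx k)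
        · -- attach to both parts
          obtain ⟨⟨i1, i2⟩, i3, i4⟩ := h.split (A ++ [a]) B (by simp [hL]) (by simp)
            (List.ne_nil_of_mem hb)
          set i := n1 - (A.length + 1) with hi
          set m := q.length - (k - i) with hm
          refine finish h hE ((A ++ [a]) ++ q.take i) (B ++ q.drop m) (q.take i ++ q.drop m) ?_
            ?_ (by simp; omega) (by simp; omega) ⟨List.mem_append_left _ i1, ?_⟩
            ⟨List.mem_append_left _ i3, ?_⟩
          · have : ((A ++ [a]) ++ q.take i ++ (B ++ q.drop m)).Perm
                ((A ++ [a]) ++ (B ++ (q.take i ++ q.drop m))) := by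
              rw [List.append_assoc]
              refine List.Perm.append_left _ ?_
              rw [← List.append_assoc, ← List.append_assoc]
              exact List.perm_append_comm.append_right _
            rw [hL]
            simpa using this
          · have h1 : (q.take i ++ q.drop m).Sublist (q.take m ++ q.drop m) :=
              (List.take_sublist_take_left (by omega)).append_right _
            rwa [List.take_append_drop] at h1
          · rw [List.toFinset_append]
            exact cn_attach i2 (s := a) (by simp) _ (hpfx i)
          · rw [List.toFinset_append]
            exact cn_attach_back i4 (s := b) (by simpa using hb) _ (hsfx m)

lemma inv_init {x y1 y2 y3 : V} (hsep : Sep G x)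
    (hN : ∀ v, G.Adj x v → v = y1 ∨ v = y2 ∨ v = y3) (h12 : y1 ≠ y2) (h13 : y1 ≠ y3) (h23 : y2 ≠ y3)
    (h1x : y1 ≠ x) (h2x : y2 ≠ x) (h3x : y3 ≠ x) : Inv G x y1 y2 y3 [y1, y2] := by
  refine ⟨by simp [h12], by simp [h1x.symm, h2x.symm], by simp [h13.symm, h23.symm], ?_, ?_⟩
  · have hy3 : y3 ∈ rest x [y1, y2] := by simp [mem_rest, h3x, h13.symm, h23.symm]
    obtain ⟨D, hDS, hyD, hD, hcl⟩ := exists_comp (G := G) hy3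
    have : D = rest x [y1, y2] := by
      refine Finset.Subset.antisymm hDS ?_
      intro d hd
      by_contra hdD
      obtain ⟨E, hES, hdE, -, hEcl⟩ := exists_comp (G := G) (S := rest x [y1, y2] \ D) (d := d)
        (by rw [Finset.mem_sdiff]; exact ⟨hd, hdD⟩)
      have := hsep E {y1, y2} ⟨d, hdE⟩
        (fun h => (mem_rest.1 (Finset.mem_sdiff.1 (hES h)).1).1 rfl)
        (by simp [h1x.symm, h2x.symm])
        (by
          rw [Finset.disjoint_left]
          intro z hz hz'
          have := (mem_rest.1 (Finset.mem_sdiff.1 (hES hz)).1).2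
          simp at this hz'
          tauto)
        (by
          intro u hu v huv
          have hu1 := Finset.mem_sdiff.1 (hES hu)
          have hu2 := mem_rest.1 hu1.1
          by_cases hvx : v = x
          · subst hvx
            rcases hN u huv.symm with rfl | rfl | rfl
            · simp at hu2
            · simp at hu2
            · exact absurd hyD hu1.2
          · by_cases hv : v ∈ [y1, y2]
            · right; simpa using hv
            · left
              have hvr : v ∈ rest x [y1, y2] := mem_rest.2 ⟨hvx, hv⟩
              refine hEcl u hu v ?_ huv
              rw [Finset.mem_sdiff]
              exact ⟨hvr, fun hvD => hu1.2 (hcl v hvD u hu1.1 huv.symm)⟩)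
      rw [Finset.card_pair h12] at this
      omega
    rwa [← this]
  · intro A B hAB hA hB
    cases A with
    | nil => exact absurd rfl hA
    | cons c A =>
      cases A with
      | nil =>
        simp only [List.cons_append, List.nil_append, List.cons.injEq] at hAB
        obtain ⟨rfl, rfl⟩ := hAB
        simp [cn_singleton]
      | cons d A =>
        simp only [List.cons_append, List.cons.injEq] at hAB
        have := hAB.2.2
        simp at this
        exact absurd this.2 hB

lemma partition [DecidableRel G.Adj] {x : V} (hdeg : G.degree x = 3) (hsep : Sep G x) (s : V → ℕ)
    (hs : ∀ y, G.Adj x y → 1 ≤ s y) (hsum : ∑ y ∈ G.neighborFinset x, s y + 1 = Fintype.card V) :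
    ∃ c : V → V, (∀ v, v ≠ x → G.Adj x (c v)) ∧ (∀ y, G.Adj x y → c y = y) ∧
      ∀ y, G.Adj x y → Cn G (univ.filter fun v => v ≠ x ∧ c v = y) ∧
        (univ.filter fun v => v ≠ x ∧ c v = y).card = s y := by
  obtain ⟨y1, y2, y3, h12, h13, h23, hN⟩ := Finset.card_eq_three.1 hdeg
  have hadj : ∀ v, G.Adj x v ↔ v = y1 ∨ v = y2 ∨ v = y3 := by
    intro v
    rw [← SimpleGraph.mem_neighborFinset, hN]; simp
  have a1 : G.Adj x y1 := by simp [hadj]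
  have a2 : G.Adj x y2 := by simp [hadj]
  have a3 : G.Adj x y3 := by simp [hadj]
  have hsum' : s y1 + s y2 + s y3 + 1 = Fintype.card V := by
    rw [← hsum, hN, Finset.sum_insert (by simp [h12, h13]), Finset.sum_insert (by simp [h23]),
      Finset.sum_singleton]
    ring
  have k1 := hs y1 a1
  have k2 := hs y2 a2
  have k3 := hs y3 a3
  have hI := inv_init hsep (fun v => (hadj v).1) h12 h13 h23 a1.ne' a2.ne' a3.ne'
  obtain ⟨l1, l2, hnd, hl1, hl2, m1, m2, hx, m3, c1, c2, c3⟩ :=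
    tri_of_inv hsep (fun v => (hadj v).1) a3.ne' k1 k2 (by omega) (s y1 + s y2 - 2) [y1, y2] hI
      (by simp) (by simp; omega)
  have hnd' := List.nodup_append.1 hnd
  have hdis : ∀ v, v ∈ l1 → v ∈ l2 → False := fun v h1 h2 => hnd'.2.2 v h1 v h2 rfl
  simp only [List.mem_append, not_or] at hx m3
  have e1 : (univ.filter fun v => v ≠ x ∧ (if v ∈ l1 then y1 else if v ∈ l2 then y2 else y3) = y1)
      = l1.toFinset := by
    ext v
    simp only [Finset.mem_filter, Finset.mem_univ, true_and, List.mem_toFinset]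
    constructor
    · rintro ⟨-, h⟩
      split_ifs at h with i1 i2
      · exact i1
      · exact absurd h.symm h12
      · exact absurd h.symm h13
    · intro h
      refine ⟨?_, by simp [h]⟩
      rintro rfl
      exact hx.1 h
  have e2 : (univ.filter fun v => v ≠ x ∧ (if v ∈ l1 then y1 else if v ∈ l2 then y2 else y3) = y2)
      = l2.toFinset := by
    ext v
    simp only [Finset.mem_filter, Finset.mem_univ, true_and, List.mem_toFinset]
    constructor
    · rintro ⟨-, h⟩
      split_ifs at h with i1 i2
      · exact absurd h h12
      · exact i2
      · exact absurd h.symm h23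
    · intro h
      have : v ∉ l1 := fun h' => hdis v h' h
      refine ⟨?_, by simp [h, this]⟩
      rintro rfl
      exact hx.2 h
  have e3 : (univ.filter fun v => v ≠ x ∧ (if v ∈ l1 then y1 else if v ∈ l2 then y2 else y3) = y3)
      = rest x (l1 ++ l2) := by
    ext v
    simp only [Finset.mem_filter, Finset.mem_univ, true_and, mem_rest, List.mem_append, not_or]
    constructor
    · rintro ⟨hvx, h⟩
      split_ifs at h with i1 i2
      · exact absurd h h13
      · exact absurd h h23
      · exact ⟨hvx, i1, i2⟩
    · rintro ⟨h, i1, i2⟩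
      exact ⟨h, by simp [i1, i2]⟩
  have d3 : (rest x (l1 ++ l2)).card = s y3 := by
    unfold rest
    rw [Finset.card_sdiff_of_subset, List.toFinset_card_of_nodup hnd,
      Finset.card_sdiff_of_subset (by simp)]
    · simp; omega
    · intro z hz
      simp only [List.mem_toFinset, List.mem_append] at hz
      simp only [Finset.mem_sdiff, Finset.mem_univ, Finset.mem_singleton, true_and]
      rintro rfl
      tauto
  refine ⟨fun v => if v ∈ l1 then y1 else if v ∈ l2 then y2 else y3, ?_, ?_, ?_⟩
  · intro v _
    dsimp only
    split_ifs <;> assumption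
  · intro y hy
    rcases (hadj y).1 hy with rfl | rfl | rfl
    · simp [m1]
    · have : y ∉ l1 := fun h' => hdis y h' m2
      simp [m2, this]
    · simp [m3]
  · intro y hy
    rcases (hadj y).1 hy with rfl | rfl | rfl
    · rw [e1]
      exact ⟨c1, by rw [List.toFinset_card_of_nodup hnd'.1, hl1]⟩
    · rw [e2]
      exact ⟨c2, by rw [List.toFinset_card_of_nodup hnd'.2.1, hl2]⟩
    · rw [e3]
      exact ⟨c3, d3⟩

lemma source [DecidableRel G.Adj] {x : V} (hdeg : G.degree x = 3) (hsep : Sep G x) (s : V → ℕ)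
    (hs : ∀ y, G.Adj x y → 1 ≤ s y) (hsum : ∑ y ∈ G.neighborFinset x, s y + 1 = Fintype.card V) :
    ∃ w : ∀ u, G.Walk x u, (∀ u, (w u).IsPath) ∧ ∀ v, v ≠ x → ∃ y, G.Adj x y ∧
      ((v = y ∧ (univ.filter fun u => x ≠ u ∧ v ∈ (w u).support ∧ v ≠ x ∧ v ≠ u).card + 1 ≤ s y) ∨
      (v ≠ y ∧ ¬ G.Adj x v ∧
        (univ.filter fun u => x ≠ u ∧ v ∈ (w u).support ∧ v ≠ x ∧ v ≠ u).card + 2 ≤ s y ∧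
        (¬ G.Adj y v →
          (univ.filter fun u => x ≠ u ∧ v ∈ (w u).support ∧ v ≠ x ∧ v ≠ u).card + 3 ≤ s y))) := by
  obtain ⟨c, hc1, hc2, hc3⟩ := partition hdeg hsep s hs hsum
  have hw : ∀ u, ∃ p : G.Walk x u, p.IsPath ∧
      (u ≠ x → ∀ z ∈ p.support, z = x ∨ (z ≠ x ∧ c z = c u)) ∧
      (u ≠ x → u = c u ∨ G.Adj (c u) u → ∀ z ∈ p.support, z = x ∨ z = c u ∨ z = u) := by
    intro u
    by_cases hux : u = x
    · subst hux
      exact ⟨SimpleGraph.Walk.nil, by simp, by simp, by simp⟩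
    · have hxc := hc1 u hux
      have hcc := hc2 _ hxc
      by_cases h1 : u = c u
      · have hxu : G.Adj x u := by rw [h1]; exact hxc
        refine ⟨SimpleGraph.Walk.cons hxu SimpleGraph.Walk.nil, ?_, ?_, ?_⟩
        · simp [hxu.ne]
        · intro _ z hz
          simp at hz
          rcases hz with rfl | rfl
          · simp
          · simp [hux]
        · intro _ _ z hz
          simp at hz
          tauto
      · by_cases h2 : G.Adj (c u) u
        · refine ⟨SimpleGraph.Walk.cons hxc (SimpleGraph.Walk.cons h2 SimpleGraph.Walk.nil), ?_, ?_, ?_⟩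
          · simp [hxc.ne, h2.ne, Ne.symm hux]
          · intro _ z hz
            simp at hz
            rcases hz with rfl | rfl | rfl
            · simp
            · right; exact ⟨hxc.ne', hcc⟩
            · simp [hux]
          · intro _ _ z hz
            simp at hz
            tauto
        · have hconn := (hc3 _ hxc).1
          have m1 : c u ∈ (univ.filter fun v => v ≠ x ∧ c v = c u) := by
            simp [hcc, hxc.ne']
          have m2 : u ∈ (univ.filter fun v => v ≠ x ∧ c v = c u) := by simp [hux]
          obtain ⟨p, hp, -⟩ := hconn.exists_path_of_dist ⟨c u, m1⟩ ⟨u, m2⟩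
          let p' : G.Walk (c u) u := p.map (SimpleGraph.Embedding.induce _).toHom
          have hs : p'.support = p.support.map Subtype.val := SimpleGraph.Walk.support_map _ _
          have hp' : p'.IsPath := SimpleGraph.Walk.IsPath.map Subtype.val_injective hp
          have hmem : ∀ z ∈ p'.support, z ≠ x ∧ c z = c u := by
            intro z hz
            rw [hs, List.mem_map] at hz
            obtain ⟨w, -, rfl⟩ := hz
            have := w.2
            rw [Finset.mem_coe, Finset.mem_filter] at this
            exact this.2
          refine ⟨SimpleGraph.Walk.cons hxc p', ?_, ?_, ?_⟩
          · rw [SimpleGraph.Walk.cons_isPath_iff]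
            exact ⟨hp', fun h => (hmem x h).1 rfl⟩
          · intro _ z hz
            rw [SimpleGraph.Walk.support_cons, List.mem_cons] at hz
            rcases hz with h | h
            · exact Or.inl h
            · exact Or.inr (hmem z h)
          · intro _ h
            tauto
  choose w hwp hw1 hw2 using hw
  refine ⟨w, hwp, ?_⟩
  intro v hvx
  have hxc := hc1 v hvx
  have hcc := hc2 _ hxc
  obtain ⟨hconn, hcard⟩ := hc3 _ hxc
  refine ⟨c v, hxc, ?_⟩
  set P := univ.filter fun u => u ≠ x ∧ c u = c v with hP
  set F := univ.filter fun u => x ≠ u ∧ v ∈ (w u).support ∧ v ≠ x ∧ v ≠ u with hF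
  have hvP : v ∈ P := by simp [hP, hvx]
  have hcP : c v ∈ P := by simp [hP, hxc.ne', hcc]
  have hFP : ∀ u ∈ F, u ∈ P ∧ u ≠ v := by
    intro u hu
    rw [hF, Finset.mem_filter] at hu
    obtain ⟨-, h1, h2, -, h4⟩ := hu
    refine ⟨?_, h4.symm⟩
    rw [hP, Finset.mem_filter]
    refine ⟨Finset.mem_univ _, h1.symm, ?_⟩
    rcases hw1 u h1.symm v h2 with h | h
    · exact absurd h hvx
    · exact h.2.symm
  by_cases hvc : v = c v
  · left
    refine ⟨hvc, ?_⟩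
    have : F ⊆ P.erase v := by
      intro u hu
      rw [Finset.mem_erase]
      exact ⟨(hFP u hu).2, (hFP u hu).1⟩
    have h1 := Finset.card_le_card this
    rw [Finset.card_erase_of_mem hvP] at h1
    have : 0 < P.card := Finset.card_pos.2 ⟨v, hvP⟩
    omega
  · right
    have hcF : c v ∉ F := by
      intro h
      rw [hF, Finset.mem_filter] at h
      obtain ⟨-, h1, h2, -, h4⟩ := h
      rcases hw2 (c v) h1.symm (Or.inl hcc.symm) v h2 with h | h | h
      · exact hvx h
      · rw [hcc] at h; exact hvc h
      · exact hvc h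
    have hsub : F ⊆ (P.erase v).erase (c v) := by
      intro u hu
      rw [Finset.mem_erase, Finset.mem_erase]
      exact ⟨fun h => hcF (h ▸ hu), (hFP u hu).2, (hFP u hu).1⟩
    have hcP' : c v ∈ P.erase v := Finset.mem_erase.2 ⟨fun h => hvc h.symm, hcP⟩
    have hc0 : ((P.erase v).erase (c v)).card + 2 = P.card := by
      have i1 := Finset.card_erase_add_one hcP'
      have i2 := Finset.card_erase_add_one hvP
      omega
    refine ⟨hvc, fun h => hvc (hc2 v h).symm, ?_, ?_⟩
    · have h1 := Finset.card_le_card hsub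
      omega
    · intro hna
      obtain ⟨a, -, z, hzP, ha, hz, haz⟩ := cn_leave hconn {c v} hcP rfl hvP hvc
      rw [Set.mem_singleton_iff] at ha hz
      subst ha
      have hzP' := hzP
      rw [hP, Finset.mem_filter] at hzP'
      have hzv : z ≠ v := by rintro rfl; exact hna haz
      have hzF : z ∉ F := by
        intro h
        rw [hF, Finset.mem_filter] at h
        obtain ⟨-, h1, h2, -, h4⟩ := h
        rw [← hzP'.2.2] at haz
        rcases hw2 z h1.symm (Or.inr haz) v h2 with h | h | h
        · exact hvx h
        · rw [hzP'.2.2] at h; exact hvc h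
        · exact hzv h.symm
      have hz2 : z ∈ (P.erase v).erase (c v) := by
        rw [Finset.mem_erase, Finset.mem_erase]
        exact ⟨hz, hzv, hzP⟩
      have hsub2 : F ⊆ ((P.erase v).erase (c v)).erase z := by
        intro u hu
        rw [Finset.mem_erase]
        exact ⟨fun h => hzF (h ▸ hu), hsub hu⟩
      have h1 := Finset.card_le_card hsub2
      have i3 := Finset.card_erase_add_one hz2
      omega

lemma exists_perm [DecidableRel G.Adj] (hreg : G.IsRegularOfDegree 3) :
    ∃ f : V → V, Function.Bijective f ∧ ∀ v, G.Adj v (f v) := by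
  obtain ⟨f, hf, hf2⟩ := (Finset.all_card_le_biUnion_card_iff_exists_injective
    (fun v => G.neighborFinset v)).1 (by
      intro S
      have := Finset.card_mul_le_card_mul G.Adj (s := S)
        (t := S.biUnion fun v => G.neighborFinset v) (m := 3) (n := 3)
        (by
          intro a ha
          rw [← hreg a]
          refine Finset.card_le_card ?_
          intro b hb
          simp only [Finset.bipartiteAbove, Finset.mem_filter, Finset.mem_biUnion]
          exact ⟨⟨a, ha, hb⟩, by simpa using hb⟩)
        (by
          intro b hb
          rw [← hreg b]
          refine Finset.card_le_card ?_
          intro a ha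
          simp only [Finset.bipartiteBelow, Finset.mem_filter] at ha
          simpa using ha.2.symm)
      omega)
  exact ⟨f, Finite.injective_iff_bijective.1 hf, fun v => by simpa using hf2 v⟩

/-- Summation of the loads contributed by the different sources. -/
lemma load_sum {F g : V → ℤ} {v : V} {a k m : ℤ} (h0 : F v = 0) (hg : 0 ≤ g v)
    (h : ∀ x, x ≠ v → F x + k ≤ a + g x) (hm : ∑ x, g x = m) :
    ∑ x, F x + k * ((Fintype.card V : ℤ) - 1) ≤ a * ((Fintype.card V : ℤ) - 1) + m := by
  have h1 : ∑ x ∈ univ.erase v, (F x + k) ≤ ∑ x ∈ univ.erase v, (a + g x) :=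
    Finset.sum_le_sum fun x hx => h x (Finset.ne_of_mem_erase hx)
  have hc : ((univ.erase v).card : ℤ) = (Fintype.card V : ℤ) - 1 := by
    rw [Finset.cast_card_erase_of_mem (Finset.mem_univ v)]; simp
  rw [Finset.sum_add_distrib, Finset.sum_add_distrib, Finset.sum_const, Finset.sum_const,
    nsmul_eq_mul, nsmul_eq_mul, hc] at h1
  have h2 := Finset.add_sum_erase univ F (Finset.mem_univ v)
  have h3 := Finset.add_sum_erase univ g (Finset.mem_univ v)
  linarith

lemma sum_adj [DecidableRel G.Adj] (hreg : G.IsRegularOfDegree 3) (v : V) :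
    ∑ x, (if G.Adj x v then (1 : ℤ) else 0) = 3 := by
  rw [Finset.sum_boole, ← Nat.cast_ofNat, ← hreg v]
  congr 1
  refine congrArg Finset.card ?_
  ext z
  simp [SimpleGraph.adj_comm]

lemma xi_le_of_routing {R : Forwarding.Routing G} {M : ℤ} (h0 : 0 ≤ M)
    (h : ∀ v, (Forwarding.vertexLoad R v : ℤ) ≤ M) : (Forwarding.xi G : ℤ) ≤ M := by
  lift M to ℕ using h0
  have h1 : Forwarding.xi G ≤ Forwarding.routingVertexIndex R := Nat.sInf_le ⟨R, rfl⟩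
  have h2 : Forwarding.routingVertexIndex R ≤ M :=
    Finset.sup_le fun v _ => by exact_mod_cast h v
  exact_mod_cast h1.trans h2

lemma load_eq (R : Forwarding.Routing G) (v : V) : (Forwarding.vertexLoad R v : ℤ) =
    ∑ x, ((univ.filter fun u => x ≠ u ∧ v ∈ (R.walk x u).support ∧ v ≠ x ∧ v ≠ u).card : ℤ) := by
  unfold Forwarding.vertexLoad
  rw [← Nat.cast_sum]
  congr 1
  simp only [Finset.card_filter]
  rw [Fintype.sum_prod_type]

lemma exists_routing [DecidableRel G.Adj] (hreg : G.IsRegularOfDegree 3) (hsep : ∀ x, Sep G x)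
    {f : V → V} (hf : ∀ v, G.Adj v (f v)) {α β : ℕ} (hα : 1 ≤ α) (hβ : 1 ≤ β)
    (hsum : α + 2 * β + 1 = Fintype.card V) :
    ∃ R : Forwarding.Routing G, ∀ x v, x ≠ v → ∃ y, G.Adj x y ∧
      ((v = y ∧ (univ.filter fun u => x ≠ u ∧ v ∈ (R.walk x u).support ∧ v ≠ x ∧ v ≠ u).card + 1
        ≤ if y = f x then α else β) ∨
      (v ≠ y ∧ ¬ G.Adj x v ∧
        (univ.filter fun u => x ≠ u ∧ v ∈ (R.walk x u).support ∧ v ≠ x ∧ v ≠ u).card + 2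
          ≤ (if y = f x then α else β) ∧
        (¬ G.Adj y v →
          (univ.filter fun u => x ≠ u ∧ v ∈ (R.walk x u).support ∧ v ≠ x ∧ v ≠ u).card + 3
            ≤ if y = f x then α else β))) := by
  have h : ∀ x, _ := fun x => source (G := G) (x := x) (hreg x) (hsep x)
    (fun y => if y = f x then α else β) (fun y _ => by split_ifs <;> assumption)
    (by
      have hm : f x ∈ G.neighborFinset x := by simpa using hf x
      rw [← Finset.add_sum_erase _ _ hm, if_pos rfl, Finset.sum_congr rfl (g := fun _ => β)
        (fun y hy => if_neg (Finset.ne_of_mem_erase hy)), Finset.sum_const,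
        Finset.card_erase_of_mem hm, SimpleGraph.card_neighborFinset_eq_degree, hreg x, smul_eq_mul]
      omega)
  choose w hw1 hw2 using h
  exact ⟨⟨w, hw1⟩, fun x v hxv => hw2 x v hxv.symm⟩

end CubicRouting

/-- If `G` is a `3`-regular, `3`-connected graph on
`n ≥ 4` vertices, then `ξ(G) ≤ ⌈(n-3)(n-4)/3⌉`. -/
theorem xi_cubic_three_connected {V : Type*} [Fintype V] [DecidableEq V]
    (G : SimpleGraph V) [DecidableRel G.Adj] (hreg : G.IsRegularOfDegree 3)
    (hG : IsKConnected 3 G) (hn : 4 ≤ Fintype.card V) :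
    (Forwarding.xi G : ℤ) ≤
      ⌈(((Fintype.card V : ℚ) - 3) * ((Fintype.card V : ℚ) - 4)) / 3⌉ := by
  classical
  open CubicRouting in
  have hsep : ∀ x, Sep G x := fun x => sep_of_conn hG.2 x
  obtain ⟨f, hfb, hf⟩ := CubicRouting.exists_perm hreg
  set n := Fintype.card V with hncard
  have heven : ¬ n = 5 := by
    intro h5
    have h1 := G.sum_degrees_eq_twice_card_edges
    rw [Finset.sum_congr rfl (g := fun _ => 3) (fun v _ => hreg v), Finset.sum_const,
      Finset.card_univ, ← hncard, h5, smul_eq_mul] at h1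
    omega
  have hfin : ∀ M : ℤ, 0 ≤ M → 3 * M ≤ ((n : ℤ) - 3) * ((n : ℤ) - 4) + 2 →
      (∃ R : Forwarding.Routing G, ∀ v, (Forwarding.vertexLoad R v : ℤ) ≤ M) →
      (Forwarding.xi G : ℤ) ≤ ⌈(((n : ℚ) - 3) * ((n : ℚ) - 4)) / 3⌉ := by
    rintro M h0 hM ⟨R, hR⟩
    refine (CubicRouting.xi_le_of_routing h0 hR).trans ?_
    rw [Int.le_ceil_iff, lt_div_iff₀ (by norm_num)]
    have : (3 * M : ℚ) ≤ ((n : ℚ) - 3) * ((n : ℚ) - 4) + 2 := by exact_mod_cast hM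
    linarith
  have s1 : ∀ v, ∑ x, (if f x = v then (1 : ℤ) else 0) = 1 := by
    intro v
    rw [hfb.sum_comp (fun z => if z = v then (1 : ℤ) else 0)]
    simp
  have s2 : ∀ v, ∑ x, (if G.Adj (f x) v then (1 : ℤ) else 0) = 3 := by
    intro v
    rw [hfb.sum_comp (fun z => if G.Adj z v then (1 : ℤ) else 0)]
    exact CubicRouting.sum_adj hreg v
  have s3 := CubicRouting.sum_adj hreg
  obtain ⟨a, ha | ha | ha⟩ : ∃ a : ℕ, n = 3 * a + 1 ∨ n = 3 * a ∨ n + 1 = 3 * a :=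
    ⟨(n + 1) / 3, by omega⟩
  · -- `n = 3 a + 1`: three parts of size `a`
    obtain ⟨R, hR⟩ := CubicRouting.exists_routing hreg hsep hf (α := a) (β := a) (by omega)
      (by omega) (by omega)
    have hn' : (n : ℤ) = 3 * a + 1 := by exact_mod_cast ha
    have ha1 : (1 : ℤ) ≤ a := by omega
    refine hfin ((n - 1) * (a - 2) + 3) ?_ ?_ ⟨R, ?_⟩
    · rw [hn']; nlinarith
    · rw [hn']; nlinarith
    · intro v
      rw [CubicRouting.load_eq]
      have := CubicRouting.load_sum (v := v) (k := 2) (a := a) (m := 3)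
        (F := fun x => ((univ.filter fun u => x ≠ u ∧ v ∈ (R.walk x u).support ∧ v ≠ x ∧ v ≠ u).card : ℤ))
        (g := fun x => if G.Adj x v then (1 : ℤ) else 0) (by simp) (by simp)
        (by
          intro x hxv
          obtain ⟨y, hxy, h | h⟩ := hR x v hxv
          · obtain ⟨rfl, h⟩ := h
            rw [if_pos hxy]
            split_ifs at h <;> omega
          · obtain ⟨h1, h2, h3, h4⟩ := h
            rw [if_neg h2]
            split_ifs at h3 <;> omega)
        (s3 v)
      rw [← hncard] at this
      linarith
  · -- `n = 3 a`: the part of `f x` has size `a - 1`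
    obtain ⟨R, hR⟩ := CubicRouting.exists_routing hreg hsep hf (α := a - 1) (β := a) (by omega)
      (by omega) (by omega)
    have hn' : (n : ℤ) = 3 * a := by exact_mod_cast ha
    have ha1 : (2 : ℤ) ≤ a := by omega
    refine hfin ((n - 1) * (a - 2) + 2) ?_ ?_ ⟨R, ?_⟩
    · rw [hn']; nlinarith
    · rw [hn']; nlinarith
    · intro v
      rw [CubicRouting.load_eq]
      have := CubicRouting.load_sum (v := v) (k := 2) (a := a) (m := 2)
        (F := fun x => ((univ.filter fun u => x ≠ u ∧ v ∈ (R.walk x u).support ∧ v ≠ x ∧ v ≠ u).card : ℤ))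
        (g := fun x => (if G.Adj x v then (1 : ℤ) else 0) - if f x = v then (1 : ℤ) else 0)
        (by simp) (by simp [(hf v).ne'])
        (by
          intro x hxv
          obtain ⟨y, hxy, h | h⟩ := hR x v hxv
          · obtain ⟨rfl, h⟩ := h
            rw [if_pos hxy]
            by_cases hv : v = f x
            · rw [if_pos hv] at h
              rw [if_pos hv.symm]
              omega
            · rw [if_neg hv] at h
              rw [if_neg (Ne.symm hv)]
              omega
          · obtain ⟨h1, h2, h3, h4⟩ := h
            have hv : f x ≠ v := by rintro rfl; exact h2 (hf x)
            rw [if_neg h2, if_neg hv]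
            split_ifs at h3 <;> omega)
        (by rw [Finset.sum_sub_distrib, s1, s3]; norm_num)
      rw [← hncard] at this
      linarith
  · -- `n = 3 a - 1`: the part of `f x` has size `a`, the others have size `a - 1`
    obtain ⟨R, hR⟩ := CubicRouting.exists_routing hreg hsep hf (α := a) (β := a - 1) (by omega)
      (by omega) (by omega)
    have hn' : (n : ℤ) = 3 * a - 1 := by omega
    have ha1 : (3 : ℤ) ≤ a := by omega
    refine hfin ((n - 1) * (a - 3) + 7) ?_ ?_ ⟨R, ?_⟩
    · rw [hn']; nlinarith
    · rw [hn']; nlinarith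
    · intro v
      rw [CubicRouting.load_eq]
      have := CubicRouting.load_sum (v := v) (k := 3) (a := a) (m := 7)
        (F := fun x => ((univ.filter fun u => x ≠ u ∧ v ∈ (R.walk x u).support ∧ v ≠ x ∧ v ≠ u).card : ℤ))
        (g := fun x => (if G.Adj x v then (1 : ℤ) else 0) + (if f x = v then (1 : ℤ) else 0)
          + if G.Adj (f x) v then (1 : ℤ) else 0)
        (by simp) (by split_ifs <;> norm_num)
        (by
          intro x hxv
          have hp1 : (0 : ℤ) ≤ if f x = v then (1 : ℤ) else 0 := by split_ifs <;> norm_num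
          have hp2 : (0 : ℤ) ≤ if G.Adj (f x) v then (1 : ℤ) else 0 := by split_ifs <;> norm_num
          obtain ⟨y, hxy, h | h⟩ := hR x v hxv
          · obtain ⟨rfl, h⟩ := h
            rw [if_pos hxy]
            by_cases hv : v = f x
            · rw [if_pos hv] at h
              rw [if_pos hv.symm]
              omega
            · rw [if_neg hv] at h
              omega
          · obtain ⟨h1, h2, h3, h4⟩ := h
            rw [if_neg h2]
            by_cases hy : y = f x
            · rw [if_pos hy] at h3 h4
              rw [hy] at h4
              by_cases hyv : G.Adj (f x) v
              · rw [if_pos hyv]; omega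
              · have := h4 hyv; omega
            · rw [if_neg hy] at h3
              omega)
        (by rw [Finset.sum_add_distrib, Finset.sum_add_distrib, s1, s2, s3]; norm_num)
      rw [← hncard] at this
      linarith
end
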